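/- For every prime p, the proportion of entries in the character table of the Weyl group D_N of type D that are divisible by p tends to 1 as N → ∞. -/

import Mathlib

open CategoryTheory Filter

/-- The hyperoctahedral group `B_N = (ℤ/2ℤ) ≀ S_N`, realized with `{±1} = ℤˣ` entries:
the semidirect product `(ℤˣ)^N ⋊ S_N` (i.e. `N×N` signed permutation matrices). -/
abbrev HyperoctahedralGroup (N : ℕ) : Type :=
  (Fin N → ℤˣ) ⋊[mulAutArrow] Equiv.Perm (Fin N)

/-- The product-of-entries character of `B_N`. -/
def wreathSign (N : ℕ) : HyperoctahedralGroup N →* ℤˣ where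
  toFun x := ∏ i, x.left i
  map_one' := by simp
  map_mul' a b := by
    simp only [SemidirectProduct.mul_left, Pi.mul_apply, Finset.prod_mul_distrib]
    congr 1
    simp only [mulAutArrow_apply_apply]
    exact Equiv.prod_comp _ _

/-- The Weyl group of type `D_N`: the index-two subgroup of `B_N` of signed permutation
matrices with an even number of `−1` entries, i.e. the kernel of `wreathSign`. -/
def WeylD (N : ℕ) : Subgroup (HyperoctahedralGroup N) := (wreathSign N).ker

/-- The set of complex irreducible characters of a group `H`. -/
def IrrChar (H : Type) [Group H] : Type :=
  { f : H → ℂ // ∃ V : FDRep ℂ H, Simple V ∧ V.character = f }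

/-- An entry of the character table is divisible by `p` if its value on the conjugacy
class is `p` times an integer. -/
def EntryDivisible {H : Type} [Group H] (p : ℕ)
    (χ : IrrChar H) (c : ConjClasses H) : Prop :=
  ∃ g ∈ c.carrier, ∃ m : ℤ, χ.1 g = (p : ℂ) * m

section

open scoped MonoidAlgebra

lemma simple_of_irreducible {G : Type} [Group G] [Finite G] {V : Type}
    [AddCommGroup V] [Module ℂ V] [FiniteDimensional ℂ V]
    (ρ : Representation ℂ G V) [ρ.IsIrreducible] : Simple (FDRep.of ρ) := by
  classical
  have := Fintype.ofFinite G
  have hne : (Nat.card G : ℂ) ≠ 0 := by exact_mod_cast Nat.card_pos.ne'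
  have := invertibleOfNonzero hne
  rw [FDRep.simple_iff_char_is_norm_one]
  have h := Representation.char_orthonormal ρ ρ
  rw [if_pos ⟨Representation.Equiv.refl ρ⟩] at h
  rw [inv_mul_eq_one₀ hne] at h
  exact h.symm

lemma irreducible_ofModule' {G : Type} [Group G] (M : Type) [AddCommGroup M] [Module ℂ M]
    [Module ℂ[G] M] [IsScalarTower ℂ ℂ[G] M] [IsSimpleModule ℂ[G] M] :
    (Representation.ofModule' (k := ℂ) (G := G) M).IsIrreducible := by
  rw [Representation.irreducible_iff_isSimpleModule_asModule]
  let e : (Representation.ofModule' (k := ℂ) (G := G) M).asModule ≃ₗ[ℂ[G]] M :=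
    { (Representation.ofModule' (k := ℂ) (G := G) M).asModuleEquiv.toAddEquiv with
      map_smul' := by
        intro r x
        have : (Representation.ofModule' (k := ℂ) (G := G) M).asAlgebraHom = Algebra.lsmul ℂ ℂ M := by
          simp [Representation.ofModule', Representation.asAlgebraHom]
        have h2 := Representation.asModuleEquiv_map_smul (Representation.ofModule' (k := ℂ) (G := G) M) r x
        rw [this] at h2
        exact h2 }
  exact IsSimpleModule.congr e

lemma eq_zero_of_orthogonal {G : Type} [Group G] [Fintype G] (f : G → ℂ)
    (hf : ∀ g h, f (h * g * h⁻¹) = f g)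
    (ho : ∀ χ : IrrChar G, ∑ g, f g * χ.1 g = 0) : f = 0 := by
  classical
  let a : ℂ[G] := ∑ g, MonoidAlgebra.single g (f g)
  have hc : ∀ b : ℂ[G], a * b = b * a := by
    intro b
    induction b using MonoidAlgebra.induction_on with
    | of h =>
      simp only [a, Finset.sum_mul, Finset.mul_sum, MonoidAlgebra.of_apply,
        MonoidAlgebra.single_mul_single, mul_one, one_mul]
      refine Finset.sum_equiv ((MulAut.conj h⁻¹).toEquiv) (by simp) ?_
      intro g _
      have := hf g h⁻¹
      simp only [inv_inv] at this
      simp [← this, mul_assoc]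
    | add x y hx hy => rw [mul_add, add_mul, hx, hy]
    | smul r x hx => rw [mul_smul_comm, smul_mul_assoc, hx]
  have key : ∀ S : Submodule ℂ[G] ℂ[G], IsSimpleModule ℂ[G] S → ∀ x ∈ S, a * x = 0 := by
    intro S hS
    have : Module.Finite ℂ S := Module.Finite.of_injective (S.subtype.restrictScalars ℂ) Subtype.val_injective
    let φ : Module.End ℂ[G] S :=
      { toFun := fun x => a • x
        map_add' := smul_add a
        map_smul' := by
          intro r x
          simp only [smul_smul, RingHom.id_apply, hc] }
    obtain ⟨c, hcφ⟩ := (IsSimpleModule.algebraMap_end_bijective_of_isAlgClosed (A := ℂ[G]) (V := S) ℂ).2 φ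
    have hcx : ∀ x : S, a • x = c • x := by
      intro x
      have := congrArg (fun ψ => ψ x) hcφ
      simpa [φ] using this.symm
    have hirr := irreducible_ofModule' (G := G) S
    have hsimp := simple_of_irreducible (Representation.ofModule' (k := ℂ) (G := G) S)
    have h0 := ho ⟨_, _, hsimp, rfl⟩
    have htr : LinearMap.trace ℂ S (Algebra.lsmul ℂ ℂ S a) = 0 := by
      rw [← h0]
      simp only [a, map_sum]
      refine Finset.sum_congr rfl fun g _ => ?_
      have : (MonoidAlgebra.single g (f g) : ℂ[G]) = f g • MonoidAlgebra.single g 1 := by simp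
      rw [this, map_smul, map_smul, smul_eq_mul]
      rfl
    have h2 : (Algebra.lsmul ℂ ℂ S a) = c • (1 : Module.End ℂ S) := by
      refine LinearMap.ext fun x => ?_
      exact hcx x
    rw [h2, map_smul, LinearMap.trace_one, smul_eq_mul] at htr
    have : Nontrivial S := IsSimpleModule.nontrivial ℂ[G] S
    have hc0 : c = 0 := by
      rcases mul_eq_zero.1 htr with h | h
      · exact h
      · exact absurd h (by exact_mod_cast (Module.finrank_pos (R := ℂ) (M := S)).ne')
    intro x hx
    have := congrArg Subtype.val (hcx ⟨x, hx⟩)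
    simpa [hc0] using this
  have ha : a = 0 := by
    have htop : sSup {S : Submodule ℂ[G] ℂ[G] | IsSimpleModule ℂ[G] S} = ⊤ :=
      IsSemisimpleModule.sSup_simples_eq_top _ _
    let K : Submodule ℂ[G] ℂ[G] :=
      { carrier := {x | a * x = 0}
        add_mem' := by
          intro x y hx hy
          simp only [Set.mem_ofPred_eq] at *
          rw [mul_add, hx, hy, add_zero]
        zero_mem' := by simp
        smul_mem' := by
          intro r x hx
          simp only [Set.mem_ofPred_eq, smul_eq_mul] at *
          rw [← mul_assoc, hc, mul_assoc, hx, mul_zero] }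
    have hle : sSup {S : Submodule ℂ[G] ℂ[G] | IsSimpleModule ℂ[G] S} ≤ K :=
      sSup_le fun S hS x hx => key S hS x hx
    rw [htop] at hle
    have : (1 : ℂ[G]) ∈ K := hle trivial
    simpa [K] using this
  funext g
  have : a.coeff g = 0 := by rw [ha]; rfl
  simpa [a, Finsupp.single_apply, Finset.sum_ite_eq'] using this

end

lemma exists_int_sum_coprime_pow (n : ℕ) : ∀ ζ : ℂ, ζ ^ n = 1 →
    ∃ m : ℤ, ∑ j ∈ (Finset.range n).filter (fun j => n.Coprime j), ζ ^ j = m := by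
  induction n using Nat.strong_induction_on with
  | _ n ih =>
    intro ζ hζ
    rcases Nat.eq_zero_or_pos n with rfl | hn
    · exact ⟨0, by simp⟩
    have htot : ∃ m : ℤ, ∑ j ∈ Finset.range n, ζ ^ j = m := by
      by_cases h1 : ζ = 1
      · exact ⟨n, by simp [h1]⟩
      · refine ⟨0, ?_⟩
        have := geom_sum_eq h1 n
        rw [this, hζ]; simp
    have hsplit : ∑ j ∈ Finset.range n, ζ ^ j =
        ∑ d ∈ n.divisors, ∑ j ∈ (Finset.range n).filter (fun j => n.gcd j = d), ζ ^ j := by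
      rw [Finset.sum_fiberwise_of_maps_to]
      intro j _
      exact Nat.mem_divisors.2 ⟨Nat.gcd_dvd_left _ _, hn.ne'⟩
    have hpart : ∀ d ∈ n.divisors, ∑ j ∈ (Finset.range n).filter (fun j => n.gcd j = d), ζ ^ j
        = ∑ j ∈ (Finset.range (n / d)).filter (fun j => (n / d).Coprime j), (ζ ^ d) ^ j := by
      intro d hd
      obtain ⟨e, rfl⟩ := Nat.dvd_of_mem_divisors hd
      have hd0 : 0 < d := Nat.pos_of_mul_pos_right hn
      rw [Nat.mul_div_cancel_left _ hd0]
      symm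
      refine Finset.sum_bij (fun j _ => d * j) ?_ ?_ ?_ ?_
      · intro j hj
        simp only [Finset.mem_filter, Finset.mem_range] at hj ⊢
        refine ⟨by gcongr; exact hj.1, ?_⟩
        rw [Nat.gcd_mul_left, hj.2.gcd_eq_one, mul_one]
      · intro a _ b _ h
        exact Nat.eq_of_mul_eq_mul_left hd0 h
      · intro b hb
        simp only [Finset.mem_filter, Finset.mem_range] at hb
        obtain ⟨k, rfl⟩ : d ∣ b := hb.2 ▸ Nat.gcd_dvd_right _ _
        refine ⟨k, ?_, rfl⟩
        simp only [Finset.mem_filter, Finset.mem_range]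
        refine ⟨lt_of_mul_lt_mul_left hb.1 (Nat.zero_le _), ?_⟩
        have := hb.2
        rw [Nat.gcd_mul_left] at this
        exact Nat.eq_of_mul_eq_mul_left hd0 (by simpa using this)
      · intro j _
        rw [pow_mul]
    have h1mem : 1 ∈ n.divisors := Nat.one_mem_divisors.2 hn.ne'
    rw [← Finset.add_sum_erase _ _ h1mem] at hsplit
    have hrest : ∃ m : ℤ, ∑ d ∈ n.divisors.erase 1,
        ∑ j ∈ (Finset.range n).filter (fun j => n.gcd j = d), ζ ^ j = m := by
      have : ∀ d ∈ n.divisors.erase 1, ∃ m : ℤ,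
          ∑ j ∈ (Finset.range n).filter (fun j => n.gcd j = d), ζ ^ j = m := by
        intro d hd
        rw [Finset.mem_erase] at hd
        rw [hpart d hd.2]
        have hdvd := Nat.dvd_of_mem_divisors hd.2
        have hd0 : d ≠ 0 := by rintro rfl; simp at hd
        refine ih (n / d) (Nat.div_lt_self hn (by lia)) _ ?_
        rw [← pow_mul, Nat.mul_div_cancel' hdvd, hζ]
      choose! m hm using this
      refine ⟨∑ d ∈ n.divisors.erase 1, m d, ?_⟩
      rw [Finset.sum_congr rfl hm]; simp
    obtain ⟨a, ha⟩ := htot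
    obtain ⟨b, hb⟩ := hrest
    refine ⟨a - b, ?_⟩
    push_cast
    rw [← ha, ← hb, hsplit]
    simp [Nat.Coprime]

lemma exists_int_of_isIntegral_of_mul {x : ℂ} (hx : IsIntegral ℤ x) {a b : ℤ} (ha : a ≠ 0)
    (h : (a : ℂ) * x = b) : ∃ m : ℤ, x = m := by
  have hq : x = algebraMap ℚ ℂ ((b : ℚ) / a) := by
    have : (a : ℂ) ≠ 0 := by exact_mod_cast ha
    simp
    field_simp
    rw [← h]; ring
  rw [hq] at hx
  have hx' : IsIntegral ℤ ((b : ℚ) / a) :=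
    (isIntegral_algebraMap_iff (algebraMap ℚ ℂ).injective).1 hx
  obtain ⟨m, hm⟩ := IsIntegrallyClosed.isIntegral_iff.1 hx'
  exact ⟨m, by rw [hq, ← hm]; simp⟩

lemma exists_trace_pow_eq_sum {V : Type} [AddCommGroup V] [Module ℂ V] [FiniteDimensional ℂ V]
    (f : Module.End ℂ V) (n : ℕ) (hn : 0 < n) (hf : f ^ (n + 1) = f) :
    ∃ (ι : Type) (_ : Fintype ι) (z : ι → ℂ), (∀ i, z i = 0 ∨ z i ^ n = 1) ∧
      ∀ j, LinearMap.trace ℂ V (f ^ j) = ∑ i, z i ^ j := by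
  classical
  have hsq : Squarefree (Polynomial.X ^ (n + 1) - Polynomial.X : Polynomial ℂ) := by
    have h1 : (Polynomial.X ^ n - 1 : Polynomial ℂ).Separable :=
      Polynomial.X_pow_sub_one_separable_iff.2 (by exact_mod_cast hn.ne')
    have h2 : IsCoprime (Polynomial.X : Polynomial ℂ) (Polynomial.X ^ n - 1) := by
      refine ⟨Polynomial.X ^ (n - 1), -1, ?_⟩
      rw [← pow_succ, Nat.sub_add_cancel hn]; ring
    have := (Polynomial.separable_X (R := ℂ)).mul h1 h2
    have e : (Polynomial.X ^ (n + 1) - Polynomial.X : Polynomial ℂ) = Polynomial.X * (Polynomial.X ^ n - 1) := by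
      ring
    rw [e]; exact this.squarefree
  have hss : f.IsSemisimple := Module.End.isSemisimple_of_squarefree_aeval_eq_zero hsq (by simp [hf])
  have htop : ⨆ μ, f.eigenspace μ = ⊤ := by
    have := Module.End.iSup_maxGenEigenspace_eq_top f
    simp only [hss.isFinitelySemisimple.maxGenEigenspace_eq_eigenspace] at this
    exact this
  have hdec : DirectSum.IsInternal (fun μ => f.eigenspace μ) :=
    DirectSum.isInternal_submodule_of_iSupIndep_of_iSup_eq_top f.eigenspaces_iSupIndep htop
  have hN : {μ | f.eigenspace μ ≠ ⊥}.Finite :=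
    WellFoundedGT.finite_ne_bot_of_iSupIndep f.eigenspaces_iSupIndep
  have hpow : ∀ (j : ℕ) (μ : ℂ) (x : V), x ∈ f.eigenspace μ → (f ^ j) x = μ ^ j • x := by
    intro j μ x hx
    rw [Module.End.mem_eigenspace_iff] at hx
    induction j with
    | zero => simp
    | succ j ih => rw [pow_succ', Module.End.mul_apply, ih, map_smul, hx, smul_smul, pow_succ]
  refine ⟨Σ μ : hN.toFinset, Fin (Module.finrank ℂ (f.eigenspace μ.1)), inferInstance,
    fun x => x.1.1, ?_, ?_⟩
  · rintro ⟨⟨μ, hμ⟩, _⟩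
    rw [Set.Finite.mem_toFinset, Set.mem_ofPred_eq, Submodule.ne_bot_iff] at hμ
    obtain ⟨x, hx, hx0⟩ := hμ
    have h1 := hpow (n + 1) μ x hx
    have h2 := hpow 1 μ x hx
    rw [hf] at h1
    rw [pow_one] at h2
    rw [h2] at h1
    have h3 := smul_left_injective ℂ hx0 h1
    simp only [pow_one] at h3
    by_cases h0 : μ = 0
    · exact Or.inl h0
    · right
      rw [pow_succ] at h3
      exact (mul_right_cancel₀ h0 (by rw [one_mul]; exact h3.symm))
  · intro j
    have hm : ∀ μ, Set.MapsTo (f ^ j) (f.eigenspace μ) (f.eigenspace μ) := by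
      intro μ x hx
      have : (f ^ j) x = μ ^ j • x := hpow j μ x hx
      rw [this]
      exact Submodule.smul_mem _ _ hx
    rw [LinearMap.trace_eq_sum_trace_restrict' hdec hN hm, Fintype.sum_sigma,
      ← Finset.sum_coe_sort]
    refine Finset.sum_congr rfl fun μ _ => ?_
    have : (f ^ j).restrict (hm μ.1) = (μ.1 ^ j) • (1 : Module.End ℂ (f.eigenspace μ.1)) := by
      refine LinearMap.ext fun x => Subtype.ext ?_
      exact hpow j μ.1 x.1 x.2
    rw [this, map_smul, LinearMap.trace_one]
    simp [mul_comm]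

lemma isIntegral_of_root {n : ℕ} (hn : 0 < n) {z : ℂ} (h : z = 0 ∨ z ^ n = 1) :
    IsIntegral ℤ z := by
  rcases h with rfl | h
  · exact isIntegral_zero
  · exact IsIntegral.of_pow hn (h ▸ isIntegral_one)

lemma exists_int_trace {V : Type} [AddCommGroup V] [Module ℂ V] [FiniteDimensional ℂ V]
    (f : Module.End ℂ V) (n : ℕ) (hn : 0 < n) (hf : f ^ (n + 1) = f)
    (h : ∀ j, n.Coprime j → 0 < j → LinearMap.trace ℂ V (f ^ j) = LinearMap.trace ℂ V f) :
    ∃ m : ℤ, LinearMap.trace ℂ V f = m := by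
  obtain ⟨ι, _, z, hz, htr⟩ := exists_trace_pow_eq_sum f n hn hf
  have h1 : LinearMap.trace ℂ V f = ∑ i, z i := by simpa using htr 1
  have hdec : IsIntegral ℤ (LinearMap.trace ℂ V f) := by
    rw [h1]
    exact IsIntegral.sum _ fun i _ => isIntegral_of_root hn (hz i)
  have hsum : ∀ i, ∃ m : ℤ,
      ∑ j ∈ (Finset.range n).filter (fun j => n.Coprime j), z i ^ (j + n) = m := by
    intro i
    rcases hz i with h0 | h0
    · refine ⟨0, ?_⟩
      rw [Int.cast_zero]
      exact Finset.sum_eq_zero fun j _ => by rw [h0, zero_pow (by lia)]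
    · simp only [pow_add, h0, mul_one]
      exact exists_int_sum_coprime_pow n _ h0
  choose m hm using hsum
  refine exists_int_of_isIntegral_of_mul hdec (a := n.totient) (b := ∑ i, m i)
    (by exact_mod_cast (Nat.totient_pos.2 hn).ne') ?_
  push_cast
  simp only [← hm]
  rw [Finset.sum_comm]
  simp only [← htr]
  rw [Finset.sum_congr rfl fun j hj => h (j + n) (by simpa using (Finset.mem_filter.1 hj).2) (by lia)]
  simp [Nat.totient]

lemma sum_pow_prime_pow {R ι : Type*} [CommRing R] (p : ℕ) (hp : p.Prime) (k : ℕ) (s : Finset ι) (a : ι → R) :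
    ∃ r, (∑ i ∈ s, a i) ^ p ^ k = ∑ i ∈ s, a i ^ p ^ k + p * r := by
  classical
  induction s using Finset.induction_on with
  | empty => exact ⟨0, by simp [hp.ne_zero]⟩
  | insert i s hi ih =>
    obtain ⟨r, hr⟩ := ih
    obtain ⟨t, ht⟩ := exists_add_pow_prime_pow_eq hp (a i) (∑ i ∈ s, a i) k
    refine ⟨(a i * (∑ i ∈ s, a i) * t) + r, ?_⟩
    rw [Finset.sum_insert hi, Finset.sum_insert hi, ht, hr]; ring

lemma trace_pow_prime_pow {V : Type} [AddCommGroup V] [Module ℂ V] [FiniteDimensional ℂ V]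
    (f : Module.End ℂ V) (n : ℕ) (hn : 0 < n) (hf : f ^ (n + 1) = f) (p : ℕ) (hp : p.Prime) (k : ℕ) :
    ∃ r : ℂ, IsIntegral ℤ r ∧
      LinearMap.trace ℂ V f ^ p ^ k = LinearMap.trace ℂ V (f ^ p ^ k) + p * r := by
  obtain ⟨ι, _, z, hz, htr⟩ := exists_trace_pow_eq_sum f n hn hf
  have h1 : LinearMap.trace ℂ V f = ∑ i, z i := by simpa using htr 1
  let z' : ι → integralClosure ℤ ℂ := fun i => ⟨z i, isIntegral_of_root hn (hz i)⟩
  obtain ⟨r, hr⟩ := sum_pow_prime_pow p hp k Finset.univ z'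
  refine ⟨r, r.2, ?_⟩
  have := congrArg Subtype.val hr
  rw [h1, htr]
  simpa [z'] using this

section Characters

variable {G : Type} [Group G]

lemma FDRep.rho_pow_card_succ (V : FDRep ℂ G) (g : G) : V.ρ g ^ (Nat.card G + 1) = V.ρ g := by
  rw [pow_succ, ← map_pow, pow_card_eq_one', map_one, one_mul]

lemma FDRep.character_pow (V : FDRep ℂ G) (g : G) (j : ℕ) :
    V.character (g ^ j) = LinearMap.trace ℂ V (V.ρ g ^ j) := by
  rw [FDRep.character, map_pow]

namespace IrrChar

lemma conj_invariant (χ : IrrChar G) (g h : G) : χ.1 (h * g * h⁻¹) = χ.1 g := by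
  obtain ⟨_, V, _, rfl⟩ := χ
  exact V.char_conj g h

lemma eq_of_isConj (χ : IrrChar G) {g h : G} (hc : IsConj g h) : χ.1 g = χ.1 h := by
  obtain ⟨c, rfl⟩ := isConj_iff.1 hc
  exact (χ.conj_invariant g c).symm

end IrrChar

variable [Finite G]

lemma FDRep.character_inv_eq_conj (V : FDRep ℂ G) (g : G) :
    V.character g⁻¹ = starRingEnd ℂ (V.character g) := by
  obtain ⟨ι, _, z, hz, htr⟩ := exists_trace_pow_eq_sum (V.ρ g) (Nat.card G) Nat.card_pos
    (V.rho_pow_card_succ g)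
  have hn : 0 < Nat.card G := Nat.card_pos
  have h1 : g⁻¹ = g ^ (2 * Nat.card G - 1) := by
    rw [inv_eq_iff_mul_eq_one, ← pow_succ', Nat.sub_add_cancel (by lia), mul_comm, pow_mul,
      pow_card_eq_one', one_pow]
  rw [h1, V.character_pow, htr, ← pow_one g, V.character_pow, htr, map_sum]
  refine Finset.sum_congr rfl fun i _ => ?_
  rcases hz i with h | h
  · rw [h, zero_pow (by lia)]; simp
  · have hnorm := Complex.norm_eq_one_of_pow_eq_one h hn.ne'
    have hz0 : z i ≠ 0 := by rintro h0; simp [h0] at hnorm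
    have : z i ^ (2 * Nat.card G - 1) * z i = 1 := by
      rw [← pow_succ, Nat.sub_add_cancel (by lia), mul_comm, pow_mul, h, one_pow]
    rw [pow_one, ← Complex.inv_eq_conj hnorm]
    exact eq_inv_of_mul_eq_one_left this

namespace IrrChar

lemma inv_eq_conj (χ : IrrChar G) (g : G) : χ.1 g⁻¹ = starRingEnd ℂ (χ.1 g) := by
  obtain ⟨_, V, _, rfl⟩ := χ
  exact V.character_inv_eq_conj g

open scoped Classical in
lemma sum_mul_inv [Fintype G] (χ ψ : IrrChar G) :
    ∑ g, χ.1 g * ψ.1 g⁻¹ = if χ = ψ then (Nat.card G : ℂ) else 0 := by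
  have hne : (Nat.card G : ℂ) ≠ 0 := by exact_mod_cast Nat.card_pos.ne'
  have := invertibleOfNonzero hne
  split_ifs with h
  · subst h
    obtain ⟨_, V, hV, rfl⟩ := χ
    exact (FDRep.simple_iff_char_is_norm_one V).1 hV
  · obtain ⟨_, V, hV, rfl⟩ := χ
    obtain ⟨_, W, hW, rfl⟩ := ψ
    have h2 := FDRep.char_orthonormal V W
    rw [if_neg] at h2
    · exact (mul_eq_zero.1 h2).resolve_left (inv_ne_zero hne)
    · rintro ⟨i⟩
      exact h (Subtype.ext (FDRep.char_iso i))

lemma linearIndependent : LinearIndependent ℂ (fun χ : IrrChar G => χ.1) := by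
  classical
  have := Fintype.ofFinite G
  have hne : (Nat.card G : ℂ) ≠ 0 := by exact_mod_cast Nat.card_pos.ne'
  rw [linearIndependent_iff']
  intro s a hs ψ hψ
  have h : ∑ g, (∑ χ ∈ s, a χ • χ.1) g * ψ.1 g⁻¹ = 0 := by rw [hs]; simp
  simp only [Finset.sum_apply, Pi.smul_apply, smul_eq_mul, Finset.sum_mul, mul_assoc] at h
  rw [Finset.sum_comm] at h
  simp only [← Finset.mul_sum, sum_mul_inv] at h
  simpa [hψ, hne] using h

instance finite : Finite (IrrChar G) := linearIndependent.finite

lemma card_conjClasses_le : Nat.card (ConjClasses G) ≤ Nat.card (IrrChar G) := by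
  classical
  have := Fintype.ofFinite G
  have := Fintype.ofFinite (IrrChar G)
  have := Fintype.ofFinite (ConjClasses G)
  let T : (ConjClasses G → ℂ) →ₗ[ℂ] (IrrChar G → ℂ) :=
    { toFun := fun F χ => ∑ g, F (ConjClasses.mk g) * χ.1 g
      map_add' := by intro x y; funext χ; simp [add_mul, Finset.sum_add_distrib]
      map_smul' := by intro x y; funext χ; simp [Finset.mul_sum, mul_assoc] }
  have hT : Function.Injective T := by
    rw [injective_iff_map_eq_zero]
    intro F hF
    have := eq_zero_of_orthogonal (fun g => F (ConjClasses.mk g)) (fun g h => by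
      congr 1
      exact ConjClasses.mk_eq_mk_iff_isConj.2 (isConj_iff.2 ⟨h, rfl⟩).symm) (fun χ => congrFun hF χ)
    funext c
    obtain ⟨g, rfl⟩ := ConjClasses.exists_rep c
    exact congrFun this g
  have := LinearMap.finrank_le_finrank_of_injective hT
  simpa [Nat.card_eq_fintype_card] using this

lemma sum_normSq [Fintype (IrrChar G)] (g : G) :
    ∑ χ : IrrChar G, χ.1 g * χ.1 g⁻¹ = (Nat.card (Subgroup.centralizer {g}) : ℂ) := by
  classical
  have := Fintype.ofFinite G
  have hne : (Nat.card G : ℂ) ≠ 0 := by exact_mod_cast Nat.card_pos.ne'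
  let F : G → ℂ := fun x => if IsConj x g then 1 else 0
  let K : ℂ := ∑ x, F x
  have hF : ∀ (χ : IrrChar G), ∑ x, F x * χ.1 x⁻¹ = K * χ.1 g⁻¹ := by
    intro χ
    simp only [K, F, Finset.sum_mul]
    refine Finset.sum_congr rfl fun x _ => ?_
    split_ifs with h
    · rw [inv_eq_conj, inv_eq_conj, χ.eq_of_isConj h]
    · simp
  let R : G → ℂ := fun x => Nat.card G * F x - ∑ χ : IrrChar G, K * χ.1 g⁻¹ * χ.1 x
  have hR : (fun x => R x⁻¹) = 0 := by
    apply eq_zero_of_orthogonal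
    · intro x h
      have hi : (h * x * h⁻¹)⁻¹ = h * x⁻¹ * h⁻¹ := by group
      have hcj : IsConj (h * x⁻¹ * h⁻¹) x⁻¹ := (isConj_iff.2 ⟨h, rfl⟩).symm
      simp only [R, F, hi, conj_invariant]
      congr 3
      exact propext ⟨fun q => hcj.symm.trans q, fun q => hcj.trans q⟩
    · intro ψ
      rw [← Equiv.sum_comp (Equiv.inv G)]
      simp only [Equiv.inv_apply, inv_inv, R, sub_mul, Finset.sum_sub_distrib, mul_assoc,
        ← Finset.mul_sum, hF, Finset.sum_mul]
      rw [Finset.sum_comm]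
      simp only [← Finset.mul_sum, sum_mul_inv]
      simp
      ring
  have h1 : (Nat.card G : ℂ) = K * ∑ χ : IrrChar G, χ.1 g * χ.1 g⁻¹ := by
    have := congrFun hR g⁻¹
    simp only [R, F, inv_inv, IsConj.refl, if_true, mul_one, Pi.zero_apply, sub_eq_zero] at this
    rw [this, Finset.mul_sum]
    refine Finset.sum_congr rfl fun χ _ => by ring
  have h2 : (Nat.card G : ℂ) = K * Nat.card (Subgroup.centralizer {g}) := by
    have hK : K = (Nat.card (MulAction.orbit (ConjAct G) g) : ℂ) := by
      simp only [K, F, Finset.sum_boole]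
      rw [Nat.card_eq_fintype_card, ← Set.toFinset_card]
      congr 2
      ext x
      simp [ConjAct.mem_orbit_conjAct]
    have h3 := MulAction.card_orbit_mul_card_stabilizer_eq_card_group (ConjAct G) g
    simp only [← Nat.card_eq_fintype_card] at h3
    rw [hK, ← Nat.cast_mul]
    congr 1
    have h4 : Nat.card (Subgroup.centralizer {g}) = Nat.card (MulAction.stabilizer (ConjAct G) g) := by
      rw [ConjAct.stabilizer_eq_centralizer]
      rfl
    rw [h4, h3]
    rfl
  have hK0 : K ≠ 0 := by
    intro h0
    rw [h0, zero_mul] at h2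
    exact hne h2
  exact mul_left_cancel₀ hK0 (h1.symm.trans h2)

end IrrChar

end Characters

section CosetAverage

variable {G : Type} [Group G] [Finite G]

lemma FDRep.exists_int_coset_average (W : FDRep ℂ G) (c : G) (H : Subgroup G)
    (hcH : ∀ h ∈ H, c * h = h * c)
    (hy : ∀ j, (Nat.card G).Coprime j → ∃ y, y * c * y⁻¹ = c ^ j ∧ ∀ h ∈ H, y⁻¹ * h * y ∈ H)
    [Fintype H] :
    ∃ m : ℤ, (Nat.card H : ℂ)⁻¹ * ∑ h : H, W.character (c * h) = m := by
  have hne : (Nat.card H : ℂ) ≠ 0 := by exact_mod_cast Nat.card_pos.ne'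
  let P : Module.End ℂ W := (Nat.card H : ℂ)⁻¹ • ∑ h : H, W.ρ h
  have hPr : ∀ h : H, W.ρ h * P = P := by
    intro h
    simp only [P, mul_smul_comm, Finset.mul_sum, ← map_mul]
    congr 1
    exact Fintype.sum_equiv (Equiv.mulLeft h) _ _ (fun x => by simp)
  have hPP : P * P = P := by
    conv_lhs =>
      enter [1]
      simp only [P]
    rw [smul_mul_assoc, Finset.sum_mul, Finset.sum_congr rfl fun h _ => hPr h]
    simp [← Nat.cast_smul_eq_nsmul ℂ, smul_smul, ← Nat.card_eq_fintype_card, hne]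
  have hcomm : Commute (W.ρ c) P := by
    simp only [P]
    apply Commute.smul_right
    apply Commute.sum_right
    intro h _
    show _ * _ = _ * _
    rw [← map_mul, ← map_mul, hcH h h.2]
  let A : Module.End ℂ W := W.ρ c * P
  have hPpow : ∀ j, 0 < j → P ^ j = P := fun j hj => (show IsIdempotentElem P from hPP).pow_eq hj.ne'
  have hA : ∀ j, 0 < j → A ^ j = W.ρ (c ^ j) * P := by
    intro j hj
    simp only [A]
    rw [hcomm.mul_pow, hPpow j hj, map_pow]
  have htr : ∀ g : G, LinearMap.trace ℂ W (W.ρ g * P) = (Nat.card H : ℂ)⁻¹ * ∑ h : H, W.character (g * h) := by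
    intro g
    simp only [P, mul_smul_comm, Finset.mul_sum, map_smul, map_sum, smul_eq_mul, ← map_mul]
    rfl
  rw [← htr]
  refine exists_int_trace A (Nat.card G) Nat.card_pos ?_ ?_
  · rw [hA _ (Nat.succ_pos _), pow_succ, pow_card_eq_one', one_mul]
  · intro j hj hj0
    rw [hA j hj0, htr]
    simp only [A]
    rw [htr]
    congr 1
    obtain ⟨y, hyc, hyH⟩ := hy j hj
    have hinj : Function.Injective (fun h : H => (⟨y⁻¹ * h * y, hyH h h.2⟩ : H)) := by
      intro a b hab
      have := congrArg Subtype.val hab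
      simpa using this
    refine Fintype.sum_bijective _ (Finite.injective_iff_bijective.1 hinj) _ _ ?_
    intro h
    rw [← hyc]
    have : y * c * y⁻¹ * h = y * (c * (y⁻¹ * h * y)) * y⁻¹ := by group
    rw [this, W.char_conj]

lemma IrrChar.one_le_coset_average (χ : IrrChar G) (c : G) (H : Subgroup G)
    (hcH : ∀ h ∈ H, c * h = h * c)
    (hy : ∀ j, (Nat.card G).Coprime j → ∃ y, y * c * y⁻¹ = c ^ j ∧ ∀ h ∈ H, y⁻¹ * h * y ∈ H)
    [Fintype H] (hχ : ∃ h ∈ H, χ.1 (c * h) ≠ 0) :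
    (Nat.card H : ℝ) ≤ ∑ h : H, ‖χ.1 (c * h)‖ ^ 2 := by
  have hne : (Nat.card H : ℝ) ≠ 0 := by exact_mod_cast Nat.card_pos.ne'
  have hpos : (0 : ℝ) < Nat.card H := by exact_mod_cast Nat.card_pos
  have h1 : ∃ m : ℤ, (Nat.card H : ℂ)⁻¹ * ∑ h : H, χ.1 (c * h) * χ.1 (c * h)⁻¹ = m := by
    obtain ⟨_, V, _, rfl⟩ := χ
    obtain ⟨m, hm⟩ := FDRep.exists_int_coset_average (FDRep.of (Representation.linHom V.ρ V.ρ)) c H hcH hy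
    refine ⟨m, ?_⟩
    rw [← hm]
    simp only [FDRep.char_linHom]
    congr 1
    exact Finset.sum_congr rfl fun h _ => mul_comm _ _
  obtain ⟨m, hm⟩ := h1
  have h2 : (Nat.card H : ℝ)⁻¹ * ∑ h : H, ‖χ.1 (c * h)‖ ^ 2 = m := by
    have : ((((Nat.card H : ℝ)⁻¹ * ∑ h : H, ‖χ.1 (c * h)‖ ^ 2 : ℝ)) : ℂ) = m := by
      rw [← hm]
      push_cast
      congr 1
      refine Finset.sum_congr rfl fun h _ => ?_
      rw [χ.inv_eq_conj, Complex.mul_conj']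
    exact_mod_cast this
  have h3 : 0 < ∑ h : H, ‖χ.1 (c * h)‖ ^ 2 := by
    obtain ⟨h, hh, h0⟩ := hχ
    refine Finset.sum_pos' (fun _ _ => by positivity) ⟨⟨h, hh⟩, Finset.mem_univ _, ?_⟩
    have : 0 < ‖χ.1 (c * h)‖ := norm_pos_iff.2 h0
    positivity
  have h4 : (0 : ℝ) < m := by rw [← h2]; positivity
  have h5 : (1 : ℝ) ≤ m := by exact_mod_cast (show 0 < m by exact_mod_cast h4)
  rw [← h2, inv_mul_eq_div, le_div_iff₀ hpos, one_mul] at h5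
  exact h5

lemma IrrChar.card_nonvanishing_mul_le (c : G) (H : Subgroup G)
    (hcH : ∀ h ∈ H, c * h = h * c)
    (hy : ∀ j, (Nat.card G).Coprime j → ∃ y, y * c * y⁻¹ = c ^ j ∧ ∀ h ∈ H, y⁻¹ * h * y ∈ H)
    [Fintype H] :
    Nat.card {χ : IrrChar G // ∃ h ∈ H, χ.1 (c * h) ≠ 0} * Nat.card H ≤
      ∑ h : H, Nat.card (Subgroup.centralizer {c * (h : G)}) := by
  classical
  have := Fintype.ofFinite (IrrChar G)
  have hcol : ∀ g : G, ∑ χ : IrrChar G, ‖χ.1 g‖ ^ 2 = (Nat.card (Subgroup.centralizer {g}) : ℝ) := by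
    intro g
    have := IrrChar.sum_normSq g
    simp only [IrrChar.inv_eq_conj, Complex.mul_conj'] at this
    exact_mod_cast this
  have h1 : (∑ h : H, Nat.card (Subgroup.centralizer {c * (h : G)}) : ℝ) =
      ∑ χ : IrrChar G, ∑ h : H, ‖χ.1 (c * h)‖ ^ 2 := by
    rw [Finset.sum_comm]
    exact Finset.sum_congr rfl fun h _ => (hcol _).symm
  have h2 : (Nat.card {χ : IrrChar G // ∃ h ∈ H, χ.1 (c * h) ≠ 0} * Nat.card H : ℝ) ≤
      ∑ χ : IrrChar G, ∑ h : H, ‖χ.1 (c * h)‖ ^ 2 := by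
    rw [Nat.card_eq_fintype_card, Fintype.card_subtype, ← nsmul_eq_mul, ← Finset.sum_const]
    refine (Finset.sum_le_sum fun χ hχ => χ.one_le_coset_average c H hcH hy
      (Finset.mem_filter.1 hχ).2).trans ?_
    exact Finset.sum_le_univ_sum_of_nonneg fun χ => Finset.sum_nonneg fun h _ => by positivity
  rw [← h1] at h2
  exact_mod_cast h2

lemma IrrChar.dvd_of_pow_isConj (χ : IrrChar G) (p : ℕ) (hp : p.Prime) (k : ℕ) (g g' : G)
    (hg : ∀ j, (Nat.card G).Coprime j → IsConj (g ^ j) g)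
    (hgg : IsConj (g ^ p ^ k) (g' ^ p ^ k)) (h0 : χ.1 g' = 0) :
    ∃ m : ℤ, χ.1 g = (p : ℂ) * m := by
  have hconj := χ.eq_of_isConj hgg
  have hrat : ∀ j, (Nat.card G).Coprime j → χ.1 (g ^ j) = χ.1 g := fun j hj => χ.eq_of_isConj (hg j hj)
  have hP : p ^ k ≠ 0 := pow_ne_zero _ hp.ne_zero
  obtain ⟨_, V, _, rfl⟩ := χ
  dsimp only at *
  obtain ⟨m, hm⟩ := exists_int_trace (V.ρ g) (Nat.card G) Nat.card_pos (V.rho_pow_card_succ g)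
    (fun j hj _ => by rw [← V.character_pow]; exact hrat j hj)
  obtain ⟨r, hr, h1⟩ := trace_pow_prime_pow (V.ρ g) _ Nat.card_pos (V.rho_pow_card_succ g) p hp k
  obtain ⟨r', hr', h2⟩ := trace_pow_prime_pow (V.ρ g') _ Nat.card_pos (V.rho_pow_card_succ g') p hp k
  rw [← V.character_pow] at h1 h2
  change V.character g ^ p ^ k = _ at h1
  change V.character g' ^ p ^ k = _ at h2
  change V.character g = _ at hm
  rw [h0, zero_pow hP] at h2
  have h3 : (m : ℂ) ^ p ^ k = p * (r - r') := by
    rw [← hm, h1, hconj, eq_neg_of_add_eq_zero_left h2.symm]; ring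
  obtain ⟨q, hq⟩ := exists_int_of_isIntegral_of_mul (hr.sub hr') (a := p) (b := m ^ p ^ k)
    (by exact_mod_cast hp.ne_zero) (by push_cast; exact h3.symm)
  have h4 : m ^ p ^ k = p * q := by
    rw [hq] at h3
    exact_mod_cast h3
  obtain ⟨t, ht⟩ : (p : ℤ) ∣ m := (Nat.prime_iff_prime_int.1 hp).dvd_of_dvd_pow ⟨q, h4⟩
  exact ⟨t, by rw [hm, ht]; push_cast; ring⟩

end CosetAverage

section EquivariantBijection

lemma card_preimage_of_card_fiber {X Q : Type*} [Finite X] (f : X → Q) (A : Q → Prop) (k : ℕ)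
    (hf : Function.Surjective f)
    (h : ∀ q, A q → Nat.card {x // f x = q} = k) :
    Nat.card {x // A (f x)} = Nat.card {q // A q} * k := by
  classical
  have := Finite.of_surjective f hf
  have := Fintype.ofFinite {q // A q}
  let e : {x // A (f x)} ≃ Σ q : {q // A q}, {x // f x = q} :=
    { toFun := fun x => ⟨⟨f x, x.2⟩, ⟨x, rfl⟩⟩
      invFun := fun y => ⟨y.2.1, by rw [y.2.2]; exact y.1.2⟩
      left_inv := fun x => rfl
      right_inv := by
        rintro ⟨⟨q, hq⟩, ⟨x, hx⟩⟩
        obtain rfl : f x = q := hx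
        rfl }
  rw [Nat.card_congr e, Nat.card_sigma, Finset.sum_congr rfl fun q _ => h q.1 q.2]
  simp [Nat.card_eq_fintype_card]

lemma exists_equiv_comp_eq {X X' L : Type*} [Finite X] [Finite X'] (l : X → L) (l' : X' → L)
    (h : ∀ a, Nat.card {x // l x = a} = Nat.card {x // l' x = a}) :
    ∃ e : X ≃ X', ∀ x, l' (e x) = l x := by
  have hne : ∀ a, Nonempty ({x // l x = a} ≃ {x // l' x = a}) := fun a =>
    Finite.card_eq.1 (h a)
  exact ⟨Equiv.ofFiberEquiv fun a => (hne a).some, Equiv.ofFiberEquiv_map _⟩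

lemma exists_equivariant_equiv_of_orbits {Γ X X' : Type*} [CommGroup Γ] [MulAction Γ X] [MulAction Γ X']
    (Φ : MulAction.orbitRel.Quotient Γ X ≃ MulAction.orbitRel.Quotient Γ X')
    (hΦ : ∀ (x : X) (x' : X'), Φ (Quotient.mk _ x) = Quotient.mk _ x' →
      MulAction.stabilizer Γ x = MulAction.stabilizer Γ x') :
    ∃ f : X ≃ X', ∀ (γ : Γ) (x : X), f (γ • x) = γ • f x := by
  have hex : ∀ x : X, ∃ γ : Γ, x = γ • (Quotient.out (Quotient.mk (MulAction.orbitRel Γ X) x)) := by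
    intro x
    have := Quotient.exact (Quotient.out_eq (Quotient.mk (MulAction.orbitRel Γ X) x))
    obtain ⟨γ, hγ⟩ := (MulAction.orbitRel Γ X).symm this
    exact ⟨γ, hγ.symm⟩
  choose c hc using hex
  let f : X → X' := fun x => c x • (Quotient.out (Φ (Quotient.mk _ x)))
  have hst : ∀ x : X, MulAction.stabilizer Γ (Quotient.out (Quotient.mk (MulAction.orbitRel Γ X) x)) =
      MulAction.stabilizer Γ (Quotient.out (Φ (Quotient.mk _ x))) := by
    intro x
    exact hΦ _ _ (by rw [Quotient.out_eq, Quotient.out_eq])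
  have hmk : ∀ (γ : Γ) (x : X), (Quotient.mk (MulAction.orbitRel Γ X) (γ • x)) = Quotient.mk _ x :=
    fun γ x => Quotient.sound ⟨γ, rfl⟩
  have hmk' : ∀ (γ : Γ) (x : X'), (Quotient.mk (MulAction.orbitRel Γ X') (γ • x)) = Quotient.mk _ x :=
    fun γ x => Quotient.sound ⟨γ, rfl⟩
  have key : ∀ (γ : Γ) (x : X), x = γ • (Quotient.out (Quotient.mk (MulAction.orbitRel Γ X) x)) →
      f x = γ • (Quotient.out (Φ (Quotient.mk _ x))) := by
    intro γ x hx
    have h1 : γ⁻¹ * c x ∈ MulAction.stabilizer Γ (Quotient.out (Quotient.mk (MulAction.orbitRel Γ X) x)) := by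
      rw [MulAction.mem_stabilizer_iff, mul_smul, ← hc x, inv_smul_eq_iff]
      exact hx
    rw [hst, MulAction.mem_stabilizer_iff, mul_smul, inv_smul_eq_iff] at h1
    exact h1
  have hf : ∀ (γ : Γ) (x : X), f (γ • x) = γ • f x := by
    intro γ x
    rw [key (γ * c x) (γ • x), hmk, mul_smul]
    rw [hmk, mul_smul, ← hc x]
  have hfq : ∀ x, (Quotient.mk (MulAction.orbitRel Γ X') (f x)) = Φ (Quotient.mk _ x) := by
    intro x
    simp only [f]
    rw [hmk', Quotient.out_eq]
  have hinj : Function.Injective f := by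
    intro x y hxy
    have h1 : Quotient.mk (MulAction.orbitRel Γ X) x = Quotient.mk _ y := by
      apply Φ.injective
      rw [← hfq, ← hfq, hxy]
    obtain ⟨γ, rfl⟩ := Quotient.exact h1
    have h2 : γ • f y = f y := by
      rw [← hf]; exact hxy
    have h3 : γ ∈ MulAction.stabilizer Γ y := by
      rw [hΦ y (f y) (hfq y).symm]; exact h2
    exact h3
  have hsurj : Function.Surjective f := by
    intro x'
    obtain ⟨x, hx⟩ := Quotient.exists_rep (Φ.symm (Quotient.mk _ x'))
    have h1 : Quotient.mk (MulAction.orbitRel Γ X') (f x) = Quotient.mk _ x' := by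
      rw [hfq]
      exact (congrArg Φ hx).trans (Φ.apply_symm_apply _)
    obtain ⟨γ, hγ⟩ := (MulAction.orbitRel Γ X').symm (Quotient.exact h1)
    exact ⟨γ • x, by rw [hf]; exact hγ⟩
  exact ⟨Equiv.ofBijective f ⟨hinj, hsurj⟩, hf⟩

lemma stabilizer_smul_eq_of_comm {Γ X : Type*} [CommGroup Γ] [MulAction Γ X] (γ : Γ) (x : X) :
    MulAction.stabilizer Γ (γ • x) = MulAction.stabilizer Γ x := by
  ext δ
  rw [MulAction.mem_stabilizer_iff, MulAction.mem_stabilizer_iff, smul_smul, mul_comm, mul_smul]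
  exact smul_left_cancel_iff γ

lemma exists_equivariant_equiv {Γ X X' : Type*} [CommGroup Γ] [Finite X] [MulAction Γ X]
    [MulAction Γ X'] (π : X ≃ X')
    (hπ : ∀ x, MulAction.stabilizer Γ (π x) = MulAction.stabilizer Γ x) :
    ∃ f : X ≃ X', ∀ (γ : Γ) (x : X), f (γ • x) = γ • f x := by
  have : Finite X' := Finite.of_equiv _ π
  let st : MulAction.orbitRel.Quotient Γ X → Subgroup Γ :=
    Quotient.lift (fun x => MulAction.stabilizer Γ x) (by
      rintro _ y ⟨γ, rfl⟩; exact stabilizer_smul_eq_of_comm γ y)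
  let st' : MulAction.orbitRel.Quotient Γ X' → Subgroup Γ :=
    Quotient.lift (fun x => MulAction.stabilizer Γ x) (by
      rintro _ y ⟨γ, rfl⟩; exact stabilizer_smul_eq_of_comm γ y)
  have hcard : ∀ S : Subgroup Γ, Nat.card {q // st q = S} = Nat.card {q // st' q = S} := by
    intro S
    have h1 : Nat.card {x : X // MulAction.stabilizer Γ x = S} = Nat.card {q // st q = S} * S.index := by
      refine card_preimage_of_card_fiber (Quotient.mk (MulAction.orbitRel Γ X)) (fun q => st q = S) _
        Quotient.mk_surjective ?_
      intro q hq
      obtain ⟨x, rfl⟩ := Quotient.exists_rep q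
      have hx : MulAction.stabilizer Γ x = S := hq
      rw [← hx, MulAction.index_stabilizer]
      refine Nat.card_congr (Equiv.subtypeEquivRight fun y => ?_)
      exact ⟨fun h => Quotient.exact h, fun h => Quotient.sound h⟩
    have h2 : Nat.card {x : X' // MulAction.stabilizer Γ x = S} = Nat.card {q // st' q = S} * S.index := by
      refine card_preimage_of_card_fiber (Quotient.mk (MulAction.orbitRel Γ X')) (fun q => st' q = S) _
        Quotient.mk_surjective ?_
      intro q hq
      obtain ⟨x, rfl⟩ := Quotient.exists_rep q
      have hx : MulAction.stabilizer Γ x = S := hq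
      rw [← hx, MulAction.index_stabilizer]
      refine Nat.card_congr (Equiv.subtypeEquivRight fun y => ?_)
      exact ⟨fun h => Quotient.exact h, fun h => Quotient.sound h⟩
    have h3 : Nat.card {x : X // MulAction.stabilizer Γ x = S} = Nat.card {x : X' // MulAction.stabilizer Γ x = S} :=
      Nat.card_congr (π.subtypeEquiv fun x => by rw [hπ])
    rcases isEmpty_or_nonempty {x : X // MulAction.stabilizer Γ x = S} with he | ⟨⟨x, hx⟩⟩
    · have hA : IsEmpty {q // st q = S} := by
        refine ⟨fun q => ?_⟩
        obtain ⟨x, hx⟩ := Quotient.exists_rep q.1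
        exact he.false ⟨x, by have := q.2; rw [← hx] at this; exact this⟩
      have hB : IsEmpty {q // st' q = S} := by
        refine ⟨fun q => ?_⟩
        obtain ⟨x, hx⟩ := Quotient.exists_rep q.1
        exact he.false ⟨π.symm x, by
          have := q.2; rw [← hx] at this; rw [← hπ, π.apply_symm_apply]; exact this⟩
      rw [Nat.card_of_isEmpty, Nat.card_of_isEmpty]
    · have hS : 0 < S.index := by
        rw [← hx, MulAction.index_stabilizer]
        have : Nonempty (MulAction.orbit Γ x) := ⟨⟨x, MulAction.mem_orbit_self x⟩⟩
        exact Nat.card_pos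
      rw [h1, h2] at h3
      exact Nat.eq_of_mul_eq_mul_right hS h3
  obtain ⟨Φ, hΦ⟩ := exists_equiv_comp_eq st st' hcard
  refine exists_equivariant_equiv_of_orbits Φ fun x x' h => ?_
  have := hΦ (Quotient.mk _ x)
  rw [h] at this
  exact this.symm

end EquivariantBijection

namespace HyperoctahedralGroup

variable {N : ℕ}

lemma mul_left_apply (a b : HyperoctahedralGroup N) (i : Fin N) :
    (a * b).left i = a.left i * b.left (a.right⁻¹ i) := rfl

lemma right_pow (a : HyperoctahedralGroup N) (n : ℕ) : (a ^ n).right = a.right ^ n :=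
  map_pow SemidirectProduct.rightHom a n

lemma right_zpow (a : HyperoctahedralGroup N) (n : ℤ) : (a ^ n).right = a.right ^ n :=
  map_zpow SemidirectProduct.rightHom a n

/-- The permutation of the signed points `±1, …, ±N` given by a signed permutation matrix. -/
def signedPerm (N : ℕ) : HyperoctahedralGroup N →* Equiv.Perm (Fin N × ℤˣ) :=
  MonoidHom.toHomPerm
    { toFun := fun g y => (g.right y.1, g.left (g.right y.1) * y.2)
      map_one' := by
        funext y
        simp
        rfl
      map_mul' := by
        intro a b
        funext y
        simp [mul_left_apply, mul_assoc]
        rfl }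

lemma signedPerm_apply (g : HyperoctahedralGroup N) (y : Fin N × ℤˣ) :
    signedPerm N g y = (g.right y.1, g.left (g.right y.1) * y.2) := rfl

lemma signedPerm_injective : Function.Injective (signedPerm N) := by
  intro a b h
  have h1 : a.right = b.right := by
    ext1 i
    exact congrArg Prod.fst (congrFun (congrArg DFunLike.coe h) (i, 1))
  refine SemidirectProduct.ext (funext fun i => ?_) h1
  have := congrArg Prod.snd (congrFun (congrArg DFunLike.coe h) (a.right⁻¹ i, 1))
  simp only [signedPerm_apply, mul_one] at this
  rw [← h1] at this
  simpa using this

lemma exists_signedPerm_eq (f : Equiv.Perm (Fin N × ℤˣ))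
    (hf : ∀ i e, f (i, e) = ((f (i, 1)).1, (f (i, 1)).2 * e)) : ∃ b, signedPerm N b = f := by
  have hinj : Function.Injective (fun i => (f (i, 1)).1) := by
    intro i j hij
    dsimp only at hij
    have h1 : f (i, (f (i, 1)).2⁻¹) = f (j, (f (j, 1)).2⁻¹) := by
      rw [hf i, hf j, hij]; simp
    exact congrArg Prod.fst (f.injective h1)
  let σ : Equiv.Perm (Fin N) := Equiv.ofBijective _ (Finite.injective_iff_bijective.1 hinj)
  refine ⟨⟨fun i => (f (σ.symm i, 1)).2, σ⟩, ?_⟩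
  ext1 ⟨i, e⟩
  rw [signedPerm_apply, hf]
  simp only [Equiv.symm_apply_apply]
  rfl

/-- Scalar sign matrices. -/
def scalar (N : ℕ) : ℤˣ →* HyperoctahedralGroup N where
  toFun s := ⟨fun _ => s, 1⟩
  map_one' := rfl
  map_mul' a b := by
    refine SemidirectProduct.ext (funext fun i => ?_) ?_
    · rw [mul_left_apply]
    · simp

lemma scalar_mul_left (s : ℤˣ) (g : HyperoctahedralGroup N) (i : Fin N) :
    (scalar N s * g).left i = s * g.left i := by
  rw [mul_left_apply]; simp [scalar]

lemma scalar_mul_right (s : ℤˣ) (g : HyperoctahedralGroup N) :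
    (scalar N s * g).right = g.right := by
  simp [scalar]

lemma commute_scalar (s : ℤˣ) (g : HyperoctahedralGroup N) : Commute (scalar N s) g := by
  refine SemidirectProduct.ext (funext fun i => ?_) ?_
  · rw [mul_left_apply, mul_left_apply]; simp [scalar, mul_comm]
  · simp [scalar]

/-- The elements whose underlying permutation fixes a point. -/
def fixing (i : Fin N) : Subgroup (HyperoctahedralGroup N) :=
  (MulAction.stabilizer (Equiv.Perm (Fin N)) i).comap SemidirectProduct.rightHom

lemma mem_fixing {i : Fin N} {g : HyperoctahedralGroup N} : g ∈ fixing i ↔ g.right i = i := Iff.rfl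

/-- The sign with which an element acts at a point fixed by its underlying permutation. -/
def fixingSign (i : Fin N) : fixing i →* ℤˣ where
  toFun g := g.1.left i
  map_one' := rfl
  map_mul' a b := by
    have : a.1.right⁻¹ i = i := by
      rw [Equiv.Perm.inv_eq_iff_eq]; exact (mem_fixing.1 a.2).symm
    change (a.1 * b.1).left i = _
    rw [mul_left_apply, this]

lemma left_zpow_of_right_eq {i : Fin N} {g : HyperoctahedralGroup N} (h : g.right i = i) (n : ℤ) :
    (g ^ n).left i = g.left i ^ n :=
  map_zpow (fixingSign i) ⟨g, mem_fixing.2 h⟩ n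

lemma left_pow_of_right_eq {i : Fin N} {g : HyperoctahedralGroup N} (h : g.right i = i) (n : ℕ) :
    (g ^ n).left i = g.left i ^ n :=
  map_pow (fixingSign i) ⟨g, mem_fixing.2 h⟩ n

/-- The length and the sign of the signed cycle through a point. -/
noncomputable def label (g : HyperoctahedralGroup N) (i : Fin N) : ℕ × ℤˣ :=
  (Function.minimalPeriod g.right i, (g ^ Function.minimalPeriod g.right i).left i)

lemma isPeriodicPt (g : HyperoctahedralGroup N) (i : Fin N) : i ∈ Function.periodicPts g.right :=
  Function.Injective.mem_periodicPts g.right.injective i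

lemma label_fst_pos (g : HyperoctahedralGroup N) (i : Fin N) : 0 < (label g i).1 :=
  Function.minimalPeriod_pos_of_mem_periodicPts (isPeriodicPt g i)

lemma iterate_eq_pow (σ : Equiv.Perm (Fin N)) (n : ℕ) : σ^[n] = ⇑(σ ^ n) := by
  rw [Equiv.Perm.coe_pow]

lemma right_pow_label (g : HyperoctahedralGroup N) (i : Fin N) :
    (g ^ (label g i).1).right i = i := by
  have := Function.iterate_minimalPeriod (f := g.right) (x := i)
  rw [iterate_eq_pow, ← right_pow] at this
  exact this

lemma right_pow_eq_iff (g : HyperoctahedralGroup N) (i : Fin N) (n : ℕ) :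
    (g ^ n).right i = i ↔ (label g i).1 ∣ n := by
  rw [right_pow, ← iterate_eq_pow]
  exact (Function.isPeriodicPt_iff_minimalPeriod_dvd (f := g.right) (x := i) (n := n))

lemma right_zpow_eq_iff (g : HyperoctahedralGroup N) (i : Fin N) (n : ℤ) :
    (g ^ n).right i = i ↔ ((label g i).1 : ℤ) ∣ n := by
  rw [right_zpow]
  exact MulAction.zpow_smul_eq_iff_minimalPeriod_dvd (a := g.right) (b := i) (n := n)

lemma left_pow_label_mul (g : HyperoctahedralGroup N) (i : Fin N) (m : ℤ) :
    (g ^ (((label g i).1 : ℤ) * m)).left i = (label g i).2 ^ m := by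
  rw [zpow_mul, zpow_natCast, left_zpow_of_right_eq (right_pow_label g i)]
  rfl

lemma left_npow_label_mul (g : HyperoctahedralGroup N) (i : Fin N) (m : ℕ) :
    (g ^ ((label g i).1 * m)).left i = (label g i).2 ^ m := by
  rw [pow_mul, left_pow_of_right_eq (right_pow_label g i)]
  rfl

lemma conj_left_apply (b g : HyperoctahedralGroup N) (i : Fin N) (h : g.right i = i) :
    (b * g * b⁻¹).left (b.right i) = g.left i := by
  have h1 : signedPerm N (b * g * b⁻¹) (signedPerm N b (i, 1)) = signedPerm N b (signedPerm N g (i, 1)) := by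
    simp [map_mul]
  have h2 := congrArg Prod.snd h1
  have h3 : (b * g * b⁻¹).right (b.right i) = b.right i := by simp [h]
  simp only [signedPerm_apply, h3, h, mul_one] at h2
  rw [mul_comm, mul_right_inj] at h2
  exact h2

lemma label_conj (b g : HyperoctahedralGroup N) (i : Fin N) :
    label (b * g * b⁻¹) (b.right i) = label g i := by
  have h1 : Function.minimalPeriod (b * g * b⁻¹).right (b.right i) = Function.minimalPeriod g.right i := by
    apply Nat.dvd_antisymm
    · refine (right_pow_eq_iff (b * g * b⁻¹) (b.right i) _).1 ?_
      rw [conj_pow]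
      have := right_pow_label g i
      simp only [label] at this
      simp [this]
    · refine (right_pow_eq_iff g i _).1 ?_
      have h := right_pow_label (b * g * b⁻¹) (b.right i)
      simp only [label] at h
      rw [conj_pow] at h
      simpa using h
  refine Prod.ext h1 ?_
  change ((b * g * b⁻¹) ^ Function.minimalPeriod (b * g * b⁻¹).right (b.right i)).left _ = _
  rw [h1, conj_pow, conj_left_apply]
  · rfl
  · exact right_pow_label g i

lemma label_pow (g : HyperoctahedralGroup N) (i : Fin N) (P : ℕ) (hP : 0 < P) :
    label (g ^ P) i = ((label g i).1 / (label g i).1.gcd P, (label g i).2 ^ (P / (label g i).1.gcd P)) := by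
  have h1 : Function.minimalPeriod (g ^ P).right i = (label g i).1 / (label g i).1.gcd P := by
    rw [right_pow, ← iterate_eq_pow]
    exact Function.minimalPeriod_iterate_eq_div_gcd hP.ne'
  refine Prod.ext h1 ?_
  change ((g ^ P) ^ Function.minimalPeriod (g ^ P).right i).left i = _
  rw [h1, ← pow_mul]
  have h2 : P * ((label g i).1 / (label g i).1.gcd P) = (label g i).1 * (P / (label g i).1.gcd P) := by
    rw [← Nat.mul_div_assoc _ (Nat.gcd_dvd_left _ _), ← Nat.mul_div_assoc _ (Nat.gcd_dvd_right _ _), mul_comm]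
  rw [h2, left_npow_label_mul]

/-- The action of `ℤ × {±1}` on signed points through powers of an element and scalars. -/
def cyclicHom (g : HyperoctahedralGroup N) : Multiplicative ℤ × ℤˣ →* Equiv.Perm (Fin N × ℤˣ) :=
  (signedPerm N).comp
    (MonoidHom.noncommCoprod (zpowersHom _ g) (scalar N) fun _ s => (commute_scalar s _).symm)

lemma cyclicHom_apply (g : HyperoctahedralGroup N) (n : ℤ) (s : ℤˣ) :
    cyclicHom g (Multiplicative.ofAdd n, s) = signedPerm N (scalar N s * g ^ n) := by
  simp only [cyclicHom, MonoidHom.comp_apply, MonoidHom.noncommCoprod_apply]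
  rw [(commute_scalar s _).eq]
  simp

lemma cyclicHom_apply_eq_iff (g : HyperoctahedralGroup N) (n : ℤ) (s : ℤˣ) (y : Fin N × ℤˣ) :
    cyclicHom g (Multiplicative.ofAdd n, s) y = y ↔
      ((label g y.1).1 : ℤ) ∣ n ∧ s * (label g y.1).2 ^ (n / (label g y.1).1) = 1 := by
  rw [cyclicHom_apply, signedPerm_apply, Prod.ext_iff, scalar_mul_right, right_zpow_eq_iff]
  refine and_congr_right fun h => ?_
  rw [(right_zpow_eq_iff g y.1 n).2 h, mul_eq_right, scalar_mul_left]
  obtain ⟨m, rfl⟩ := h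
  rw [left_pow_label_mul, Int.mul_ediv_cancel_left]
  exact_mod_cast (label_fst_pos g y.1).ne'

lemma isConj_of_label {g g' : HyperoctahedralGroup N} (π : Equiv.Perm (Fin N))
    (hπ : ∀ i, label g' (π i) = label g i) : IsConj g g' := by
  obtain ⟨f, hf⟩ := @exists_equivariant_equiv (Multiplicative ℤ × ℤˣ) (Fin N × ℤˣ) (Fin N × ℤˣ) _ _
    (MulAction.compHom _ (cyclicHom g)) (MulAction.compHom _ (cyclicHom g'))
    (π.prodCongr (Equiv.refl _)) (by
      rintro ⟨i, e⟩
      ext ⟨n, s⟩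
      refine (cyclicHom_apply_eq_iff g' n s _).trans (Iff.trans ?_ (cyclicHom_apply_eq_iff g n s _).symm)
      simp [hπ])
  have hf' : ∀ γ y, f (cyclicHom g γ y) = cyclicHom g' γ (f y) := hf
  obtain ⟨b, hb⟩ := exists_signedPerm_eq f (by
    intro i e
    have := hf' (Multiplicative.ofAdd 0, e) (i, 1)
    rw [cyclicHom_apply, cyclicHom_apply] at this
    simp only [signedPerm_apply, scalar_mul_right, scalar_mul_left] at this
    simpa [mul_comm] using this)
  rw [isConj_iff]
  refine ⟨b, ?_⟩
  rw [mul_inv_eq_iff_eq_mul]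
  apply signedPerm_injective
  ext1 y
  have := hf' (Multiplicative.ofAdd 1, 1) y
  rw [cyclicHom_apply, cyclicHom_apply] at this
  simpa [hb] using this

/-- The number of points lying on signed cycles with a given length and sign. -/
noncomputable def cnt (g : HyperoctahedralGroup N) (l : ℕ × ℤˣ) : ℕ :=
  Nat.card {i // label g i = l}

lemma isConj_iff_cnt {g g' : HyperoctahedralGroup N} : IsConj g g' ↔ ∀ l, cnt g l = cnt g' l := by
  constructor
  · intro h l
    obtain ⟨b, rfl⟩ := isConj_iff.1 h
    exact Nat.card_congr (b.right.subtypeEquiv fun i => by rw [label_conj])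
  · intro h
    obtain ⟨π, hπ⟩ := exists_equiv_comp_eq (label g) (label g') h
    exact isConj_of_label π hπ

end HyperoctahedralGroup

/-- A bipartition, recorded by the multiplicities of its parts: `μ (i, s)` counts the parts of
size `i + 1` and sign `s`. -/
abbrev SignedType : Type := (ℕ × ℤˣ) →₀ ℕ

/-- The sum of the parts. -/
def SignedType.size (μ : SignedType) : ℕ := μ.sum fun k m => m * (k.1 + 1)

/-- The product of the signs of the parts. -/
def SignedType.sign (μ : SignedType) : ℤˣ := μ.prod fun k m => k.2 ^ m

lemma SignedType.size_add (μ ν : SignedType) : (μ + ν).size = μ.size + ν.size :=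
  Finsupp.sum_add_index' (by simp) (by intros; ring)

lemma SignedType.sign_add (μ ν : SignedType) : (μ + ν).sign = μ.sign * ν.sign :=
  Finsupp.prod_add_index' (by simp) (by intros; rw [pow_add])

lemma SignedType.size_single (k : ℕ × ℤˣ) (m : ℕ) : SignedType.size (Finsupp.single k m) = m * (k.1 + 1) :=
  Finsupp.sum_single_index (by simp)

lemma SignedType.sign_single (k : ℕ × ℤˣ) (m : ℕ) : SignedType.sign (Finsupp.single k m) = k.2 ^ m :=
  Finsupp.prod_single_index (by simp)

namespace HyperoctahedralGroup

variable {N : ℕ}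

lemma label_smul_zpowers (g : HyperoctahedralGroup N) (γ : Subgroup.zpowers g.right) (i : Fin N) :
    label g (γ • i) = label g i := by
  obtain ⟨_, n, rfl⟩ := γ
  have := label_conj (g ^ n) g i
  rw [(Commute.refl g).zpow_left n |>.eq, mul_inv_cancel_right, right_zpow] at this
  exact this

lemma card_orbit_zpowers (g : HyperoctahedralGroup N) (i : Fin N) :
    Nat.card (MulAction.orbit (Subgroup.zpowers g.right) i) = (label g i).1 := by
  classical
  have : Fintype (MulAction.orbit (Subgroup.zpowers g.right) i) := Fintype.ofFinite _
  rw [Nat.card_eq_fintype_card]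
  exact (MulAction.minimalPeriod_eq_card (a := g.right) (b := i)).symm

lemma dvd_cnt (g : HyperoctahedralGroup N) (l : ℕ × ℤˣ) : l.1 ∣ cnt g l := by
  let R := MulAction.orbitRel (Subgroup.zpowers g.right) (Fin N)
  let lab : Quotient R → ℕ × ℤˣ := Quotient.lift (label g) (by
    rintro _ i ⟨γ, rfl⟩; exact label_smul_zpowers g γ i)
  have := card_preimage_of_card_fiber (Quotient.mk R) (fun q => lab q = l) l.1 Quotient.mk_surjective (by
    intro q hq
    obtain ⟨i, rfl⟩ := Quotient.exists_rep q
    have hi : label g i = l := hq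
    rw [← hi, ← card_orbit_zpowers]
    exact Nat.card_congr (Equiv.subtypeEquivRight fun j =>
      ⟨fun h => Quotient.exact h, fun h => Quotient.sound h⟩))
  exact ⟨_, this.trans (mul_comm _ _)⟩

lemma label_fst_le (g : HyperoctahedralGroup N) (i : Fin N) : (label g i).1 ≤ N := by
  rw [← card_orbit_zpowers]
  simpa using Nat.card_le_card_of_injective
    (Subtype.val : MulAction.orbit (Subgroup.zpowers g.right) i → Fin N) Subtype.val_injective

lemma cnt_eq_zero_of_lt (g : HyperoctahedralGroup N) (l : ℕ × ℤˣ) (h : N < l.1) : cnt g l = 0 := by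
  have : IsEmpty {i // label g i = l} := ⟨fun i => by
    have := label_fst_le g i.1
    rw [i.2] at this
    lia⟩
  exact Nat.card_of_isEmpty

lemma cnt_zero (g : HyperoctahedralGroup N) (s : ℤˣ) : cnt g (0, s) = 0 := by
  have : IsEmpty {i // label g i = (0, s)} := ⟨fun i => by
    have := label_fst_pos g i.1
    rw [i.2] at this
    simp at this⟩
  exact Nat.card_of_isEmpty

/-- The signed cycle type. -/
noncomputable def typ (g : HyperoctahedralGroup N) : SignedType :=
  Finsupp.onFinset (Finset.range N ×ˢ Finset.univ) (fun k => cnt g (k.1 + 1, k.2) / (k.1 + 1)) (by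
    intro k hk
    by_contra h
    apply hk
    rw [cnt_eq_zero_of_lt, Nat.zero_div]
    simp only [Finset.mem_product, Finset.mem_range, Finset.mem_univ, and_true] at h
    simp only
    lia)

lemma cnt_succ (g : HyperoctahedralGroup N) (k : ℕ × ℤˣ) :
    cnt g (k.1 + 1, k.2) = typ g k * (k.1 + 1) :=
  (Nat.div_mul_cancel (dvd_cnt g (k.1 + 1, k.2))).symm

lemma isConj_iff_typ {g g' : HyperoctahedralGroup N} : IsConj g g' ↔ typ g = typ g' := by
  rw [isConj_iff_cnt]
  constructor
  · intro h
    ext k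
    exact congrArg (· / (k.1 + 1)) (h (k.1 + 1, k.2))
  · rintro h ⟨k, s⟩
    rcases k with _ | k
    · rw [cnt_zero, cnt_zero]
    · rw [cnt_succ g (k, s), cnt_succ g' (k, s), h]

/-- Sums over the points of a function of the label. -/
lemma sum_label {M : Type*} [AddCommMonoid M] (g : HyperoctahedralGroup N) (F : ℕ × ℤˣ → M) :
    ∑ i, F (label g i) = (typ g).sum fun k m => (m * (k.1 + 1)) • F (k.1 + 1, k.2) := by
  classical
  rw [typ, Finsupp.onFinset_sum _ (by simp)]
  have hmap : ∀ i ∈ (Finset.univ : Finset (Fin N)), ((label g i).1 - 1, (label g i).2) ∈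
      Finset.range N ×ˢ (Finset.univ : Finset ℤˣ) := by
    intro i _
    have := label_fst_le g i
    have := label_fst_pos g i
    simp only [Finset.mem_product, Finset.mem_range, Finset.mem_univ, and_true]
    lia
  rw [← Finset.sum_fiberwise_of_maps_to hmap]
  refine Finset.sum_congr rfl fun k _ => ?_
  have hiff : ∀ i, ((label g i).1 - 1, (label g i).2) = k ↔ label g i = (k.1 + 1, k.2) := by
    intro i
    have := label_fst_pos g i
    rw [Prod.ext_iff, Prod.ext_iff]
    simp only
    constructor <;> rintro ⟨h1, h2⟩ <;> exact ⟨by lia, h2⟩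
  simp only [hiff]
  rw [Nat.div_mul_cancel (dvd_cnt g (k.1 + 1, k.2)), Finset.sum_congr rfl fun i hi => by
    rw [(Finset.mem_filter.1 hi).2], Finset.sum_const, cnt, Nat.card_eq_fintype_card, Fintype.card_subtype]

lemma size_typ (g : HyperoctahedralGroup N) : (typ g).size = N := by
  have := sum_label g (fun _ => (1 : ℕ))
  simp at this
  exact this.symm

lemma label_eq {g : HyperoctahedralGroup N} {i : Fin N} {n : ℕ} {s : ℤˣ} (hn : 0 < n)
    (h : signedPerm N (g ^ n) (i, 1) = (i, s))
    (hlt : ∀ m, 0 < m → m < n → (g ^ m).right i ≠ i) : label g i = (n, s) := by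
  rw [signedPerm_apply, Prod.ext_iff] at h
  obtain ⟨h1, h2⟩ := h
  simp only [mul_one] at h1 h2
  have h3 : (label g i).1 = n := by
    have hd := (right_pow_eq_iff g i n).1 h1
    refine le_antisymm (Nat.le_of_dvd hn hd) ?_
    by_contra hlt'
    exact hlt _ (label_fst_pos g i) (by lia) (right_pow_label g i)
  refine Prod.ext h3 ?_
  rw [h1] at h2
  rw [← h2]
  simp only [← h3]
  rfl

/-- The underlying set of the standard permutation of a given signed cycle type. -/
abbrev Model (μ : SignedType) : Type :=
  Σ a : μ.support, Fin (μ a.1) × Fin (a.1.1 + 1)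

lemma card_model (μ : SignedType) : Fintype.card (Model μ) = μ.size := by
  rw [Fintype.card_sigma, SignedType.size, Finsupp.sum]
  simp only [Fintype.card_prod, Fintype.card_fin]
  exact Finset.sum_coe_sort μ.support fun a => μ a * (a.1 + 1)

/-- Rotation of every cycle of the model. -/
def Model.rotate (μ : SignedType) : Equiv.Perm (Model μ) :=
  Equiv.sigmaCongrRight fun _ => (Equiv.refl _).prodCongr (finRotate _)

lemma exists_label_of_size (μ : SignedType) (h : μ.size = N) :
    ∃ (e : Model μ ≃ Fin N) (g : HyperoctahedralGroup N),
      (∀ y, label g (e y) = (y.1.1.1 + 1, y.1.1.2)) ∧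
      ∀ y, g.left (e y) = if y.2.2 = 0 then y.1.1.2 else 1 := by
  let e : Model μ ≃ Fin N := Fintype.equivFinOfCardEq (by rw [card_model, h])
  let g : HyperoctahedralGroup N :=
    ⟨fun i => if (e.symm i).2.2 = 0 then (e.symm i).1.1.2 else 1, e.permCongr (Model.rotate μ)⟩
  have hr : ∀ y, g.right (e y) = e (Model.rotate μ y) := fun y => by
    simp [g, Equiv.permCongr_apply]
  have hl : ∀ y, g.left (e y) = if y.2.2 = 0 then y.1.1.2 else 1 := fun y => by
    have := e.symm_apply_apply y
    simp only [g]
    rw [this]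
  have hpow : ∀ (a : μ.support) (j : Fin (μ a.1)) (n : ℕ) (hn : n < a.1.1 + 1),
      signedPerm N (g ^ n) (e ⟨a, j, 0⟩, 1) = (e ⟨a, j, ⟨n, hn⟩⟩, 1) := by
    intro a j n
    induction n with
    | zero => intro hn; simp
    | succ n ih =>
      intro hn
      rw [pow_succ', map_mul, Equiv.Perm.mul_apply, ih (by lia), signedPerm_apply]
      simp only
      have : Model.rotate μ ⟨a, j, ⟨n, by lia⟩⟩ = ⟨a, j, ⟨n + 1, hn⟩⟩ := by
        simp only [Model.rotate, Equiv.sigmaCongrRight_apply, Equiv.prodCongr_apply, Prod.map]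
        rw [finRotate_of_lt (by lia)]
        simp
      rw [hr, this, hl]
      simp
  have hzero : ∀ (a : μ.support) (j : Fin (μ a.1)), label g (e ⟨a, j, 0⟩) = (a.1.1 + 1, a.1.2) := by
    intro a j
    refine label_eq (by lia) ?_ ?_
    · rw [pow_succ', map_mul, Equiv.Perm.mul_apply, hpow a j a.1.1 (by lia), signedPerm_apply]
      simp only
      have : Model.rotate μ ⟨a, j, ⟨a.1.1, by lia⟩⟩ = ⟨a, j, 0⟩ := by
        simp only [Model.rotate, Equiv.sigmaCongrRight_apply, Equiv.prodCongr_apply, Prod.map]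
        rw [finRotate_last']
        rfl
      rw [hr, this, hl]
      simp
    · intro m hm hlt h0
      have h1 := congrArg Prod.fst (hpow a j m hlt)
      rw [signedPerm_apply] at h1
      simp only at h1
      rw [h0] at h1
      have := e.injective h1
      simp at this
      lia
  refine ⟨e, g, ?_, hl⟩
  rintro ⟨a, j, n, hn⟩
  have h1 := congrArg Prod.fst (hpow a j n hn)
  rw [signedPerm_apply] at h1
  simp only at h1
  rw [← h1]
  have := label_conj (g ^ n) g (e ⟨a, j, 0⟩)
  rw [((Commute.refl g).pow_left n).eq, mul_inv_cancel_right] at this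
  rw [this, hzero]

lemma exists_typ_eq (μ : SignedType) (h : μ.size = N) : ∃ g : HyperoctahedralGroup N,
    typ g = μ ∧ wreathSign N g = μ.sign := by
  classical
  obtain ⟨e, g, hg, hl⟩ := exists_label_of_size μ h
  refine ⟨g, ?_, ?_⟩
  · ext k
    have h1 := cnt_succ g k
    have h2 : cnt g (k.1 + 1, k.2) = μ k * (k.1 + 1) := by
      rw [cnt, Nat.card_congr (e.symm.subtypeEquiv (p := fun i => label g i = (k.1 + 1, k.2))
        (q := fun y => y.1.1 = k) fun i => ?_), Nat.card_eq_fintype_card, Fintype.card_subtype,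
        Finset.card_filter, Fintype.sum_sigma]
      · change (∑ a : μ.support, ∑ _y : Fin (μ a.1) × Fin (a.1.1 + 1), if a.1 = k then 1 else 0) = _
        simp only [Finset.sum_const, Finset.card_univ, Fintype.card_prod, Fintype.card_fin,
          smul_eq_mul, mul_ite, mul_one, mul_zero]
        rw [Finset.sum_coe_sort μ.support fun a => if a = k then μ a * (a.1 + 1) else 0,
          Finset.sum_ite_eq']
        split_ifs with hk
        · rfl
        · rw [Finsupp.notMem_support_iff.1 hk, zero_mul]
      · have := hg (e.symm i)
        rw [Equiv.apply_symm_apply] at this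
        rw [this, Prod.ext_iff, Prod.ext_iff]
        simp
    exact Nat.eq_of_mul_eq_mul_right (by lia) (h1.symm.trans h2)
  · change ∏ i, g.left i = _
    rw [← Equiv.prod_comp e, Fintype.prod_sigma]
    simp only [hl]
    change (∏ a : μ.support, ∏ y : Fin (μ a.1) × Fin (a.1.1 + 1), if y.2 = 0 then a.1.2 else 1) = _
    simp only [Fintype.prod_prod_type, Finset.prod_ite_eq', Finset.mem_univ, if_true,
      Finset.prod_const, Finset.card_univ, Fintype.card_fin]
    exact Finset.prod_coe_sort μ.support fun a => a.2 ^ μ a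

lemma wreathSign_eq_sign (g : HyperoctahedralGroup N) : wreathSign N g = (typ g).sign := by
  obtain ⟨g', h1, h2⟩ := exists_typ_eq (typ g) (size_typ g)
  obtain ⟨b, rfl⟩ := isConj_iff.1 (isConj_iff_typ.2 h1)
  rw [← h2, map_mul, map_mul, map_inv, mul_comm, inv_mul_cancel_left]

lemma exists_commute_wreathSign (g : HyperoctahedralGroup N) (i : Fin N)
    (h : Odd (label g i).1) : ∃ z, Commute z g ∧ wreathSign N z = -1 := by
  classical
  let O := MulAction.orbit (Subgroup.zpowers g.right) i
  have hO : ∀ j, g.right⁻¹ j ∈ O ↔ j ∈ O := by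
    intro j
    rw [← MulAction.orbit_eq_iff, ← MulAction.orbit_eq_iff]
    have : MulAction.orbit (Subgroup.zpowers g.right) (g.right⁻¹ j) =
        MulAction.orbit (Subgroup.zpowers g.right) j :=
      MulAction.orbit_eq_iff.2 ⟨⟨g.right⁻¹, Subgroup.inv_mem _ (Subgroup.mem_zpowers _)⟩, rfl⟩
    rw [this]
  refine ⟨⟨fun j => if j ∈ O then -1 else 1, 1⟩, ?_, ?_⟩
  · refine SemidirectProduct.ext (funext fun j => ?_) ?_
    · rw [mul_left_apply, mul_left_apply]
      simp only [hO, inv_one, Equiv.Perm.one_apply]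
      exact mul_comm _ _
    · simp
  · change ∏ j, (if j ∈ O then (-1 : ℤˣ) else 1) = -1
    rw [Finset.prod_ite, Finset.prod_const, Finset.prod_const_one, mul_one]
    have h1 := card_orbit_zpowers g i
    rw [← h1, Nat.card_eq_fintype_card, Fintype.card_subtype] at h
    exact h.neg_one_pow

lemma isConj_weylD {g g' : WeylD N} (h : IsConj (g : HyperoctahedralGroup N) g') (i : Fin N)
    (hi : Odd (label (g : HyperoctahedralGroup N) i).1) : IsConj g g' := by
  obtain ⟨b, hb⟩ := isConj_iff.1 h
  by_cases hs : wreathSign N b = 1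
  · exact isConj_iff.2 ⟨⟨b, hs⟩, Subtype.ext hb⟩
  · obtain ⟨z, hz, hz1⟩ := exists_commute_wreathSign _ i hi
    refine isConj_iff.2 ⟨⟨b * z, ?_⟩, Subtype.ext ?_⟩
    · change wreathSign N (b * z) = 1
      rw [map_mul, (Int.units_eq_one_or _).resolve_left hs, hz1]
      simp
    · rw [← hb]
      change b * z * g * (b * z)⁻¹ = _
      rw [mul_assoc b, hz.eq]
      group

lemma label_pow_of_coprime (g : HyperoctahedralGroup N) (i : Fin N) (j : ℕ)
    (hj : (orderOf g).Coprime j) : label (g ^ j) i = label g i := by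
  rcases Nat.eq_zero_or_pos j with rfl | hj0
  · have : g = 1 := by simpa using hj
    rw [this, pow_zero]
  · have hk : (label g i).1 ∣ orderOf g := by
      rw [← right_pow_eq_iff, pow_orderOf_eq_one]
      simp
    have hgcd : (label g i).1.gcd j = 1 := Nat.Coprime.coprime_dvd_left hk hj
    rw [label_pow _ _ _ hj0, hgcd, Nat.div_one, Nat.div_one]
    refine Prod.ext rfl ?_
    simp only
    rcases Int.units_eq_one_or (label g i).2 with hs | hs
    · rw [hs, one_pow]
    · obtain ⟨m, hm⟩ := hk
      have h1 := left_npow_label_mul g i m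
      rw [← hm, pow_orderOf_eq_one, hs] at h1
      have h2 : Even m := by
        rcases Nat.even_or_odd m with h | h
        · exact h
        · rw [h.neg_one_pow] at h1
          exact absurd h1 (show ¬ (1 : ℤˣ) = -1 by decide)
      have h3 : Odd j := by
        rw [hm] at hj
        have := Nat.Coprime.coprime_dvd_left (Dvd.dvd.mul_left h2.two_dvd _) hj
        exact (Nat.coprime_two_left).1 this
      rw [hs, h3.neg_one_pow]

lemma isConj_pow_of_coprime (g : HyperoctahedralGroup N) (j : ℕ)
    (hj : (orderOf g).Coprime j) : IsConj g (g ^ j) :=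
  isConj_of_label (Equiv.refl _) fun i => label_pow_of_coprime g i j hj

lemma weylD_isConj_pow {g : WeylD N} (i : Fin N)
    (hi : Odd (label (g : HyperoctahedralGroup N) i).1) (j : ℕ)
    (hj : (Nat.card (WeylD N)).Coprime j) : IsConj g (g ^ j) := by
  refine isConj_weylD ?_ i hi
  rw [Subgroup.coe_pow]
  apply isConj_pow_of_coprime
  rw [Subgroup.orderOf_coe]
  exact Nat.Coprime.coprime_dvd_left (orderOf_dvd_natCard g) hj

end HyperoctahedralGroup

section Centralizers

variable {G : Type*} [Group G] [Finite G]

lemma card_centralizer_mul_card_isConj (g : G) :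
    Nat.card (Subgroup.centralizer {g}) * Nat.card {x // IsConj x g} = Nat.card G := by
  classical
  have := Fintype.ofFinite G
  have h3 := MulAction.card_orbit_mul_card_stabilizer_eq_card_group (ConjAct G) g
  simp only [← Nat.card_eq_fintype_card] at h3
  have h4 : Nat.card (Subgroup.centralizer {g}) = Nat.card (MulAction.stabilizer (ConjAct G) g) := by
    rw [ConjAct.stabilizer_eq_centralizer]
    rfl
  have h5 : Nat.card {x // IsConj x g} = Nat.card (MulAction.orbit (ConjAct G) g) :=
    Nat.card_congr (Equiv.subtypeEquivRight fun x => ConjAct.mem_orbit_conjAct.symm)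
  rw [h4, h5, mul_comm, h3]
  rfl

lemma sum_card_centralizer_mul [Fintype G] [Fintype (ConjClasses G)] (ψ : ConjClasses G → ℕ) :
    ∑ g : G, Nat.card (Subgroup.centralizer {g}) * ψ (ConjClasses.mk g) =
      Nat.card G * ∑ κ, ψ κ := by
  classical
  rw [← Finset.sum_fiberwise_of_maps_to (s := Finset.univ) (t := Finset.univ)
    (g := ConjClasses.mk) (fun _ _ => Finset.mem_univ _), Finset.mul_sum]
  refine Finset.sum_congr rfl fun κ _ => ?_
  obtain ⟨g, rfl⟩ := ConjClasses.exists_rep κ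
  have : ∀ x ∈ Finset.univ.filter (fun x : G => ConjClasses.mk x = ConjClasses.mk g),
      Nat.card (Subgroup.centralizer {x}) * ψ (ConjClasses.mk x) =
      Nat.card (Subgroup.centralizer {g}) * ψ (ConjClasses.mk g) := by
    intro x hx
    have hc : ConjClasses.mk x = ConjClasses.mk g := (Finset.mem_filter.1 hx).2
    rw [hc]
    have h1 := card_centralizer_mul_card_isConj x
    have h2 := card_centralizer_mul_card_isConj g
    have hxg : IsConj x g := ConjClasses.mk_eq_mk_iff_isConj.1 hc
    have h3 : Nat.card {y // IsConj y x} = Nat.card {y // IsConj y g} :=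
      Nat.card_congr (Equiv.subtypeEquivRight fun y => ⟨fun h => h.trans hxg, fun h => h.trans hxg.symm⟩)
    rw [h3, ← h2] at h1
    have : Nonempty {y // IsConj y g} := ⟨g, IsConj.refl g⟩
    rw [Nat.eq_of_mul_eq_mul_right Nat.card_pos h1]
  rw [Finset.sum_congr rfl this, Finset.sum_const, smul_eq_mul, ← mul_assoc]
  congr 1
  rw [← card_centralizer_mul_card_isConj g, mul_comm]
  congr 1
  rw [Nat.card_eq_fintype_card, Fintype.card_subtype]
  simp only [ConjClasses.mk_eq_mk_iff_isConj]

lemma sum_card_centralizer [Fintype G] :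
    ∑ g : G, Nat.card (Subgroup.centralizer {g}) = Nat.card G * Nat.card (ConjClasses G) := by
  have := Fintype.ofFinite (ConjClasses G)
  have h := sum_card_centralizer_mul (G := G) (fun _ => 1)
  simpa [Nat.card_eq_fintype_card] using h

lemma card_le_index_mul_card_inf (H K : Subgroup G) :
    Nat.card K ≤ H.index * Nat.card {x : K // (x : G) ∈ H} := by
  have h1 := (H.subgroupOf K).index_mul_card
  have h2 : (H.subgroupOf K).index ≤ H.index := by
    rw [← H.relIndex_top_right]
    exact Subgroup.relIndex_le_of_le_right le_top (Subgroup.index_ne_zero_of_finite)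
  calc Nat.card K = (H.subgroupOf K).index * Nat.card (H.subgroupOf K) := h1.symm
    _ ≤ _ := Nat.mul_le_mul_right _ h2

lemma card_conjClasses_le_index_mul (H : Subgroup G) :
    Nat.card (ConjClasses G) ≤ H.index * Nat.card (ConjClasses H) := by
  classical
  have := Fintype.ofFinite G
  have hG : ∑ g : G, Nat.card (Subgroup.centralizer {g}) ≤
      H.index * ∑ h : H, Nat.card (Subgroup.centralizer {(h : G)}) := by
    have e : Nat.card (Σ g : G, {x : Subgroup.centralizer {g} // (x : G) ∈ H}) =
        Nat.card (Σ h : H, Subgroup.centralizer {(h : G)}) :=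
      Nat.card_congr
        { toFun := fun y => ⟨⟨y.2.1.1, y.2.2⟩, ⟨y.1, by
            rw [Subgroup.mem_centralizer_singleton_iff]
            exact (Subgroup.mem_centralizer_singleton_iff.1 y.2.1.2).symm⟩⟩
          invFun := fun y => ⟨y.2.1, ⟨⟨y.1.1, by
            rw [Subgroup.mem_centralizer_singleton_iff]
            exact (Subgroup.mem_centralizer_singleton_iff.1 y.2.2).symm⟩, y.1.2⟩⟩
          left_inv := fun _ => rfl
          right_inv := fun _ => rfl }
    rw [Nat.card_sigma, Nat.card_sigma] at e
    rw [← e, Finset.mul_sum]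
    exact Finset.sum_le_sum fun g _ => card_le_index_mul_card_inf H _
  have hH : ∑ h : H, Nat.card (Subgroup.centralizer {(h : G)}) ≤
      H.index * ∑ h : H, Nat.card (Subgroup.centralizer {h}) := by
    rw [Finset.mul_sum]
    refine Finset.sum_le_sum fun h _ => (card_le_index_mul_card_inf H _).trans_eq ?_
    congr 1
    exact Nat.card_congr
      { toFun := fun y => ⟨⟨y.1.1, y.2⟩, by
          rw [Subgroup.mem_centralizer_singleton_iff]
          exact Subtype.ext (Subgroup.mem_centralizer_singleton_iff.1 y.1.2)⟩
        invFun := fun y => ⟨⟨y.1.1, by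
          rw [Subgroup.mem_centralizer_singleton_iff]
          exact congrArg Subtype.val (Subgroup.mem_centralizer_singleton_iff.1 y.2)⟩, y.1.2⟩
        left_inv := fun _ => rfl
        right_inv := fun _ => rfl }
  have h := hG.trans (Nat.mul_le_mul_left _ hH)
  rw [sum_card_centralizer, sum_card_centralizer, ← H.index_mul_card] at h
  have hpos : 0 < H.index * Nat.card H := by rw [H.index_mul_card]; exact Nat.card_pos
  refine Nat.le_of_mul_le_mul_left (h.trans_eq ?_) hpos
  ring

lemma card_centralizer_coe_le (H : Subgroup G) (h : H) :
    Nat.card (Subgroup.centralizer {h}) ≤ Nat.card (Subgroup.centralizer {(h : G)}) :=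
  Nat.card_le_card_of_injective
    (fun y => ⟨y.1.1, by
      rw [Subgroup.mem_centralizer_singleton_iff]
      exact congrArg Subtype.val (Subgroup.mem_centralizer_singleton_iff.1 y.2)⟩)
    fun y z hyz => Subtype.ext (Subtype.ext (Subtype.mk.inj hyz))

end Centralizers

namespace HyperoctahedralGroup

variable {N : ℕ}

instance : Finite (HyperoctahedralGroup N) :=
  Finite.of_injective (fun g => (g.left, g.right)) fun _ _ h =>
    SemidirectProduct.ext (congrArg Prod.fst h) (congrArg Prod.snd h)

lemma index_weylD_le : (WeylD N).index ≤ 2 := by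
  have h1 : (WeylD N).index = Nat.card (wreathSign N).range := Subgroup.index_ker _
  rw [h1]
  refine (Subgroup.card_le_card_group _).trans ?_
  rw [Nat.card_eq_fintype_card, Fintype.card_units_int]

/-- The signed cycle type of a conjugacy class. -/
noncomputable def classTyp : ConjClasses (HyperoctahedralGroup N) → SignedType :=
  Quotient.lift typ fun _ _ h => isConj_iff_typ.1 h

lemma classTyp_injective : Function.Injective (classTyp (N := N)) := by
  intro a b
  obtain ⟨a, rfl⟩ := ConjClasses.exists_rep a
  obtain ⟨b, rfl⟩ := ConjClasses.exists_rep b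
  exact fun h => ConjClasses.mk_eq_mk_iff_isConj.2 (isConj_iff_typ.2 h)

lemma sum_weylD_le (T : Finset SignedType) (hT : ∀ μ, μ.size = N → μ ∈ T) (ψ : SignedType → ℕ)
    [Fintype (WeylD N)] :
    ∑ g : WeylD N, Nat.card (Subgroup.centralizer {g}) * ψ (typ (g : HyperoctahedralGroup N)) ≤
      2 * Nat.card (WeylD N) * ∑ μ ∈ T, ψ μ := by
  classical
  have := Fintype.ofFinite (HyperoctahedralGroup N)
  have := Fintype.ofFinite (ConjClasses (HyperoctahedralGroup N))
  calc ∑ g : WeylD N, Nat.card (Subgroup.centralizer {g}) * ψ (typ (g : HyperoctahedralGroup N))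
      ≤ ∑ g : WeylD N, Nat.card (Subgroup.centralizer {(g : HyperoctahedralGroup N)}) *
          ψ (typ (g : HyperoctahedralGroup N)) :=
        Finset.sum_le_sum fun g _ => Nat.mul_le_mul_right _ (card_centralizer_coe_le _ g)
    _ ≤ ∑ g : HyperoctahedralGroup N, Nat.card (Subgroup.centralizer {g}) * ψ (typ g) := by
        refine (Finset.sum_map Finset.univ (Function.Embedding.subtype (· ∈ WeylD N))
          fun g => Nat.card (Subgroup.centralizer {g}) * ψ (typ g)).symm.trans_le ?_
        exact Finset.sum_le_univ_sum_of_nonneg fun _ => Nat.zero_le _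
    _ = Nat.card (HyperoctahedralGroup N) * ∑ κ, ψ (classTyp κ) :=
        sum_card_centralizer_mul fun κ => ψ (classTyp κ)
    _ ≤ 2 * Nat.card (WeylD N) * ∑ μ ∈ T, ψ μ := by
        refine Nat.mul_le_mul ?_ ?_
        · rw [← (WeylD N).index_mul_card]
          exact Nat.mul_le_mul_right _ index_weylD_le
        · rw [← Finset.sum_image (s := Finset.univ) (f := ψ) fun _ _ _ _ h => classTyp_injective h]
          refine Finset.sum_le_sum_of_subset fun μ hμ => ?_
          obtain ⟨κ, -, rfl⟩ := Finset.mem_image.1 hμ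
          obtain ⟨g, rfl⟩ := ConjClasses.exists_rep κ
          exact hT _ (size_typ g)

lemma card_le_two_mul_card_conjClasses (T : Finset SignedType) (hT : ∀ μ ∈ T, μ.size = N) :
    T.card ≤ 2 * Nat.card (ConjClasses (WeylD N)) := by
  refine le_trans ?_ ((card_conjClasses_le_index_mul (WeylD N)).trans
    (Nat.mul_le_mul_right _ index_weylD_le))
  rw [← Nat.card_eq_finsetCard]
  choose f hf using fun μ : T => exists_typ_eq μ.1 (hT μ.1 μ.2)
  refine Nat.card_le_card_of_injective (fun μ => ConjClasses.mk (f μ)) fun μ ν h => ?_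
  have := congrArg classTyp h
  exact Subtype.ext ((hf μ).1.symm.trans (this.trans (hf ν).1))

/-- The signed cycle type of a conjugacy class of `D_N`. -/
noncomputable def weylTyp : ConjClasses (WeylD N) → SignedType :=
  fun κ => classTyp (ConjClasses.map (WeylD N).subtype κ)

lemma weylTyp_mk (g : WeylD N) :
    weylTyp (ConjClasses.mk g) = typ (g : HyperoctahedralGroup N) := rfl

lemma card_weylTyp_le (T : Finset SignedType) (hT : ∀ μ, μ.size = N → μ ∈ T)
    (A : SignedType → Prop) [DecidablePred A] :
    Nat.card {κ : ConjClasses (WeylD N) // A (weylTyp κ)} ≤ 2 * (T.filter A).card := by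
  classical
  have := Fintype.ofFinite (WeylD N)
  have := Fintype.ofFinite (ConjClasses (WeylD N))
  have h1 := sum_weylD_le T hT fun μ => if A μ then 1 else 0
  have h2 := sum_card_centralizer_mul (G := WeylD N) fun κ => if A (weylTyp κ) then 1 else 0
  simp only [weylTyp_mk] at h2
  replace h1 := h2.symm.trans_le h1
  rw [← Finset.card_filter, ← Finset.card_filter, mul_comm 2, mul_assoc] at h1
  rw [Nat.card_eq_fintype_card, Fintype.card_subtype]
  exact Nat.le_of_mul_le_mul_left h1 Nat.card_pos

end HyperoctahedralGroup

section Centralizers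

variable {G : Type*} [Group G] [Finite G]

lemma card_centralizer_conj (x g : G) :
    Nat.card (Subgroup.centralizer {x * g * x⁻¹}) = Nat.card (Subgroup.centralizer {g}) := by
  have h1 := card_centralizer_mul_card_isConj (x * g * x⁻¹)
  have h2 := card_centralizer_mul_card_isConj g
  have hxg : IsConj (x * g * x⁻¹) g := (isConj_iff.2 ⟨x, rfl⟩).symm
  have h3 : Nat.card {y // IsConj y (x * g * x⁻¹)} = Nat.card {y // IsConj y g} :=
    Nat.card_congr (Equiv.subtypeEquivRight fun y => ⟨fun h => h.trans hxg, fun h => h.trans hxg.symm⟩)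
  rw [h3, ← h2] at h1
  have : Nonempty {y // IsConj y g} := ⟨g, IsConj.refl g⟩
  exact Nat.eq_of_mul_eq_mul_right Nat.card_pos h1

lemma card_mul_sum_centralizer_le [Fintype G] (c : G) (H : Subgroup G) [Fintype H] (M : G → ℕ)
    (hM : ∀ g, Nat.card {x // ∃ h ∈ H, x * g * x⁻¹ = c * h} ≤ M g) :
    Nat.card G * ∑ h : H, Nat.card (Subgroup.centralizer {c * (h : G)}) ≤
      ∑ g : G, Nat.card (Subgroup.centralizer {g}) * M g := by
  classical
  calc Nat.card G * ∑ h : H, Nat.card (Subgroup.centralizer {c * (h : G)})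
      = ∑ x : G, ∑ h : H, Nat.card (Subgroup.centralizer {x⁻¹ * (c * (h : G)) * x}) := by
        have : ∀ (x : G) (h : H), Nat.card (Subgroup.centralizer {x⁻¹ * (c * (h : G)) * x}) =
            Nat.card (Subgroup.centralizer {c * (h : G)}) := fun x h => by
          have := card_centralizer_conj x⁻¹ (c * (h : G))
          rwa [inv_inv] at this
        simp only [this]
        rw [Finset.sum_const, Finset.card_univ, smul_eq_mul, Nat.card_eq_fintype_card]
    _ ≤ ∑ x : G, ∑ g : G, if ∃ h ∈ H, x * g * x⁻¹ = c * h then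
          Nat.card (Subgroup.centralizer {g}) else 0 := by
        refine Finset.sum_le_sum fun x _ => ?_
        rw [← Finset.sum_filter, ← Finset.sum_image (s := Finset.univ)
          (g := fun h : H => x⁻¹ * (c * (h : G)) * x)
          (f := fun g => Nat.card (Subgroup.centralizer {g}))]
        · refine Finset.sum_le_sum_of_subset fun g hg => ?_
          obtain ⟨h, -, rfl⟩ := Finset.mem_image.1 hg
          exact Finset.mem_filter.2 ⟨Finset.mem_univ _, h, h.2, by group⟩
        · intro h _ h' _ hh
          exact Subtype.ext (mul_left_cancel (mul_left_cancel (mul_right_cancel hh)))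
    _ = ∑ g : G, Nat.card (Subgroup.centralizer {g}) *
          Nat.card {x // ∃ h ∈ H, x * g * x⁻¹ = c * h} := by
        rw [Finset.sum_comm]
        refine Finset.sum_congr rfl fun g _ => ?_
        rw [← Finset.sum_filter, Finset.sum_const, smul_eq_mul, mul_comm]
        congr 1
        rw [Nat.card_eq_fintype_card, Fintype.card_subtype]
    _ ≤ _ := Finset.sum_le_sum fun g _ => Nat.mul_le_mul_left _ (hM g)

end Centralizers

namespace HyperoctahedralGroup

variable {N : ℕ}

lemma signedPerm_fixed {g : HyperoctahedralGroup N} {j : Fin N}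
    (h : signedPerm N g (j, 1) = (j, 1)) (e : ℤˣ) : signedPerm N g (j, e) = (j, e) := by
  rw [signedPerm_apply, Prod.ext_iff] at h ⊢
  simp only [mul_one] at h
  refine ⟨h.1, ?_⟩
  simp only
  rw [h.2, one_mul]

lemma label_eq_of_agree {g x : HyperoctahedralGroup N} {i : Fin N}
    (h : ∀ n : ℕ, signedPerm N (x ^ n) (i, 1) = signedPerm N (g ^ n) (i, 1)) :
    label x i = label g i := by
  refine label_eq (label_fst_pos g i) ?_ ?_
  · rw [h, signedPerm_apply]
    refine Prod.ext (right_pow_label g i) ?_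
    simp only [mul_one]
    exact congrArg (g ^ (label g i).1).left (right_pow_label g i)
  · intro m hm hlt h0
    have h1 := congrArg Prod.fst (h m)
    rw [signedPerm_apply, signedPerm_apply] at h1
    simp only at h1
    rw [h0, eq_comm, right_pow_eq_iff] at h1
    exact absurd (Nat.le_of_dvd hm h1) (not_le.2 hlt)

lemma label_eq_one_of_fixed {g : HyperoctahedralGroup N} {j : Fin N}
    (h : signedPerm N g (j, 1) = (j, 1)) : label g j = (1, 1) :=
  label_eq one_pos (by simpa using h) (by lia)

lemma label_of_sameCycle {g : HyperoctahedralGroup N} {i j : Fin N} (h : g.right.SameCycle i j) :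
    label g j = label g i := by
  obtain ⟨n, rfl⟩ := h
  exact label_smul_zpowers g ⟨g.right ^ n, n, rfl⟩ i

lemma exists_label_of_typ_ne_zero {g : HyperoctahedralGroup N} {k : ℕ × ℤˣ} (h : typ g k ≠ 0) :
    ∃ i, label g i = (k.1 + 1, k.2) := by
  by_contra! hne
  have : IsEmpty {i // label g i = (k.1 + 1, k.2)} := ⟨fun i => hne i.1 i.2⟩
  have h1 := cnt_succ g k
  rw [cnt, Nat.card_of_isEmpty] at h1
  exact h (by simpa using h1.symm)

lemma wreathSign_eq_one_of_label {g : HyperoctahedralGroup N} (h : ∀ i, (label g i).2 = 1) :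
    wreathSign N g = 1 := by
  rw [wreathSign_eq_sign]
  refine Finset.prod_eq_one fun k hk => ?_
  obtain ⟨i, hi⟩ := exists_label_of_typ_ne_zero (Finsupp.mem_support_iff.1 hk)
  have := h i
  rw [hi] at this
  simp only at this ⊢
  rw [this, one_pow]

/-- `c` is a single positive `t`-cycle through `a`. -/
def IsPosCycle (c : HyperoctahedralGroup N) (a : Fin N) (t : ℕ) : Prop :=
  label c a = (t, 1) ∧ ∀ j, ¬ c.right.SameCycle a j → signedPerm N c (j, 1) = (j, 1)

namespace IsPosCycle

variable {c : HyperoctahedralGroup N} {a : Fin N} {t : ℕ}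

lemma label_eq_or (h : IsPosCycle c a t) (j : Fin N) :
    (c.right.SameCycle a j ∧ label c j = (t, 1)) ∨ (¬ c.right.SameCycle a j ∧ label c j = (1, 1)) := by
  by_cases hj : c.right.SameCycle a j
  · exact Or.inl ⟨hj, (label_of_sameCycle hj).trans h.1⟩
  · exact Or.inr ⟨hj, label_eq_one_of_fixed (h.2 j hj)⟩

lemma wreathSign_eq_one (h : IsPosCycle c a t) : wreathSign N c = 1 :=
  wreathSign_eq_one_of_label fun j => by
    rcases h.label_eq_or j with h | h <;> rw [h.2]

lemma card_sameCycle (h : IsPosCycle c a t) : Nat.card {j // c.right.SameCycle a j} = t := by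
  have := card_orbit_zpowers c a
  rw [h.1] at this
  refine Eq.trans ?_ this
  refine Nat.card_congr (Equiv.subtypeEquivRight fun j => ⟨?_, ?_⟩)
  · rintro ⟨n, rfl⟩
    exact ⟨⟨c.right ^ n, n, rfl⟩, rfl⟩
  · rintro ⟨⟨_, n, rfl⟩, rfl⟩
    exact ⟨n, rfl⟩

lemma card_not_sameCycle (h : IsPosCycle c a t) :
    Nat.card {j // ¬ c.right.SameCycle a j} = N - t := by
  classical
  rw [Nat.card_eq_fintype_card, Fintype.card_subtype_compl, ← Nat.card_eq_fintype_card (α := {j // _}),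
    h.card_sameCycle, Fintype.card_fin]

lemma isConj (h : IsPosCycle c a t) {c' : HyperoctahedralGroup N} {a' : Fin N}
    (h' : IsPosCycle c' a' t) (ht : 2 ≤ t) : IsConj c c' := by
  have key : ∀ {c : HyperoctahedralGroup N} {a : Fin N}, IsPosCycle c a t →
      ∀ l, cnt c l = if l = (t, 1) then t else if l = (1, 1) then N - t else 0 := by
    intro c a h l
    have hne : ((t, 1) : ℕ × ℤˣ) ≠ (1, 1) := fun h => by
      have := congrArg Prod.fst h
      simp at this
      lia
    split_ifs with h1 h2
    · subst h1
      refine Eq.trans (Nat.card_congr (Equiv.subtypeEquivRight fun j => ?_)) h.card_sameCycle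
      rcases h.label_eq_or j with h | h
      · simp [h.1, h.2]
      · simp [h.1, h.2, hne.symm]
    · subst h2
      refine Eq.trans (Nat.card_congr (Equiv.subtypeEquivRight fun j => ?_)) h.card_not_sameCycle
      rcases h.label_eq_or j with h | h
      · simp [h.1, h.2, hne]
      · simp [h.1, h.2]
    · have : IsEmpty {j // label c j = l} := ⟨fun j => by
        have hj := j.2
        rcases h.label_eq_or j with h | h
        · exact h1 (hj.symm.trans h.2)
        · exact h2 (hj.symm.trans h.2)⟩
      exact Nat.card_of_isEmpty
  exact isConj_iff_cnt.2 fun l => (key h l).trans (key h' l).symm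

lemma exists_fixed (h : IsPosCycle c a t) (htN : t < N) : ∃ j, label c j = (1, 1) := by
  have h1 := h.card_not_sameCycle
  have : Nonempty {j // ¬ c.right.SameCycle a j} := by
    rw [← not_isEmpty_iff]
    intro hE
    rw [Nat.card_of_isEmpty] at h1
    lia
  obtain ⟨j, hj⟩ := this
  exact ⟨j, label_eq_one_of_fixed (h.2 j hj)⟩

end IsPosCycle

lemma exists_isPosCycle {g : HyperoctahedralGroup N} {a : Fin N} {t : ℕ} (h : label g a = (t, 1)) :
    ∃ c, IsPosCycle c a t ∧ ∀ j, c.right.SameCycle a j → signedPerm N (c⁻¹ * g) (j, 1) = (j, 1) := by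
  classical
  let c : HyperoctahedralGroup N :=
    ⟨fun j => if g.right.SameCycle a j then g.left j else 1, g.right.cycleOf a⟩
  have hc : ∀ j, g.right.SameCycle a j → ∀ e, signedPerm N c (j, e) = signedPerm N g (j, e) := by
    intro j hj e
    have h1 : c.right j = g.right j := Equiv.Perm.SameCycle.cycleOf_apply hj
    rw [signedPerm_apply, signedPerm_apply, h1]
    have h2 : g.right.SameCycle a (g.right j) := by simpa using hj
    simp [c, h2]
  have hpow : ∀ n : ℕ, signedPerm N (c ^ n) (a, 1) = signedPerm N (g ^ n) (a, 1) := by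
    intro n
    induction n with
    | zero => simp
    | succ n ih =>
      rw [pow_succ', pow_succ', map_mul, map_mul, Equiv.Perm.mul_apply, Equiv.Perm.mul_apply, ih,
        signedPerm_apply (g ^ n)]
      refine hc _ ⟨n, ?_⟩ _
      rw [right_pow, zpow_natCast]
  have hsc : ∀ j, c.right.SameCycle a j ↔ g.right.SameCycle a j := by
    intro j
    have : ∀ n : ℤ, (c.right ^ n) a = (g.right ^ n) a := Equiv.Perm.cycleOf_zpow_apply_self _ _
    simp only [Equiv.Perm.SameCycle, this]
  refine ⟨c, ⟨(label_eq_of_agree hpow).trans h, fun j hj => ?_⟩, fun j hj => ?_⟩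
  · rw [hsc] at hj
    have h1 : c.right j = j := Equiv.Perm.cycleOf_apply_of_not_sameCycle hj
    rw [signedPerm_apply, h1]
    simp [c, hj]
  · rw [hsc] at hj
    rw [map_mul, Equiv.Perm.mul_apply, ← hc j hj, map_inv]
    exact Equiv.symm_apply_apply _ _

/-- The elements of `D_N` fixing pointwise the cycle of `c` through `a`. -/
def cycleFixer (c : HyperoctahedralGroup N) (a : Fin N) : Subgroup (WeylD N) where
  carrier := {h | ∀ j, c.right.SameCycle a j →
    signedPerm N (h : HyperoctahedralGroup N) (j, 1) = (j, 1)}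
  one_mem' j _ := by simp
  mul_mem' {x y} hx hy j hj := by
    change signedPerm N ((x : HyperoctahedralGroup N) * y) (j, 1) = (j, 1)
    rw [map_mul, Equiv.Perm.mul_apply, hy j hj, hx j hj]
  inv_mem' {x} hx j hj := by
    change signedPerm N ((x : HyperoctahedralGroup N)⁻¹) (j, 1) = (j, 1)
    rw [map_inv]
    exact (Equiv.symm_apply_eq _).2 (hx j hj).symm

lemma mem_cycleFixer {c : HyperoctahedralGroup N} {a : Fin N} {h : WeylD N} :
    h ∈ cycleFixer c a ↔ ∀ j, c.right.SameCycle a j →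
      signedPerm N (h : HyperoctahedralGroup N) (j, 1) = (j, 1) := Iff.rfl

namespace IsPosCycle

variable {c : WeylD N} {a : Fin N} {t : ℕ}

lemma moves_iff (hc : IsPosCycle (c : HyperoctahedralGroup N) a t) (ht : 2 ≤ t) (y : Fin N × ℤˣ) :
    signedPerm N (c : HyperoctahedralGroup N) y ≠ y ↔
      (c : HyperoctahedralGroup N).right.SameCycle a y.1 := by
  constructor
  · contrapose!
    exact fun h => signedPerm_fixed (hc.2 _ h) y.2
  · intro h h'
    have h1 : (c : HyperoctahedralGroup N).right y.1 = y.1 := congrArg Prod.fst h'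
    have h2 := (right_pow_eq_iff (c : HyperoctahedralGroup N) y.1 1).1 (by simpa using h1)
    rw [label_of_sameCycle h, hc.1] at h2
    have := Nat.le_of_dvd one_pos h2
    simp only at this
    lia

lemma commute (hc : IsPosCycle (c : HyperoctahedralGroup N) a t) {h : WeylD N}
    (hh : h ∈ cycleFixer (c : HyperoctahedralGroup N) a) :
    Commute (c : HyperoctahedralGroup N) h := by
  have hd : Equiv.Perm.Disjoint (signedPerm N (c : HyperoctahedralGroup N))
      (signedPerm N (h : HyperoctahedralGroup N)) := by
    intro y
    by_cases hy : (c : HyperoctahedralGroup N).right.SameCycle a y.1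
    · exact Or.inr (signedPerm_fixed (hh _ hy) y.2)
    · exact Or.inl (signedPerm_fixed (hc.2 _ hy) y.2)
  refine signedPerm_injective ?_
  rw [map_mul, map_mul]
  exact hd.commute

lemma isConj_pow (hc : IsPosCycle (c : HyperoctahedralGroup N) a t) (htN : t < N) (j : ℕ)
    (hj : (Nat.card (WeylD N)).Coprime j) : IsConj c (c ^ j) := by
  obtain ⟨i, hi⟩ := hc.exists_fixed htN
  exact weylD_isConj_pow i (by rw [hi]; exact odd_one) j hj

lemma exists_conj_eq_pow (hc : IsPosCycle (c : HyperoctahedralGroup N) a t) (ht : 2 ≤ t)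
    (htN : t < N) (j : ℕ) (hj : (Nat.card (WeylD N)).Coprime j) :
    ∃ y, y * c * y⁻¹ = c ^ j ∧ ∀ h ∈ cycleFixer (c : HyperoctahedralGroup N) a,
      y⁻¹ * h * y ∈ cycleFixer (c : HyperoctahedralGroup N) a := by
  obtain ⟨y, hy⟩ := isConj_iff.1 (hc.isConj_pow htN j hj)
  refine ⟨y, hy, fun h hh i hi => ?_⟩
  set Y := signedPerm N (y : HyperoctahedralGroup N) with hY
  have h1 : signedPerm N (c : HyperoctahedralGroup N) (Y (i, 1)) ≠ Y (i, 1) := by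
    intro h0
    have h2 : signedPerm N ((c ^ j : WeylD N) : HyperoctahedralGroup N) (Y (i, 1)) = Y (i, 1) := by
      rw [Subgroup.coe_pow, map_pow]
      exact Equiv.Perm.pow_apply_eq_self_of_apply_eq_self h0 j
    rw [← hy] at h2
    simp only [Subgroup.coe_mul, Subgroup.coe_inv, map_mul, map_inv, Equiv.Perm.mul_apply] at h2
    rw [← hY] at h2
    have h3 : Y⁻¹ (Y (i, 1)) = (i, 1) := Equiv.symm_apply_apply _ _
    rw [h3] at h2
    exact (hc.moves_iff ht (i, 1)).2 hi (Y.injective h2)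
  rw [hc.moves_iff ht] at h1
  simp only [Subgroup.coe_mul, Subgroup.coe_inv, map_mul, map_inv, Equiv.Perm.mul_apply]
  rw [← hY, signedPerm_fixed (hh _ h1) (Y (i, 1)).2]
  exact Equiv.symm_apply_apply _ _

lemma mul_pow_apply (hc : IsPosCycle (c : HyperoctahedralGroup N) a t) {h : WeylD N}
    (hh : h ∈ cycleFixer (c : HyperoctahedralGroup N) a) (n : ℤ) :
    signedPerm N (((c * h : WeylD N) : HyperoctahedralGroup N) ^ n) (a, 1) =
      signedPerm N ((c : HyperoctahedralGroup N) ^ n) (a, 1) := by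
  rw [Subgroup.coe_mul, (hc.commute hh).mul_zpow, map_mul, Equiv.Perm.mul_apply]
  congr 1
  have := mem_cycleFixer.1 (Subgroup.zpow_mem _ hh n) a (Equiv.Perm.SameCycle.refl _ _)
  rwa [Subgroup.coe_zpow] at this

lemma label_mul (hc : IsPosCycle (c : HyperoctahedralGroup N) a t) {h : WeylD N}
    (hh : h ∈ cycleFixer (c : HyperoctahedralGroup N) a) :
    label ((c * h : WeylD N) : HyperoctahedralGroup N) a = (t, 1) := by
  rw [← hc.1]
  refine label_eq_of_agree fun n => ?_
  have := hc.mul_pow_apply hh n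
  rwa [zpow_natCast, zpow_natCast] at this

lemma card_conj_mem_le (hc : IsPosCycle (c : HyperoctahedralGroup N) a t) (g : WeylD N) :
    Nat.card {x : WeylD N // ∃ h ∈ cycleFixer (c : HyperoctahedralGroup N) a, x * g * x⁻¹ = c * h} ≤
      Nat.card (cycleFixer (c : HyperoctahedralGroup N) a) *
        (cnt (g : HyperoctahedralGroup N) (t, 1) * 2) := by
  classical
  have := Fintype.ofFinite (WeylD N)
  set H := cycleFixer (c : HyperoctahedralGroup N) a
  have hcard : (Finset.univ.filter fun y : Fin N × ℤˣ =>
      label (g : HyperoctahedralGroup N) y.1 = (t, 1)).card =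
      cnt (g : HyperoctahedralGroup N) (t, 1) * 2 := by
    have h1 : Finset.univ.filter (fun y : Fin N × ℤˣ =>
        label (g : HyperoctahedralGroup N) y.1 = (t, 1)) =
        (Finset.univ.filter fun i => label (g : HyperoctahedralGroup N) i = (t, 1)) ×ˢ Finset.univ := by
      ext y
      rw [Finset.mem_product, Finset.mem_filter, Finset.mem_filter]
      simp only [Finset.mem_univ, true_and, and_true]
    rw [h1, Finset.card_product, Finset.card_univ, Fintype.card_units_int, cnt,
      Nat.card_eq_fintype_card, Fintype.card_subtype]
  rw [← hcard, Nat.card_eq_fintype_card, Fintype.card_subtype]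
  refine Finset.card_le_mul_card_image_of_maps_to
    (f := fun x : WeylD N => (signedPerm N (x : HyperoctahedralGroup N))⁻¹ (a, 1)) ?_ _ ?_
  · intro x hx
    obtain ⟨h, hh, hx⟩ := (Finset.mem_filter.1 hx).2
    refine Finset.mem_filter.2 ⟨Finset.mem_univ _, ?_⟩
    have h1 := label_conj (x⁻¹ : WeylD N) ((c * h : WeylD N) : HyperoctahedralGroup N) a
    have h2 : x⁻¹ * (c * h) * x⁻¹⁻¹ = g := by
      rw [← hx]
      group
    have h3 := congrArg (Subtype.val : WeylD N → HyperoctahedralGroup N) h2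
    rw [hc.label_mul hh] at h1
    rw [← map_inv, ← h3]
    exact h1
  · intro y _
    rcases Finset.eq_empty_or_nonempty ((Finset.univ.filter fun x : WeylD N =>
      ∃ h ∈ H, x * g * x⁻¹ = c * h).filter fun x : WeylD N =>
        (signedPerm N (x : HyperoctahedralGroup N))⁻¹ (a, 1) = y) with he | ⟨x0, hx0⟩
    · rw [he, Finset.card_empty]
      exact Nat.zero_le _
    · have hH : Nat.card H = (Finset.univ.filter fun h : WeylD N => h ∈ H).card := by
        rw [← Fintype.card_subtype, ← Nat.card_eq_fintype_card]
      rw [hH]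
      refine Finset.card_le_card_of_injOn (fun x => x * x0⁻¹) ?_ fun x _ x' _ h => mul_right_cancel h
      intro x hx
      rw [Finset.mem_coe, Finset.mem_filter, Finset.mem_filter] at hx
      rw [Finset.mem_filter, Finset.mem_filter] at hx0
      obtain ⟨⟨-, h0, hh0, hx0'⟩, hy0⟩ := hx0
      obtain ⟨⟨-, h, hh, hx'⟩, hy⟩ := hx
      refine Finset.mem_coe.2 (Finset.mem_filter.2 ⟨Finset.mem_univ _, ?_⟩)
      rintro j ⟨n, rfl⟩
      set u : WeylD N := x * x0⁻¹ with hu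
      have hua : signedPerm N (u : HyperoctahedralGroup N) (a, 1) = (a, 1) := by
        rw [hu, Subgroup.coe_mul, Subgroup.coe_inv, map_mul, map_inv, Equiv.Perm.mul_apply, hy0,
          ← hy]
        exact Equiv.apply_symm_apply _ _
      have hconj : u * (c * h0) = (c * h) * u := by
        rw [← hx0', ← hx', hu]
        group
      have hconjn : (u : HyperoctahedralGroup N) * ((c * h0 : WeylD N) : HyperoctahedralGroup N) ^ n =
          ((c * h : WeylD N) : HyperoctahedralGroup N) ^ n * u := by
        have : SemiconjBy u (c * h0) (c * h) := hconj
        have h2 := (this.zpow_right n).eq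
        have h3 := congrArg (Subtype.val : WeylD N → HyperoctahedralGroup N) h2
        exact h3
      have h4 := congrArg (fun z => signedPerm N z (a, 1)) hconjn
      rw [map_mul, map_mul, Equiv.Perm.mul_apply, Equiv.Perm.mul_apply, hua, hc.mul_pow_apply hh0,
        hc.mul_pow_apply hh, signedPerm_apply ((c : HyperoctahedralGroup N) ^ n)] at h4
      rw [← right_zpow]
      simp only at h4
      rw [signedPerm_apply, Prod.ext_iff] at h4 ⊢
      simp only at h4 ⊢
      refine ⟨h4.1, ?_⟩
      have := h4.2
      rw [mul_eq_right] at this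
      rw [this, one_mul]

lemma card_nonvanishing_le (hc : IsPosCycle (c : HyperoctahedralGroup N) a t) (ht : 2 ≤ t)
    (htN : t < N) (T : Finset SignedType) (hT : ∀ μ, μ.size = N → μ ∈ T) :
    Nat.card {χ : IrrChar (WeylD N) //
      ∃ h ∈ cycleFixer (c : HyperoctahedralGroup N) a, χ.1 (c * h) ≠ 0} ≤
      4 * t * ∑ μ ∈ T, μ (t - 1, 1) := by
  classical
  have := Fintype.ofFinite (WeylD N)
  set H := cycleFixer (c : HyperoctahedralGroup N) a
  have h1 := IrrChar.card_nonvanishing_mul_le c H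
    (fun h hh => Subtype.ext (hc.commute hh).eq) (hc.exists_conj_eq_pow ht htN)
  have h2 := card_mul_sum_centralizer_le c H _ hc.card_conj_mem_le
  have h3 := sum_weylD_le T hT fun μ => Nat.card H * (μ (t - 1, 1) * t * 2)
  have h4 : ∀ g : HyperoctahedralGroup N, cnt g (t, 1) = typ g (t - 1, 1) * t := by
    intro g
    have := cnt_succ g (t - 1, 1)
    simpa [Nat.sub_add_cancel (by lia : 1 ≤ t)] using this
  simp only [h4] at h2
  have h5 := (Nat.mul_le_mul_left (Nat.card (WeylD N)) h1).trans (h2.trans h3)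
  have h6 : ∑ μ ∈ T, Nat.card H * (μ (t - 1, 1) * t * 2) =
      Nat.card H * (2 * t) * ∑ μ ∈ T, μ (t - 1, 1) := by
    rw [Finset.mul_sum]
    exact Finset.sum_congr rfl fun μ _ => by ring
  rw [h6] at h5
  have hpos : 0 < Nat.card (WeylD N) * Nat.card H := Nat.mul_pos Nat.card_pos Nat.card_pos
  refine le_of_mul_le_mul_left (a := Nat.card (WeylD N) * Nat.card H) ?_ hpos
  calc _ = Nat.card (WeylD N) * (Nat.card {χ : IrrChar (WeylD N) // ∃ h ∈ H, χ.1 (c * h) ≠ 0} *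
        Nat.card H) := by ring
    _ ≤ _ := h5
    _ = _ := by ring

lemma exists_isConj_mul (hc : IsPosCycle (c : HyperoctahedralGroup N) a t) (ht : 2 ≤ t)
    (htN : t < N) {g : WeylD N} {i : Fin N} (hg : label (g : HyperoctahedralGroup N) i = (t, 1)) :
    ∃ h ∈ cycleFixer (c : HyperoctahedralGroup N) a, IsConj g (c * h) := by
  obtain ⟨z, hz, hzg⟩ := exists_isPosCycle hg
  have hzD : z ∈ WeylD N := hz.wreathSign_eq_one
  have hconj : IsConj (⟨z, hzD⟩ : WeylD N) c := by
    obtain ⟨j, hj⟩ := hz.exists_fixed htN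
    exact isConj_weylD (hz.isConj hc ht) j (by rw [hj]; exact odd_one)
  obtain ⟨b, hb⟩ := isConj_iff.1 hconj
  set z' : WeylD N := ⟨z, hzD⟩ with hz'
  refine ⟨b * (z'⁻¹ * g) * b⁻¹, ?_, isConj_iff.2 ⟨b, ?_⟩⟩
  · intro j hj
    have h1 := (hc.moves_iff ht (j, 1)).2 hj
    have he : ((b * (z'⁻¹ * g) * b⁻¹ : WeylD N) : HyperoctahedralGroup N) =
        b * ((z'⁻¹ * g : WeylD N) : HyperoctahedralGroup N) * (b : HyperoctahedralGroup N)⁻¹ := rfl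
    rw [he, map_mul, map_mul, map_inv, Equiv.Perm.mul_apply, Equiv.Perm.mul_apply]
    set Y := signedPerm N (b : HyperoctahedralGroup N) with hY
    have h2 : signedPerm N z (Y⁻¹ (j, 1)) ≠ Y⁻¹ (j, 1) := by
      intro h0
      apply h1
      rw [← hb, Subgroup.coe_mul, Subgroup.coe_mul, Subgroup.coe_inv, map_mul, map_mul, map_inv,
        Equiv.Perm.mul_apply, Equiv.Perm.mul_apply, ← hY, hz']
      simp only
      rw [h0]
      exact Equiv.apply_symm_apply _ _
    have h3 := ((moves_iff (c := z') hz ht _).1 h2)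
    have h4 := signedPerm_fixed (hzg _ h3) (Y⁻¹ (j, 1)).2
    have h5 : signedPerm N ((z'⁻¹ * g : WeylD N) : HyperoctahedralGroup N) (Y⁻¹ (j, 1)) = Y⁻¹ (j, 1) := h4
    rw [h5]
    exact Equiv.apply_symm_apply _ _
  · rw [← hb]
    group

end IsPosCycle

end HyperoctahedralGroup

/-- A part `m`, coprime to `2 * p`, occurs in `μ`, and some of the parts of `μ` of the form
`m * p ^ i`, `i ≤ a`, add up to `t = m * p ^ a`. -/
def SignedType.Mergeable (p t : ℕ) (μ : SignedType) : Prop :=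
  ∃ m a : ℕ, Odd m ∧ m.Coprime p ∧ t = p ^ a * m ∧ μ (m - 1, 1) ≠ 0 ∧
    ∃ ν ≤ μ, ν.size = t ∧ ∀ k ∈ ν.support, k.2 = 1 ∧ ∃ i ≤ a, k.1 + 1 = p ^ i * m

namespace HyperoctahedralGroup

variable {N : ℕ}

lemma cnt_pow (g : HyperoctahedralGroup N) (P : ℕ) (hP : 0 < P) (l : ℕ × ℤˣ) :
    cnt (g ^ P) l = (typ g).sum fun k m => (m * (k.1 + 1)) •
      if ((k.1 + 1) / (k.1 + 1).gcd P, k.2 ^ (P / (k.1 + 1).gcd P)) = l then 1 else 0 := by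
  classical
  rw [← sum_label g fun l' => if (l'.1 / l'.1.gcd P, l'.2 ^ (P / l'.1.gcd P)) = l then 1 else 0,
    cnt, Nat.card_eq_fintype_card, Fintype.card_subtype, Finset.card_filter]
  refine Finset.sum_congr rfl fun i _ => ?_
  rw [label_pow g i P hP]

lemma weylD_dvd_of_mergeable (χ : IrrChar (WeylD N)) (p t : ℕ) (hp : p.Prime) (g : WeylD N)
    (hg : (typ (g : HyperoctahedralGroup N)).Mergeable p t)
    (hχ : ∀ (x : WeylD N) i, label (x : HyperoctahedralGroup N) i = (t, 1) → χ.1 x = 0) :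
    ∃ m : ℤ, χ.1 g = (p : ℂ) * m := by
  classical
  obtain ⟨m, a, hm, hmp, rfl, hμm, ν, hν, hsize, hsupp⟩ := hg
  have hm0 : 0 < m := hm.pos
  have ht0 : 0 < p ^ a * m := Nat.mul_pos (Nat.pow_pos hp.pos) hm0
  obtain ⟨ρ, hρ⟩ := exists_add_of_le hν
  set σ : SignedType := Finsupp.single (p ^ a * m - 1, 1) 1 with hσ
  have hσs : σ.size = p ^ a * m := by
    rw [SignedType.size_single]
    simp only [one_mul]
    lia
  have hνsign : ν.sign = 1 := Finset.prod_eq_one fun k hk => by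
    simp only
    rw [(hsupp k hk).1, one_pow]
  have hN := size_typ (g : HyperoctahedralGroup N)
  rw [hρ, SignedType.size_add, hsize] at hN
  obtain ⟨g', hg', hs'⟩ := exists_typ_eq (σ + ρ) (by rw [SignedType.size_add, hσs, hN])
  have hg'D : g' ∈ WeylD N := by
    have h1 : wreathSign N (g : HyperoctahedralGroup N) = 1 := g.2
    rw [wreathSign_eq_sign, hρ, SignedType.sign_add, hνsign, one_mul] at h1
    change wreathSign N g' = 1
    rw [hs', SignedType.sign_add, h1, hσ, SignedType.sign_single, one_pow, one_mul]
  have hP : 0 < p ^ a := Nat.pow_pos hp.pos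
  have hgcd : ∀ i ≤ a, (p ^ i * m).gcd (p ^ a) = p ^ i := by
    intro i hi
    obtain ⟨b, rfl⟩ := Nat.exists_eq_add_of_le hi
    rw [pow_add, Nat.gcd_mul_left, Nat.Coprime.pow_right b hmp, mul_one]
  have hcnt : ∀ l, cnt ((g : HyperoctahedralGroup N) ^ p ^ a) l = cnt (g' ^ p ^ a) l := by
    intro l
    rw [cnt_pow _ _ hP, cnt_pow _ _ hP, hg', hρ, Finsupp.sum_add_index', Finsupp.sum_add_index']
    · congr 1
      have h1 : ∀ k : ℕ × ℤˣ, (k.2 = 1 ∧ ∃ i ≤ a, k.1 + 1 = p ^ i * m) →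
          ((k.1 + 1) / (k.1 + 1).gcd (p ^ a), k.2 ^ (p ^ a / (k.1 + 1).gcd (p ^ a))) = (m, 1) := by
        rintro k ⟨h1, i, hi, h2⟩
        rw [h1, h2, hgcd i hi, one_pow, Nat.mul_div_cancel_left _ (Nat.pow_pos hp.pos)]
      have h2 : ∀ τ : SignedType, (∀ k ∈ τ.support, k.2 = 1 ∧ ∃ i ≤ a, k.1 + 1 = p ^ i * m) →
          (τ.sum fun k n => (n * (k.1 + 1)) •
            if ((k.1 + 1) / (k.1 + 1).gcd (p ^ a), k.2 ^ (p ^ a / (k.1 + 1).gcd (p ^ a))) = l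
            then 1 else 0) = τ.size * if ((m, 1) : ℕ × ℤˣ) = l then 1 else 0 := by
        intro τ hτ
        rw [SignedType.size, Finsupp.sum, Finsupp.sum, Finset.sum_mul]
        refine Finset.sum_congr rfl fun k hk => ?_
        rw [h1 k (hτ k hk), smul_eq_mul]
      rw [h2 ν hsupp, h2 σ, hsize, hσs]
      intro k hk
      have := Finsupp.support_single_subset hk
      rw [Finset.mem_singleton] at this
      subst this
      refine ⟨rfl, a, le_rfl, ?_⟩
      simp only
      lia
    · intro k
      rw [zero_mul, zero_smul]
    · intro k b c
      rw [add_mul, add_smul]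
    · intro k
      rw [zero_mul, zero_smul]
    · intro k b c
      rw [add_mul, add_smul]
  obtain ⟨i, hi⟩ := exists_label_of_typ_ne_zero hμm
  have hi' : label (g : HyperoctahedralGroup N) i = (m, 1) := by
    rw [hi, Nat.sub_add_cancel (by lia : 1 ≤ m)]
  obtain ⟨i', hi''⟩ := exists_label_of_typ_ne_zero (g := g') (k := (p ^ a * m - 1, 1)) (by
    rw [hg', Finsupp.add_apply, hσ, Finsupp.single_eq_same]
    lia)
  have hodd : Odd (label (g : HyperoctahedralGroup N) i).1 := by rw [hi']; exact hm
  refine χ.dvd_of_pow_isConj p hp a g ⟨g', hg'D⟩ (fun j hj => (weylD_isConj_pow i hodd j hj).symm) ?_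
    (hχ _ i' ?_)
  · refine isConj_weylD (isConj_iff_cnt.2 hcnt) i ?_
    rw [Subgroup.coe_pow, label_pow _ _ _ hP, hi', Nat.Coprime.pow_right a hmp, Nat.div_one]
    exact hm
  · simp only
    rw [hi'', Nat.sub_add_cancel ht0]

lemma exists_weylD_isPosCycle {t : ℕ} (ht : 2 ≤ t) (htN : t < N) :
    ∃ (c : WeylD N) (a : Fin N), IsPosCycle (c : HyperoctahedralGroup N) a t := by
  obtain ⟨g, hg, -⟩ := exists_typ_eq (N := N)
    (Finsupp.single (t - 1, 1) 1 + Finsupp.single (0, 1) (N - t)) (by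
      rw [SignedType.size_add, SignedType.size_single, SignedType.size_single]
      simp only
      lia)
  obtain ⟨a, ha⟩ := exists_label_of_typ_ne_zero (g := g) (k := (t - 1, 1)) (by
    rw [hg, Finsupp.add_apply, Finsupp.single_eq_same]
    lia)
  rw [Nat.sub_add_cancel (by lia : 1 ≤ t)] at ha
  obtain ⟨c, hc, -⟩ := exists_isPosCycle ha
  exact ⟨⟨c, hc.wreathSign_eq_one⟩, a, hc⟩

lemma card_not_entryDivisible_of_mergeable {p : ℕ} (hp : p.Prime) {t : ℕ} (ht : 2 ≤ t) (htN : t < N)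
    (T : Finset SignedType) (hT : ∀ μ, μ.size = N → μ ∈ T) (κ : ConjClasses (WeylD N))
    (hκ : (weylTyp κ).Mergeable p t) :
    Nat.card {χ : IrrChar (WeylD N) // ¬ EntryDivisible p χ κ} ≤ 4 * t * ∑ μ ∈ T, μ (t - 1, 1) := by
  obtain ⟨c, a, hc⟩ := exists_weylD_isPosCycle ht htN
  refine le_trans ?_ (hc.card_nonvanishing_le ht htN T hT)
  have := IrrChar.finite (G := WeylD N)
  refine Nat.card_le_card_of_injective (fun χ => ⟨χ.1, ?_⟩) fun χ χ' h =>
    Subtype.ext (Subtype.mk.inj h)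
  by_contra! hχ
  apply χ.2
  obtain ⟨g, rfl⟩ := ConjClasses.exists_rep κ
  refine ⟨g, ConjClasses.mem_carrier_mk, weylD_dvd_of_mergeable χ.1 p t hp g hκ fun x i hx => ?_⟩
  obtain ⟨h, hh, hxh⟩ := hc.exists_isConj_mul ht htN hx
  rw [χ.1.eq_of_isConj hxh]
  exact hχ h hh

lemma card_not_entryDivisible_le {p : ℕ} (hp : p.Prime) (R : Finset ℕ)
    (hR : ∀ t ∈ R, 2 ≤ t ∧ t < N) (T : Finset SignedType) (hT : ∀ μ, μ.size = N → μ ∈ T) (M : ℕ)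
    (hM : ∀ t ∈ R, 4 * t * ∑ μ ∈ T, μ (t - 1, 1) ≤ M)
    [DecidablePred fun μ : SignedType => ∀ t ∈ R, ¬ μ.Mergeable p t] :
    Nat.card {e : IrrChar (WeylD N) × ConjClasses (WeylD N) // ¬ EntryDivisible p e.1 e.2} ≤
      Nat.card (ConjClasses (WeylD N)) * M +
        2 * (T.filter fun μ => ∀ t ∈ R, ¬ μ.Mergeable p t).card * Nat.card (IrrChar (WeylD N)) := by
  classical
  have := Fintype.ofFinite (ConjClasses (WeylD N))
  have := IrrChar.finite (G := WeylD N)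
  let B : ConjClasses (WeylD N) → Prop := fun κ => ∀ t ∈ R, ¬ (weylTyp κ).Mergeable p t
  have e : {e : IrrChar (WeylD N) × ConjClasses (WeylD N) // ¬ EntryDivisible p e.1 e.2} ≃
      Σ κ : ConjClasses (WeylD N), {χ : IrrChar (WeylD N) // ¬ EntryDivisible p χ κ} :=
    { toFun := fun e => ⟨e.1.2, e.1.1, e.2⟩
      invFun := fun e => ⟨(e.2.1, e.1), e.2.2⟩
      left_inv := fun _ => rfl
      right_inv := fun _ => rfl }
  rw [Nat.card_congr e, Nat.card_sigma]
  have h1 : ∀ κ : ConjClasses (WeylD N),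
      Nat.card {χ : IrrChar (WeylD N) // ¬ EntryDivisible p χ κ} ≤
        M + if B κ then Nat.card (IrrChar (WeylD N)) else 0 := by
    intro κ
    split_ifs with hB
    · exact (Finite.card_subtype_le _).trans (Nat.le_add_left _ _)
    · simp only [B] at hB
      push Not at hB
      obtain ⟨t, ht, hm⟩ := hB
      exact (card_not_entryDivisible_of_mergeable hp (hR t ht).1 (hR t ht).2 T hT κ hm).trans (hM t ht)
  refine (Finset.sum_le_sum fun κ _ => h1 κ).trans ?_
  rw [Finset.sum_add_distrib, Finset.sum_const, smul_eq_mul, Finset.card_univ,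
    ← Nat.card_eq_fintype_card, ← Finset.sum_filter, Finset.sum_const, smul_eq_mul,
    ← Fintype.card_subtype, ← Nat.card_eq_fintype_card]
  refine Nat.add_le_add_left (Nat.mul_le_mul_right _ ?_) _
  exact card_weylTyp_le T hT fun μ => ∀ t ∈ R, ¬ μ.Mergeable p t

end HyperoctahedralGroup

namespace SignedType

lemma mul_le_size (μ : SignedType) (k : ℕ × ℤˣ) : μ k * (k.1 + 1) ≤ μ.size := by
  by_cases h : k ∈ μ.support
  · exact Finset.single_le_sum (f := fun k : ℕ × ℤˣ => μ k * (k.1 + 1)) (fun _ _ => Nat.zero_le _) h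
  · simp [Finsupp.notMem_support_iff.mp h]

lemma apply_le_size (μ : SignedType) (k : ℕ × ℤˣ) : μ k ≤ μ.size :=
  (Nat.le_mul_of_pos_right _ k.1.succ_pos).trans (μ.mul_le_size k)

lemma lt_size_of_mem_support {μ : SignedType} {k : ℕ × ℤˣ} (h : k ∈ μ.support) : k.1 < μ.size := by
  have h1 := μ.mul_le_size k
  have h2 : 0 < μ k := Nat.pos_of_ne_zero (Finsupp.mem_support_iff.mp h)
  nlinarith

/-- The multiplicities of the parts of size at most `N`. -/
def multiplicities (N : ℕ) (μ : SignedType) (i : Fin N × ℤˣ) : Fin (N + 1) :=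
  Fin.ofNat (N + 1) (μ (i.1, i.2))

lemma multiplicities_val {N : ℕ} {μ : SignedType} (h : μ.size = N) (i : Fin N × ℤˣ) :
    (multiplicities N μ i : ℕ) = μ (i.1, i.2) := by
  have := μ.apply_le_size (i.1, i.2)
  simp only [multiplicities, Fin.val_ofNat]
  exact Nat.mod_eq_of_lt (by omega)

lemma injOn_multiplicities (N : ℕ) : Set.InjOn (multiplicities N) {μ | μ.size = N} := by
  intro μ hμ ν hν h
  have hμ : μ.size = N := hμ
  have hν : ν.size = N := hν
  ext ⟨k, s⟩
  by_cases hk : k < N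
  · have := congrArg Fin.val (congrFun h (⟨k, hk⟩, s))
    rwa [multiplicities_val hμ, multiplicities_val hν] at this
  · have h1 : (k, s) ∉ μ.support := fun h => hk (hμ ▸ lt_size_of_mem_support h)
    have h2 : (k, s) ∉ ν.support := fun h => hk (hν ▸ lt_size_of_mem_support h)
    rw [Finsupp.notMem_support_iff.mp h1, Finsupp.notMem_support_iff.mp h2]

lemma finite_size_eq (N : ℕ) : {μ : SignedType | μ.size = N}.Finite :=
  Set.Finite.of_finite_image (Set.toFinite _) (injOn_multiplicities N)

/-- The bipartitions of `N`. -/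
noncomputable def ofSize (N : ℕ) : Finset SignedType := (finite_size_eq N).toFinset

@[simp] lemma mem_ofSize {N : ℕ} {μ : SignedType} : μ ∈ ofSize N ↔ μ.size = N := by
  simp [ofSize]

/-- The number of bipartitions of `N`. -/
noncomputable def count (N : ℕ) : ℕ := (ofSize N).card

lemma size_eq_sum {N : ℕ} {μ : SignedType} (h : μ.size ≤ N) :
    μ.size = ∑ i : Fin N × ℤˣ, μ (i.1, i.2) * (i.1 + 1) := by
  have h1 : μ.size = ∑ k ∈ Finset.range N ×ˢ (Finset.univ : Finset ℤˣ), μ k * (k.1 + 1) :=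
    Finsupp.sum_of_support_subset _ (fun k hk => by
      have := lt_size_of_mem_support hk
      simp only [Finset.mem_product, Finset.mem_range, Finset.mem_univ, and_true]
      omega) _ (by simp)
  rw [h1, Finset.sum_product, Finset.sum_range, ← Finset.univ_product_univ, Finset.sum_product]

lemma count_zero : count 0 = 1 := by
  rw [count, Finset.card_eq_one]
  refine ⟨0, ?_⟩
  ext μ
  rw [mem_ofSize, Finset.mem_singleton]
  constructor
  · intro h
    ext k
    have := μ.apply_le_size k
    simp only [Finsupp.coe_zero, Pi.zero_apply]
    omega
  · rintro rfl
    simp [size]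

/-- Removing `j` parts of a given kind. -/
lemma card_filter_le_apply (N j : ℕ) (k : ℕ × ℤˣ) (h : j * (k.1 + 1) ≤ N) :
    ((ofSize N).filter fun μ => j ≤ μ k).card = count (N - j * (k.1 + 1)) := by
  symm
  refine Finset.card_bij (fun μ _ => μ + Finsupp.single k j) ?_ ?_ ?_
  · intro μ hμ
    rw [mem_ofSize] at hμ
    simp only [Finset.mem_filter, mem_ofSize, size_add, size_single, Finsupp.add_apply,
      Finsupp.single_eq_same]
    omega
  · intro μ _ ν _ h
    exact add_right_cancel h
  · intro μ hμ
    rw [Finset.mem_filter, mem_ofSize] at hμ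
    have hle : Finsupp.single k j ≤ μ := by
      rw [Finsupp.single_le_iff]; exact hμ.2
    have heq := tsub_add_cancel_of_le hle
    refine ⟨μ - Finsupp.single k j, ?_, heq⟩
    have := congrArg size heq
    rw [size_add, size_single] at this
    rw [mem_ofSize]
    omega

lemma count_mono : Monotone count := by
  refine monotone_nat_of_le_succ fun n => ?_
  have := card_filter_le_apply (n + 1) 1 (0, 1) (by simp)
  simp only [zero_add, mul_one, Nat.add_sub_cancel] at this
  rw [← this]
  exact Finset.card_filter_le _ _

lemma count_pos (n : ℕ) : 0 < count n := by
  have := count_mono (Nat.zero_le n)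
  rw [count_zero] at this
  omega

lemma sum_apply (N : ℕ) (k : ℕ × ℤˣ) :
    ∑ μ ∈ ofSize N, μ k =
      ∑ j ∈ (Finset.Icc 1 N).filter (fun j => j * (k.1 + 1) ≤ N), count (N - j * (k.1 + 1)) := by
  have h1 : ∀ μ ∈ ofSize N, μ k =
      ∑ j ∈ (Finset.Icc 1 N).filter (fun j => j * (k.1 + 1) ≤ N), if j ≤ μ k then 1 else 0 := by
    intro μ hμ
    rw [mem_ofSize] at hμ
    rw [← Finset.card_filter, Finset.filter_filter]
    have : (Finset.Icc 1 N).filter (fun j => j * (k.1 + 1) ≤ N ∧ j ≤ μ k) = Finset.Icc 1 (μ k) := by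
      ext j
      simp only [Finset.mem_filter, Finset.mem_Icc]
      constructor
      · tauto
      · rintro ⟨h1, h2⟩
        have h3 := μ.mul_le_size k
        have h4 := μ.apply_le_size k
        have h5 := Nat.mul_le_mul_right (k.1 + 1) h2
        omega
    rw [this, Nat.card_Icc, Nat.add_sub_cancel]
  rw [Finset.sum_congr rfl h1, Finset.sum_comm]
  refine Finset.sum_congr rfl fun j hj => ?_
  rw [← Finset.card_filter]
  exact card_filter_le_apply N j k (Finset.mem_filter.mp hj).2

/-- The total number of parts of size `t` and sign `+1` in all bipartitions of `N`. -/
noncomputable def partCount (N t : ℕ) : ℕ :=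
  ∑ j ∈ (Finset.Icc 1 N).filter (fun j => j * t ≤ N), count (N - j * t)

lemma sum_apply_eq_partCount (N : ℕ) {t : ℕ} (ht : 1 ≤ t) (s : ℤˣ) :
    ∑ μ ∈ ofSize N, μ (t - 1, s) = partCount N t := by
  rw [sum_apply, partCount]
  simp only [Nat.sub_add_cancel ht]

lemma partCount_anti (N : ℕ) {t u : ℕ} (h : t ≤ u) : partCount N u ≤ partCount N t := by
  rw [partCount, partCount]
  have hj : ∀ j : ℕ, j * t ≤ j * u := fun j => Nat.mul_le_mul_left j h
  refine (Finset.sum_le_sum fun j _ => count_mono (Nat.sub_le_sub_left (hj j) N)).trans ?_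
  refine Finset.sum_le_sum_of_subset fun j hj' => ?_
  rw [Finset.mem_filter] at hj' ⊢
  exact ⟨hj'.1, (hj j).trans hj'.2⟩

lemma count_sub_le_partCount {N t : ℕ} (hN : 1 ≤ N) (ht : t ≤ N) : count (N - t) ≤ partCount N t := by
  have := Finset.single_le_sum (f := fun j => count (N - j * t)) (fun _ _ => Nat.zero_le _)
    (Finset.mem_filter.mpr ⟨Finset.mem_Icc.mpr ⟨le_refl 1, hN⟩, by simpa using ht⟩ :
      1 ∈ (Finset.Icc 1 N).filter (fun j => j * t ≤ N))
  simpa [partCount] using this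

lemma partCount_add_le {N s t : ℕ} (ht : 1 ≤ t) (hs : s ≤ N) : partCount N (t + s) ≤ partCount (N - s) t := by
  rw [partCount, partCount]
  have hle : ∀ j : ℕ, 1 ≤ j → j * t + s ≤ j * (t + s) := fun j hj => by nlinarith
  calc _ ≤ ∑ j ∈ (Finset.Icc 1 N).filter (fun j => j * (t + s) ≤ N), count (N - s - j * t) := by
        refine Finset.sum_le_sum fun j hj => count_mono ?_
        have := hle j (Finset.mem_Icc.mp (Finset.mem_filter.mp hj).1).1
        omega
    _ ≤ _ := by
        refine Finset.sum_le_sum_of_subset fun j hj => ?_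
        simp only [Finset.mem_filter, Finset.mem_Icc] at hj ⊢
        have h1 := hle j hj.1.1
        have h2 := Nat.le_mul_of_pos_right j ht
        omega

/-- The recurrence obtained by summing all parts of all bipartitions of `n`. -/
lemma mul_count (n : ℕ) :
    n * count n = 2 * ∑ d ∈ Finset.Icc 1 n, d * partCount n d := by
  have h1 : n * count n = ∑ μ ∈ ofSize n, ∑ i : Fin n × ℤˣ, μ (i.1, i.2) * (i.1 + 1) := by
    rw [count, mul_comm, ← smul_eq_mul, ← Finset.sum_const]
    refine Finset.sum_congr rfl fun μ hμ => ?_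
    rw [mem_ofSize] at hμ
    rw [← size_eq_sum hμ.le, hμ]
  rw [h1, Finset.sum_comm, ← Finset.univ_product_univ, Finset.sum_product_right]
  have h2 : ∀ s : ℤˣ, ∑ i : Fin n, ∑ μ ∈ ofSize n, μ ((i : ℕ), s) * (i + 1) =
      ∑ d ∈ Finset.Icc 1 n, d * partCount n d := by
    intro s
    have h3 : ∑ d ∈ Finset.Icc 1 n, d * partCount n d =
        ∑ i ∈ Finset.range n, (i + 1) * partCount n (i + 1) := by
      refine Finset.sum_nbij' (· - 1) (· + 1) ?_ ?_ ?_ ?_ ?_ <;>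
        intro d hd <;> simp only [Finset.mem_Icc, Finset.mem_range] at hd ⊢ <;> try omega
      rw [Nat.sub_add_cancel hd.1]
    rw [h3, Finset.sum_range]
    refine Finset.sum_congr rfl fun i _ => ?_
    rw [← Finset.sum_mul, ← sum_apply_eq_partCount n (Nat.le_add_left 1 i) s, Nat.add_sub_cancel,
      mul_comm]
  simp only [h2]
  rw [Finset.sum_const, Finset.card_univ, Fintype.card_units_int, smul_eq_mul]

end SignedType

section Series

lemma inv_sq_sub_one_le {s : ℝ} (hs : 0 < s) :
    1 / s ^ 2 - 1 ≤ Real.exp (-s) / (1 - Real.exp (-s)) ^ 2 := by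
  by_cases h1 : 1 ≤ s
  · have : 1 / s ^ 2 ≤ 1 := by
      rw [div_le_one (by positivity)]; nlinarith
    have h2 : 0 ≤ Real.exp (-s) / (1 - Real.exp (-s)) ^ 2 := by positivity
    linarith
  · push Not at h1
    have hx : Real.exp (-s) < 1 := by rw [Real.exp_lt_one_iff]; linarith
    have hx0 := Real.exp_pos (-s)
    have hv : 1 - s ^ 2 / 2 > 0 := by nlinarith
    have h2 : Real.cosh s * (1 - s ^ 2 / 2) ≤ 1 := by
      have h3 := Real.cosh_le_exp_half_sq s
      have h4 := Real.one_sub_le_exp_neg (s ^ 2 / 2)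
      calc _ ≤ Real.exp (s ^ 2 / 2) * Real.exp (-(s ^ 2 / 2)) := by gcongr
        _ = 1 := by rw [← Real.exp_add]; simp
    have h5 : (1 - Real.exp (-s)) ^ 2 = Real.exp (-s) * (2 * (Real.cosh s - 1)) := by
      rw [Real.cosh_eq]
      have : Real.exp (-s) * Real.exp s = 1 := by rw [← Real.exp_add]; simp
      nlinarith
    have h6 : 0 < (1 - Real.exp (-s)) ^ 2 := by
      have : 0 < 1 - Real.exp (-s) := by linarith
      positivity
    rw [le_div_iff₀ h6, h5]
    have h7 : (1 / s ^ 2 - 1) * (2 * (Real.cosh s - 1)) ≤ 1 := by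
      have h8 : 2 * (Real.cosh s - 1) * (1 - s ^ 2 / 2) ≤ s ^ 2 := by nlinarith
      have h9 : 1 / s ^ 2 - 1 = (1 - s ^ 2) / s ^ 2 := by field_simp
      have h10 := Real.one_le_cosh s
      rw [h9, div_mul_eq_mul_div, div_le_one (by positivity)]
      nlinarith [mul_nonneg (sq_nonneg s) (sub_nonneg.mpr h10)]
    nlinarith

lemma summable_pow_mul_geom (k : ℕ) {x : ℝ} (h0 : 0 ≤ x) (h1 : x < 1) :
    Summable fun d : ℕ => (d : ℝ) ^ k * x ^ d :=
  summable_pow_mul_geometric_of_norm_lt_one k (by rwa [Real.norm_of_nonneg h0])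

lemma tsum_cube_mul_geom_le {x : ℝ} (h0 : 0 ≤ x) (h1 : x < 1) :
    ∑' d : ℕ, (d : ℝ) ^ 3 * x ^ d ≤ 6 / (1 - x) ^ 4 := by
  have hx : ‖x‖ < 1 := by rwa [Real.norm_of_nonneg h0]
  have h2 := tsum_choose_mul_geometric_of_norm_lt_one 3 hx
  have h3 := summable_choose_mul_geometric_of_norm_lt_one 3 hx
  have h4 : 6 / (1 - x) ^ 4 = ∑' d : ℕ, 6 * (((d + 3).choose 3 : ℝ) * x ^ d) := by
    rw [tsum_mul_left, h2]; norm_num; ring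
  rw [h4]
  refine (summable_pow_mul_geom 3 h0 h1).tsum_le_tsum (fun d => ?_) (h3.mul_left 6)
  rw [← mul_assoc]
  gcongr
  have h5 : (d + 3).choose 3 * 6 = (d + 3) * (d + 2) * (d + 1) := by
    have := Nat.descFactorial_eq_factorial_mul_choose (d + 3) 3
    simp [Nat.descFactorial_succ, Nat.factorial] at this
    lia
  have h6 : ((d + 3).choose 3 : ℝ) * 6 = (d + 3) * (d + 2) * (d + 1) := by exact_mod_cast h5
  have : (0 : ℝ) ≤ d := d.cast_nonneg
  rw [mul_comm, h6]
  calc (d : ℝ) ^ 3 = d * d * d := by ring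
    _ ≤ _ := by gcongr <;> linarith

lemma le_tsum_sq_mul_geom {x : ℝ} (h0 : 0 ≤ x) (h1 : x < 1) :
    x ^ 2 / (1 - x) ^ 3 ≤ ∑' d : ℕ, (d : ℝ) ^ 2 * x ^ d := by
  have hx : ‖x‖ < 1 := by rwa [Real.norm_of_nonneg h0]
  have h2 := tsum_choose_mul_geometric_of_norm_lt_one 2 hx
  have h3 := summable_choose_mul_geometric_of_norm_lt_one 2 hx
  have hs := summable_pow_mul_geom 2 h0 h1
  have h4 : x ^ 2 / (1 - x) ^ 3 = ∑' d : ℕ, x ^ 2 * (((d + 2).choose 2 : ℝ) * x ^ d) := by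
    rw [tsum_mul_left, h2]; norm_num; ring
  rw [h4, ← hs.sum_add_tsum_nat_add 2]
  refine le_add_of_nonneg_of_le (Finset.sum_nonneg fun i _ => by positivity) ?_
  refine (h3.mul_left _).tsum_le_tsum (fun d => ?_) ((summable_nat_add_iff 2).mpr hs)
  have h5 : ((d + 2).choose 2 : ℝ) ≤ ((d + 2 : ℕ) : ℝ) ^ 2 := by
    exact_mod_cast Nat.choose_le_pow (d + 2) 2
  calc x ^ 2 * (((d + 2).choose 2 : ℝ) * x ^ d) = ((d + 2).choose 2 : ℝ) * x ^ (d + 2) := by ring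
    _ ≤ _ := by gcongr

lemma pi_sq_div_six_sub_le {J : ℕ} (hJ : 1 ≤ J) :
    Real.pi ^ 2 / 6 - 1 / J ≤ ∑ j ∈ Finset.Icc 1 J, 1 / (j : ℝ) ^ 2 := by
  have h1 := hasSum_zeta_two.tendsto_sum_nat.comp (tendsto_add_atTop_nat 1)
  suffices h : Real.pi ^ 2 / 6 ≤ ∑ j ∈ Finset.Icc 1 J, 1 / (j : ℝ) ^ 2 + 1 / J by linarith
  refine le_of_tendsto h1 (eventually_atTop.mpr ⟨J, fun M hM => ?_⟩)
  have h2 := sum_Ioc_inv_sq_le_sub (α := ℝ) (k := J) (n := M) (by omega) hM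
  have h3 : Finset.range (M + 1) = insert 0 (Finset.Icc 1 J ∪ Finset.Ioc J M) := by
    ext i
    simp only [Finset.mem_range, Finset.mem_insert, Finset.mem_union, Finset.mem_Icc,
      Finset.mem_Ioc]
    omega
  have h4 : Disjoint (Finset.Icc 1 J) (Finset.Ioc J M) := by
    rw [Finset.disjoint_left]
    intro i
    simp only [Finset.mem_Icc, Finset.mem_Ioc]
    omega
  simp only [Function.comp_apply]
  rw [h3, Finset.sum_insert (by simp), Finset.sum_union h4]
  have h5 : (0 : ℝ) ≤ (M : ℝ)⁻¹ := by positivity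
  simp only [one_div] at *
  simp only [CharP.cast_eq_zero, ne_eq, OfNat.ofNat_ne_zero, not_false_eq_true, zero_pow, inv_zero]
  linarith

lemma sum_inv_sq_le (J : ℕ) : ∑ j ∈ Finset.Icc 1 J, 1 / (j : ℝ) ^ 2 ≤ 2 := by
  refine (sum_le_hasSum _ (fun _ _ => by positivity) hasSum_zeta_two).trans ?_
  have := Real.pi_lt_d2
  have := Real.pi_pos
  nlinarith

end Series

/-- The constant `C` for which the number of bipartitions of `n` grows like `exp (C √n)`. -/
noncomputable def growthConst : ℝ := 2 * Real.pi / √3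

lemma growthConst_pos : 0 < growthConst := by
  have := Real.pi_pos
  unfold growthConst; positivity

lemma growthConst_sq : growthConst ^ 2 = 4 * Real.pi ^ 2 / 3 := by
  rw [growthConst, div_pow, Real.sq_sqrt (by norm_num)]; ring

lemma growthConst_bounds : 3 ≤ growthConst ∧ growthConst ≤ 4 := by
  have h1 := growthConst_pos
  have h2 := growthConst_sq
  have h3 := Real.pi_gt_three
  have h4 := Real.pi_lt_d2
  constructor <;> nlinarith

/-- The Boltzmann exponent attached to `n`. -/
noncomputable def decay (n : ℕ) : ℝ := growthConst / (2 * √n)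

lemma decay_pos {n : ℕ} (hn : 1 ≤ n) : 0 < decay n := by
  have : (0 : ℝ) < n := by exact_mod_cast hn
  have := growthConst_pos
  unfold decay; positivity

lemma decay_mul_sqrt {n : ℕ} (hn : 1 ≤ n) : decay n * √n = growthConst / 2 := by
  have : (0 : ℝ) < n := by exact_mod_cast hn
  have : 0 < √(n : ℝ) := by positivity
  unfold decay; field_simp

lemma one_sub_exp_neg_ge {s : ℝ} (h0 : 0 ≤ s) (h2 : s ≤ 2) : s / 3 ≤ 1 - Real.exp (-s) := by
  have h : Real.exp (-s) * (1 + s) ≤ 1 := by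
    have h1 := Real.add_one_le_exp s
    calc Real.exp (-s) * (1 + s) ≤ Real.exp (-s) * Real.exp s := by gcongr; linarith
      _ = 1 := by rw [← Real.exp_add]; simp
  nlinarith [Real.exp_pos (-s)]

section

variable {n : ℕ}

lemma sum_main_ge (hn : 1 ≤ n) :
    (n : ℝ) / 2 - 2 * √n ≤ ∑ j ∈ Finset.Icc 1 (Nat.sqrt n),
      Real.exp (-(decay n * j)) / (1 - Real.exp (-(decay n * j))) ^ 2 := by
  set J := Nat.sqrt n
  have hJ : 1 ≤ J := Nat.sqrt_pos.mpr hn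
  have hJ0 : (1 : ℝ) ≤ J := by exact_mod_cast hJ
  have hβ := decay_pos hn
  have hn0 : (0 : ℝ) < n := by exact_mod_cast hn
  have hr : 0 < √(n : ℝ) := by positivity
  have hr2 : √(n : ℝ) ^ 2 = n := Real.sq_sqrt hn0.le
  have hJ1 : (J : ℝ) ≤ √n := Real.nat_sqrt_le_real_sqrt
  have hJ2 : √(n : ℝ) ≤ J + 1 := Real.real_sqrt_le_nat_sqrt_succ
  have h1 : ∀ j ∈ Finset.Icc 1 J, 1 / (decay n) ^ 2 * (1 / (j : ℝ) ^ 2) - 1 ≤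
      Real.exp (-(decay n * j)) / (1 - Real.exp (-(decay n * j))) ^ 2 := by
    intro j hj
    have hj1 : (0 : ℝ) < j := by exact_mod_cast (Finset.mem_Icc.mp hj).1
    refine le_trans (le_of_eq ?_) (inv_sq_sub_one_le (s := decay n * j) (by positivity))
    rw [mul_pow]; field_simp
  refine le_trans ?_ (Finset.sum_le_sum h1)
  rw [Finset.sum_sub_distrib, ← Finset.mul_sum, Finset.sum_const, Nat.card_Icc, Nat.add_sub_cancel,
    nsmul_eq_mul, mul_one]
  have h2 := pi_sq_div_six_sub_le hJ
  have hb : 1 / (decay n) ^ 2 = 4 * n / growthConst ^ 2 := by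
    unfold decay
    have := growthConst_pos
    rw [div_pow, mul_pow, hr2]; field_simp; norm_num
  have h3 : 4 * n / growthConst ^ 2 * (Real.pi ^ 2 / 6) = n / 2 := by
    rw [growthConst_sq]
    have := Real.pi_pos
    field_simp
    norm_num
  have h4 : 4 * n / growthConst ^ 2 * (1 / J) ≤ √n := by
    have h5 : (9 : ℝ) ≤ growthConst ^ 2 := by nlinarith [growthConst_bounds.1]
    calc 4 * n / growthConst ^ 2 * (1 / J) ≤ 4 * n / 9 * (1 / J) := by gcongr
      _ ≤ √n := by
        rw [mul_one_div, div_le_iff₀ (by positivity)]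
        nlinarith
  have h5 : 1 / (decay n) ^ 2 * (Real.pi ^ 2 / 6 - 1 / J) ≤
      1 / (decay n) ^ 2 * ∑ j ∈ Finset.Icc 1 J, 1 / (j : ℝ) ^ 2 := by gcongr
  rw [hb, mul_sub, h3] at h5
  rw [hb]
  linarith

lemma decay_mul_le_two (hn : 1 ≤ n) {j : ℕ} (hj : j ∈ Finset.Icc 1 (Nat.sqrt n)) :
    decay n * j ≤ 2 := by
  have hj2 : (j : ℝ) ≤ √n :=
    (Nat.cast_le.mpr (Finset.mem_Icc.mp hj).2).trans Real.nat_sqrt_le_real_sqrt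
  have := decay_mul_sqrt hn
  have := mul_le_mul_of_nonneg_left hj2 (decay_pos hn).le
  have := growthConst_bounds.2
  linarith

lemma sum_cube_le (hn : 1 ≤ n) :
    ∑ j ∈ Finset.Icc 1 (Nat.sqrt n),
      decay n * j ^ 2 / n * ∑' d : ℕ, (d : ℝ) ^ 3 * Real.exp (-(decay n * j)) ^ d ≤
      972 / (n * decay n ^ 3) := by
  have hβ := decay_pos hn
  have hn0 : (0 : ℝ) < n := by exact_mod_cast hn
  have h1 : ∀ j ∈ Finset.Icc 1 (Nat.sqrt n),
      decay n * j ^ 2 / n * ∑' d : ℕ, (d : ℝ) ^ 3 * Real.exp (-(decay n * j)) ^ d ≤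
      486 / (n * decay n ^ 3) * (1 / (j : ℝ) ^ 2) := by
    intro j hj
    have hj1 : (0 : ℝ) < j := by exact_mod_cast (Finset.mem_Icc.mp hj).1
    have hs : 0 < decay n * j := by positivity
    have h2 := one_sub_exp_neg_ge hs.le (decay_mul_le_two hn hj)
    have h3 := tsum_cube_mul_geom_le (Real.exp_pos (-(decay n * j))).le
      (by rw [Real.exp_lt_one_iff]; linarith)
    calc _ ≤ decay n * j ^ 2 / n * (6 / (decay n * j / 3) ^ 4) := by
          refine mul_le_mul_of_nonneg_left (h3.trans ?_) (by positivity)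
          gcongr
      _ = _ := by field_simp; norm_num
  refine (Finset.sum_le_sum h1).trans ?_
  rw [← Finset.mul_sum]
  calc _ ≤ 486 / (n * decay n ^ 3) * 2 :=
        mul_le_mul_of_nonneg_left (sum_inv_sq_le _) (by positivity)
    _ = _ := by ring

lemma sum_sq_ge (hn : 1 ≤ n) (A : ℕ) :
    A * Real.exp (-4) / 2 / (n * decay n ^ 3) ≤ ∑ j ∈ Finset.Icc 1 (Nat.sqrt n),
      A * j / (n + 1) * ∑' d : ℕ, (d : ℝ) ^ 2 * Real.exp (-(decay n * j)) ^ d := by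
  have hβ := decay_pos hn
  have hn0 : (1 : ℝ) ≤ n := by exact_mod_cast hn
  have hJ : 1 ∈ Finset.Icc 1 (Nat.sqrt n) :=
    Finset.mem_Icc.mpr ⟨le_refl 1, Nat.sqrt_pos.mpr hn⟩
  refine le_trans ?_ (Finset.single_le_sum (f := fun j : ℕ => A * j / (n + 1) *
    ∑' d : ℕ, (d : ℝ) ^ 2 * Real.exp (-(decay n * j)) ^ d) (fun j _ => ?_) hJ)
  · have hs := decay_mul_le_two hn hJ
    simp only [Nat.cast_one, mul_one] at hs ⊢
    have hx : Real.exp (-decay n) < 1 := by rw [Real.exp_lt_one_iff]; linarith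
    have h3 := le_tsum_sq_mul_geom (Real.exp_pos (-decay n)).le hx
    have h4 : 1 - Real.exp (-decay n) ≤ decay n := by
      have := Real.one_sub_le_exp_neg (decay n); linarith
    have h5 : Real.exp (-4) ≤ Real.exp (-decay n) ^ 2 := by
      rw [← Real.exp_nat_mul]
      refine Real.exp_le_exp.mpr ?_
      push_cast; linarith
    have h6 : 0 < 1 - Real.exp (-decay n) := by linarith
    calc A * Real.exp (-4) / 2 / (n * decay n ^ 3)
        = A / (2 * n) * (Real.exp (-4) / decay n ^ 3) := by field_simp
      _ ≤ A / (n + 1) * (Real.exp (-decay n) ^ 2 / (1 - Real.exp (-decay n)) ^ 3) := by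
        gcongr; linarith
      _ ≤ _ := mul_le_mul_of_nonneg_left h3 (by positivity)
  · exact mul_nonneg (by positivity) (tsum_nonneg fun d => by positivity)

lemma exists_series_ge : ∃ A : ℕ, ∀ n : ℕ, 1 ≤ n → (n : ℝ) / 2 ≤
    ∑ j ∈ Finset.Icc 1 (Nat.sqrt n),
      (Real.exp (-(decay n * j)) / (1 - Real.exp (-(decay n * j))) ^ 2 +
        A * j / (n + 1) * ∑' d : ℕ, (d : ℝ) ^ 2 * Real.exp (-(decay n * j)) ^ d -
        decay n * j ^ 2 / n * ∑' d : ℕ, (d : ℝ) ^ 3 * Real.exp (-(decay n * j)) ^ d) := by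
  obtain ⟨A, hA⟩ := exists_nat_ge (2000 / Real.exp (-4))
  refine ⟨A, fun n hn => ?_⟩
  rw [Finset.sum_sub_distrib, Finset.sum_add_distrib]
  have h1 := sum_main_ge hn
  have h2 := sum_cube_le hn
  have h3 := sum_sq_ge hn A
  have hn0 : (0 : ℝ) < n := by exact_mod_cast hn
  have hr : 0 < √(n : ℝ) := by positivity
  have hβ := decay_pos hn
  have hA : 2000 ≤ A * Real.exp (-4) := by rwa [div_le_iff₀ (Real.exp_pos _)] at hA
  have h4 : √(n : ℝ) / 8 ≤ 1 / (n * decay n ^ 3) := by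
    have hC := growthConst_bounds
    have h5 : n * decay n ^ 3 * √n = growthConst ^ 3 / 8 := by
      have h6 : √(n : ℝ) * √n = n := Real.mul_self_sqrt hn0.le
      calc n * decay n ^ 3 * √n = (decay n * √n) ^ 3 := by
            rw [mul_pow]; nth_rewrite 1 [← h6]; ring
        _ = _ := by rw [decay_mul_sqrt hn]; ring
    have h6 : growthConst ^ 3 ≤ 64 := by
      calc growthConst ^ 3 ≤ 4 ^ 3 := pow_le_pow_left₀ (by linarith) hC.2 3
        _ = 64 := by norm_num
    rw [le_div_iff₀ (by positivity)]
    nlinarith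
  have h5 : 1000 / (n * decay n ^ 3) ≤ A * Real.exp (-4) / 2 / (n * decay n ^ 3) := by
    gcongr; linarith
  have h6 : 1000 / (n * decay n ^ 3) = 972 / (n * decay n ^ 3) + 28 * (1 / (n * decay n ^ 3)) := by
    ring
  linarith

end

lemma sqrt_sub_ge {x y : ℝ} (hx : 0 < x) (h0 : 0 ≤ y) (hy : y ≤ x) :
    √x - y / (2 * √x) - y ^ 2 / (2 * √x * x) ≤ √(x - y) := by
  have hr : 0 < √x := Real.sqrt_pos.mpr hx
  have h2 : √x ^ 2 = x := Real.sq_sqrt hx.le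
  set z := y / x with hz
  have hyz : y = z * x := by rw [hz]; field_simp
  have hz0 : 0 ≤ z := by positivity
  have hz1 : z ≤ 1 := (div_le_one hx).mpr hy
  have h3 : √x - y / (2 * √x) - y ^ 2 / (2 * √x * x) = √x * ((1 - z) * (1 + z / 2)) := by
    rw [hyz]
    field_simp
    rw [h2]; ring
  rw [h3]
  apply Real.le_sqrt_of_sq_le
  rw [mul_pow, h2, hyz]
  have h4 : ((1 - z) * (1 + z / 2)) ^ 2 ≤ 1 - z := by
    have h5 : (1 - z) * (1 + z / 2) ^ 2 ≤ 1 := by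
      nlinarith [mul_nonneg hz0 hz0, mul_nonneg (mul_nonneg hz0 hz0) hz0]
    calc ((1 - z) * (1 + z / 2)) ^ 2 = (1 - z) * ((1 - z) * (1 + z / 2) ^ 2) := by ring
      _ ≤ (1 - z) * 1 := mul_le_mul_of_nonneg_left h5 (by linarith)
      _ = 1 - z := mul_one _
  nlinarith

/-- The comparison function for the number of bipartitions. -/
noncomputable def growth (A n : ℕ) : ℝ := Real.exp (growthConst * √n) / ((n : ℝ) + 1) ^ A

lemma growth_pos (A n : ℕ) : 0 < growth A n := by unfold growth; positivity

lemma growth_sub_ge (A : ℕ) {n k : ℕ} (hn : 1 ≤ n) (hk : k ≤ n) :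
    growth A n * (Real.exp (-(decay n * k)) *
      (1 + A * k / (n + 1) - decay n * k ^ 2 / n)) ≤ growth A (n - k) := by
  have hn0 : (0 : ℝ) < n := by exact_mod_cast hn
  have hk0 : (k : ℝ) ≤ n := by exact_mod_cast hk
  have hk1 : (0 : ℝ) ≤ k := k.cast_nonneg
  have hr : 0 < √(n : ℝ) := by positivity
  have hC := growthConst_pos
  have h1 : growthConst * √n - decay n * k - decay n * k ^ 2 / n ≤ growthConst * √((n - k : ℕ) : ℝ) := by
    rw [Nat.cast_sub hk]
    have h2 := mul_le_mul_of_nonneg_left (sqrt_sub_ge hn0 hk1 hk0) hC.le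
    refine le_trans (le_of_eq ?_) h2
    unfold decay
    field_simp
  have h3 : (((n - k : ℕ) : ℝ) + 1) ^ A ≤ ((n : ℝ) + 1) ^ A * Real.exp (-(A * k / (n + 1))) := by
    have h4 : (((n - k : ℕ) : ℝ) + 1) ≤ ((n : ℝ) + 1) * Real.exp (-(k / (n + 1))) := by
      have h5 := Real.one_sub_le_exp_neg ((k : ℝ) / (n + 1))
      rw [Nat.cast_sub hk]
      calc (n : ℝ) - k + 1 = (n + 1) * (1 - k / (n + 1)) := by field_simp; ring
        _ ≤ _ := by gcongr
    calc _ ≤ (((n : ℝ) + 1) * Real.exp (-(k / (n + 1)))) ^ A := by gcongr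
      _ = _ := by
        rw [mul_pow, ← Real.exp_nat_mul]
        congr 2; ring
  have h6 : 1 + A * k / (n + 1) - decay n * k ^ 2 / n ≤
      Real.exp (A * k / (n + 1) - decay n * k ^ 2 / n) := by
    have := Real.add_one_le_exp ((A : ℝ) * k / (n + 1) - decay n * k ^ 2 / n)
    linarith
  calc _ ≤ growth A n * (Real.exp (-(decay n * k)) *
      Real.exp (A * k / (n + 1) - decay n * k ^ 2 / n)) := by
        have := growth_pos A n
        gcongr
    _ = Real.exp (growthConst * √n - decay n * k - decay n * k ^ 2 / n) /
        (((n : ℝ) + 1) ^ A * Real.exp (-(A * k / (n + 1)))) := by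
      unfold growth
      rw [div_mul_eq_mul_div, ← Real.exp_add, ← Real.exp_add, Real.exp_neg, ← div_eq_mul_inv,
        div_div_eq_mul_div, ← Real.exp_add]
      congr 2; ring
    _ ≤ _ := by
      unfold growth
      gcongr

lemma sum_growth_ge (A : ℕ) {n j : ℕ} (hj : 1 ≤ j) (hn : (A + 1) ^ 2 ≤ n) :
    growth A n * (Real.exp (-(decay n * j)) / (1 - Real.exp (-(decay n * j))) ^ 2 +
        A * j / (n + 1) * ∑' d : ℕ, (d : ℝ) ^ 2 * Real.exp (-(decay n * j)) ^ d -
        decay n * j ^ 2 / n * ∑' d : ℕ, (d : ℝ) ^ 3 * Real.exp (-(decay n * j)) ^ d) ≤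
    ∑ d ∈ (Finset.Icc 1 n).filter (fun d => j * d ≤ n), d * growth A (n - j * d) := by
  have hn1 : 1 ≤ n := le_trans (Nat.one_le_pow _ _ A.succ_pos) hn
  have hn0 : (0 : ℝ) < n := by exact_mod_cast hn1
  have hβ := decay_pos hn1
  have hj0 : (1 : ℝ) ≤ j := by exact_mod_cast hj
  set x := Real.exp (-(decay n * j)) with hx
  have hx0 : 0 ≤ x := (Real.exp_pos _).le
  have hx1 : x < 1 := by
    rw [hx, Real.exp_lt_one_iff]
    have : 0 < decay n * j := by positivity
    linarith
  have hxd : ∀ d : ℕ, x ^ d = Real.exp (-(decay n * (j * d : ℕ))) := by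
    intro d
    rw [hx, ← Real.exp_nat_mul]
    congr 1; push_cast; ring
  let h : ℕ → ℝ := fun d => d * x ^ d + A * j / (n + 1) * ((d : ℝ) ^ 2 * x ^ d) -
    decay n * j ^ 2 / n * ((d : ℝ) ^ 3 * x ^ d)
  have hh : ∀ d : ℕ, h d = d * (x ^ d *
      (1 + A * (j * d : ℕ) / (n + 1) - decay n * (j * d : ℕ) ^ 2 / n)) := by
    intro d
    simp only [h]
    push_cast
    ring
  have s1 : HasSum (fun d : ℕ => (d : ℝ) * x ^ d) (x / (1 - x) ^ 2) :=
    hasSum_coe_mul_geometric_of_norm_lt_one (by rwa [Real.norm_of_nonneg hx0])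
  have hs : HasSum h _ := (s1.add ((summable_pow_mul_geom 2 hx0 hx1).hasSum.mul_left
    (A * j / (n + 1) : ℝ))).sub ((summable_pow_mul_geom 3 hx0 hx1).hasSum.mul_left
    (decay n * j ^ 2 / n))
  rw [← hs.tsum_eq]
  have hneg : ∀ d : ℕ, d ∉ (Finset.Icc 1 n).filter (fun d => j * d ≤ n) → h d ≤ 0 := by
    intro d hd
    rcases Nat.eq_zero_or_pos d with rfl | hd0
    · rw [hh]; simp
    have hd1 : n < j * d := by
      by_contra hc
      push Not at hc
      have := Nat.le_mul_of_pos_left d hj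
      exact hd (Finset.mem_filter.mpr ⟨Finset.mem_Icc.mpr ⟨hd0, by omega⟩, hc⟩)
    have hk : (n : ℝ) < (j * d : ℕ) := by exact_mod_cast hd1
    rw [hh]
    refine mul_nonpos_of_nonneg_of_nonpos d.cast_nonneg
      (mul_nonpos_of_nonneg_of_nonpos (by positivity) ?_)
    generalize ((j * d : ℕ) : ℝ) = k at hk
    have hk0 : 0 < k := hn0.trans hk
    have hsq : (A + 1 : ℝ) ≤ √n := by
      apply Real.le_sqrt_of_sq_le; exact_mod_cast hn
    have h1 : (A + 1 : ℝ) ≤ decay n * k := by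
      have h2 : decay n * n = growthConst / 2 * √n := by
        rw [← decay_mul_sqrt hn1, mul_assoc, Real.mul_self_sqrt hn0.le]
      have h3 := growthConst_bounds.1
      have h4 : decay n * n ≤ decay n * k := by gcongr
      nlinarith [Real.sqrt_nonneg (n : ℝ)]
    have h2 : (A + 1 : ℝ) * (k / n) ≤ decay n * k ^ 2 / n := by
      calc (A + 1 : ℝ) * (k / n) ≤ decay n * k * (k / n) := by gcongr
        _ = _ := by ring
    have h3 : 1 ≤ k / n := by rw [one_le_div hn0]; exact hk.le
    have h4 : A * k / (n + 1) ≤ A * (k / n) := by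
      rw [← mul_div_assoc]
      gcongr; linarith
    nlinarith
  have hle : ∑' d, h d ≤ ∑ d ∈ (Finset.Icc 1 n).filter (fun d => j * d ≤ n), h d := by
    have := hs.summable.neg.sum_le_tsum ((Finset.Icc 1 n).filter (fun d => j * d ≤ n))
      (fun d hd => by linarith [hneg d hd])
    rw [tsum_neg, Finset.sum_neg_distrib] at this
    linarith
  refine (mul_le_mul_of_nonneg_left hle (growth_pos A n).le).trans ?_
  rw [Finset.mul_sum]
  refine Finset.sum_le_sum fun d hd => ?_
  rw [hh, hxd, mul_left_comm]
  exact mul_le_mul_of_nonneg_left (growth_sub_ge A hn1 (Finset.mem_filter.mp hd).2) d.cast_nonneg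

namespace SignedType

lemma exists_count_ge : ∃ A : ℕ, ∃ c : ℝ, 0 < c ∧ ∀ n, c * growth A n ≤ count n := by
  obtain ⟨A, hA⟩ := exists_series_ge
  refine ⟨A, Real.exp (-(growthConst * √(((A + 1) ^ 2 : ℕ) : ℝ))), Real.exp_pos _, fun n => ?_⟩
  set c := Real.exp (-(growthConst * √(((A + 1) ^ 2 : ℕ) : ℝ))) with hc
  have hc0 : 0 < c := Real.exp_pos _
  have hC := growthConst_pos
  induction n using Nat.strong_induction_on with
  | _ n ih =>
  by_cases hn : (A + 1) ^ 2 ≤ n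
  · have hn1 : 1 ≤ n := le_trans (Nat.one_le_pow _ _ A.succ_pos) hn
    have hn0 : (0 : ℝ) < n := by exact_mod_cast hn1
    have h1 : (n : ℝ) * count n = 2 * ∑ d ∈ Finset.Icc 1 n,
        d * ∑ j ∈ (Finset.Icc 1 n).filter (fun j => j * d ≤ n), (count (n - j * d) : ℝ) := by
      have := mul_count n
      simp only [partCount] at this
      exact_mod_cast this
    have h2 : ∑ j ∈ Finset.Icc 1 (Nat.sqrt n),
        ∑ d ∈ (Finset.Icc 1 n).filter (fun d => j * d ≤ n), d * (c * growth A (n - j * d)) ≤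
        ∑ d ∈ Finset.Icc 1 n,
        d * ∑ j ∈ (Finset.Icc 1 n).filter (fun j => j * d ≤ n), (count (n - j * d) : ℝ) := by
      have h3 : ∑ d ∈ Finset.Icc 1 n,
        d * ∑ j ∈ (Finset.Icc 1 n).filter (fun j => j * d ≤ n), (count (n - j * d) : ℝ) =
        ∑ j ∈ Finset.Icc 1 n, ∑ d ∈ (Finset.Icc 1 n).filter (fun d => j * d ≤ n),
          (d : ℝ) * (count (n - j * d) : ℝ) := by
        simp only [Finset.sum_filter, Finset.mul_sum, mul_ite, mul_zero]
        exact Finset.sum_comm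
      rw [h3]
      refine (Finset.sum_le_sum fun j hj => Finset.sum_le_sum fun d hd => ?_).trans
        (Finset.sum_le_sum_of_subset_of_nonneg
          (Finset.Icc_subset_Icc_right (Nat.sqrt_le_self n)) fun j _ _ => by positivity)
      have hd1 := Finset.mem_Icc.mp (Finset.mem_filter.mp hd).1
      have hj1 := Finset.mem_Icc.mp hj
      have : 0 < j * d := Nat.mul_pos hj1.1 hd1.1
      exact mul_le_mul_of_nonneg_left (ih _ (by omega)) d.cast_nonneg
    have h4 : growth A n * c * (n / 2) ≤ ∑ j ∈ Finset.Icc 1 (Nat.sqrt n),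
        ∑ d ∈ (Finset.Icc 1 n).filter (fun d => j * d ≤ n), d * (c * growth A (n - j * d)) := by
      refine (mul_le_mul_of_nonneg_left (hA n hn1)
        (mul_pos (growth_pos A n) hc0).le).trans ?_
      rw [Finset.mul_sum]
      refine Finset.sum_le_sum fun j hj => ?_
      have h5 := mul_le_mul_of_nonneg_left
        (sum_growth_ge A (Finset.mem_Icc.mp hj).1 hn) hc0.le
      rw [Finset.mul_sum] at h5
      calc _ ≤ _ := le_of_eq (by ring)
        _ ≤ _ := h5
        _ = _ := Finset.sum_congr rfl fun d _ => by ring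
    have h6 : c * growth A n * n ≤ count n * n := by
      rw [mul_comm (count n : ℝ), h1]
      linarith
    exact le_of_mul_le_mul_right h6 hn0
  · push Not at hn
    have h1 : growth A n ≤ Real.exp (growthConst * √(((A + 1) ^ 2 : ℕ) : ℝ)) := by
      unfold growth
      refine (div_le_self (Real.exp_pos _).le (one_le_pow₀ ?_)).trans ?_
      · have : (0 : ℝ) ≤ n := n.cast_nonneg
        linarith
      · gcongr
    calc c * growth A n ≤ c * Real.exp (growthConst * √(((A + 1) ^ 2 : ℕ) : ℝ)) := by gcongr
      _ = 1 := by rw [hc, ← Real.exp_add]; simp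
      _ ≤ count n := by exact_mod_cast count_pos n

lemma sum_comp_multiplicities_le {N : ℕ} {T : Finset SignedType} (hT : T ⊆ ofSize N)
    (S : Finset (Fin N × ℤˣ → Fin (N + 1))) (hS : ∀ μ ∈ T, multiplicities N μ ∈ S)
    (g : (Fin N × ℤˣ → Fin (N + 1)) → ℝ) (hg : ∀ f, 0 ≤ g f) :
    ∑ μ ∈ T, g (multiplicities N μ) ≤ ∑ f ∈ S, g f := by
  classical
  rw [← Finset.sum_image (f := g) (g := multiplicities N) fun μ hμ ν hν h =>
    injOn_multiplicities N (mem_ofSize.mp (hT hμ)) (mem_ofSize.mp (hT hν)) h]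
  refine Finset.sum_le_sum_of_subset_of_nonneg (fun f hf => ?_) fun f _ _ => hg f
  obtain ⟨μ, hμ, rfl⟩ := Finset.mem_image.mp hf
  exact hS μ hμ

/-- The Boltzmann weight of a part of size `k + 1`, where `k` is the first component. -/
noncomputable def partWeight (N : ℕ) (i : Fin N × ℤˣ) : ℝ := Real.exp (-(decay N * (i.1 + 1)))

lemma partWeight_pos {N : ℕ} (i : Fin N × ℤˣ) : 0 < partWeight N i := Real.exp_pos _

lemma partWeight_lt_one {N : ℕ} (i : Fin N × ℤˣ) : partWeight N i < 1 := by
  have := decay_pos (n := N) (by have := i.1.2; omega)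
  rw [partWeight, Real.exp_lt_one_iff]
  have : 0 < decay N * ((i.1 : ℕ) + 1) := by positivity
  linarith

lemma prod_partWeight_pow {N : ℕ} {μ : SignedType} (h : μ.size = N) :
    ∏ i, partWeight N i ^ (multiplicities N μ i : ℕ) = Real.exp (-(decay N * N)) := by
  have h1 : ∀ i, partWeight N i ^ (multiplicities N μ i : ℕ) =
      Real.exp (-(decay N) * ((μ (i.1, i.2) * (i.1 + 1) : ℕ) : ℝ)) := by
    intro i
    rw [multiplicities_val h, partWeight, ← Real.exp_nat_mul]
    congr 1; push_cast; ring
  simp only [h1]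
  rw [← Real.exp_sum, ← Finset.mul_sum, ← Nat.cast_sum, ← size_eq_sum h.le, h]
  congr 1; ring

lemma sum_pow_fin_le {x : ℝ} (h0 : 0 ≤ x) (h1 : x < 1) (n : ℕ) :
    ∑ m : Fin n, x ^ (m : ℕ) ≤ 1 / (1 - x) := by
  rw [Fin.sum_univ_eq_sum_range (fun m => x ^ m), one_div, ← tsum_geometric_of_lt_one h0 h1]
  exact (summable_geometric_of_lt_one h0 h1).sum_le_tsum _ fun _ _ => by positivity

lemma decay_mul_self {N : ℕ} (hN : 1 ≤ N) : decay N * N = growthConst * √N / 2 := by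
  have h := decay_mul_sqrt hN
  have h2 : √(N : ℝ) * √N = N := Real.mul_self_sqrt N.cast_nonneg
  calc decay N * N = decay N * √N * √N := by rw [mul_assoc, h2]
    _ = _ := by rw [h]; ring

lemma prod_one_div_le {N : ℕ} (hN : 1 ≤ N) :
    ∏ i, 1 / (1 - partWeight N i) ≤ Real.exp (growthConst * √N / 2) := by
  have hβ := decay_pos hN
  have h1 : ∀ i, 1 / (1 - partWeight N i) = Real.exp (-Real.log (1 - partWeight N i)) := by
    intro i
    have := partWeight_lt_one i
    rw [Real.exp_neg, Real.exp_log (by linarith), one_div]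
  simp only [h1]
  rw [← Real.exp_sum]
  refine Real.exp_le_exp.mpr ?_
  have h2 : HasSum (fun j : ℕ => ∑ i : Fin N × ℤˣ, partWeight N i ^ (j + 1) / ((j : ℝ) + 1))
      (∑ i : Fin N × ℤˣ, -Real.log (1 - partWeight N i)) := by
    refine hasSum_sum fun i _ => Real.hasSum_pow_div_log_of_abs_lt_one ?_
    rw [abs_of_pos (partWeight_pos i)]
    exact partWeight_lt_one i
  have h3 : HasSum (fun j : ℕ => 2 / decay N * (1 / ((j + 1 : ℕ) : ℝ) ^ 2))
      (2 / decay N * (Real.pi ^ 2 / 6)) := by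
    refine HasSum.mul_left _ ?_
    have := (hasSum_nat_add_iff (f := fun n : ℕ => 1 / (n : ℝ) ^ 2) (g := Real.pi ^ 2 / 6) 1).mpr
    refine this ?_
    simpa using hasSum_zeta_two
  refine (hasSum_le (fun j => ?_) h2 h3).trans (le_of_eq ?_)
  · have hs : 0 < decay N * (j + 1) := by positivity
    set y := Real.exp (-(decay N * (j + 1))) with hy
    have hy0 : 0 < y := Real.exp_pos _
    have hy1 : y < 1 := by rw [hy, Real.exp_lt_one_iff]; linarith
    have h4 : ∀ i : Fin N × ℤˣ, partWeight N i ^ (j + 1) = y * y ^ (i.1 : ℕ) := by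
      intro i
      rw [partWeight, hy, ← Real.exp_nat_mul, ← Real.exp_nat_mul, ← Real.exp_add]
      congr 1; push_cast; ring
    simp only [h4]
    rw [← Finset.univ_product_univ, Finset.sum_product_right]
    dsimp only
    rw [Finset.sum_const, Finset.card_univ,
      Fintype.card_units_int, nsmul_eq_mul, ← Finset.sum_div, ← Finset.mul_sum]
    have h5 := sum_pow_fin_le hy0.le hy1 N
    have h6 : y * (1 / (1 - y)) ≤ 1 / (decay N * (j + 1)) := by
      have h7 := Real.add_one_le_exp (decay N * (j + 1))
      have h8 : y * Real.exp (decay N * (j + 1)) = 1 := by rw [hy, ← Real.exp_add]; simp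
      rw [mul_one_div, div_le_div_iff₀ (by linarith) hs]
      nlinarith
    have h7 : y * ∑ m : Fin N, y ^ (m : ℕ) ≤ 1 / (decay N * (j + 1)) :=
      (mul_le_mul_of_nonneg_left h5 hy0.le).trans h6
    push_cast
    calc _ ≤ 2 * (1 / (decay N * (j + 1)) / ((j : ℝ) + 1)) := by gcongr
      _ = _ := by field_simp
  · have h4 := growthConst_sq
    have h5 := growthConst_pos
    have h6 : (0 : ℝ) < N := by exact_mod_cast hN
    have h7 : 0 < √(N : ℝ) := by positivity
    unfold decay
    field_simp
    linarith

/-- The average number of parts of a given size, bounded via convexity of the exponential. -/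
lemma mul_partCount_le {N t w : ℕ} {L : ℝ} (hwt : w ≤ t) (htN : t ≤ N) (hN : 1 ≤ N)
    (hL : Real.exp (growthConst * √N) ≤ Real.exp L * count N)
    (hy : Real.exp (-(decay N * (t - w : ℕ))) ≤ 1 / 6) :
    w * (partCount N t : ℝ) ≤
      count N * (L + 4 * w * Real.exp (-(decay N * (t - w : ℕ)))) := by
  classical
  set y := Real.exp (-(decay N * (t - w : ℕ))) with hy_def
  have hβ := decay_pos hN
  let W : Finset (Fin N × ℤˣ) :=
    Finset.univ.filter fun i => (t - w ≤ (i.1 : ℕ) ∧ (i.1 : ℕ) < t) ∧ i.2 = 1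
  have hW : W.card = w := by
    have h1 : (Finset.Ico (t - w) t).card = w := by rw [Nat.card_Ico]; omega
    conv_rhs => rw [← h1]
    symm
    refine Finset.card_bij (fun k hk => (⟨k, by have := Finset.mem_Ico.mp hk; omega⟩, 1)) ?_ ?_ ?_
    · intro k hk
      simpa [W] using hk
    · intro k _ l _ h
      simpa using h
    · rintro ⟨k, s⟩ hk
      simp only [W, Finset.mem_filter, Finset.mem_univ, true_and] at hk
      exact ⟨k, Finset.mem_Ico.mpr hk.1, by simp [hk.2]⟩
  let Y : SignedType → ℝ := fun μ => ∑ i ∈ W, (μ (i.1, i.2) : ℝ)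
  let e : Fin N × ℤˣ → ℝ := fun i => if i ∈ W then Real.exp 1 else 1
  have hY : ∀ μ : SignedType, μ.size = N →
      Real.exp (Y μ) = ∏ i, e i ^ (multiplicities N μ i : ℕ) := by
    intro μ hμ
    have : ∀ i, e i ^ (multiplicities N μ i : ℕ) =
        if i ∈ W then Real.exp (μ (i.1, i.2)) else 1 := by
      intro i
      rw [multiplicities_val hμ]
      by_cases hi : i ∈ W
      · simp only [e, hi, if_true]
        rw [← Real.exp_nat_mul, mul_one]
      · simp [e, hi]
    simp only [this]
    rw [Finset.prod_ite_mem, Finset.univ_inter, Real.exp_sum]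
  have hfac : ∀ i, ∑ m : Fin (N + 1), (partWeight N i * e i) ^ (m : ℕ) ≤
      1 / (1 - partWeight N i) * (if i ∈ W then Real.exp (4 * y) else 1) := by
    intro i
    have hx0 := partWeight_pos i
    have hx1 := partWeight_lt_one i
    by_cases hi : i ∈ W
    · simp only [e, hi, if_true]
      have hxy : partWeight N i ≤ y := by
        have h1 := (Finset.mem_filter.mp hi).2.1.1
        have h2 : ((t - w : ℕ) : ℝ) ≤ ((i.1 : ℕ) : ℝ) := by exact_mod_cast h1
        rw [partWeight, hy_def]
        refine Real.exp_le_exp.mpr (neg_le_neg ?_)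
        gcongr
        linarith
      have he := Real.exp_one_lt_d9
      have he0 := Real.exp_pos 1
      have h3 : partWeight N i * Real.exp 1 ≤ 1 / 2 := by nlinarith
      refine (sum_pow_fin_le (by positivity) (by linarith) _).trans ?_
      have h4 : 1 + 4 * partWeight N i ≤ Real.exp (4 * y) := by
        have := Real.add_one_le_exp (4 * y); linarith
      have h5 : 1 - partWeight N i ≤ (1 - partWeight N i * Real.exp 1) * (1 + 4 * partWeight N i) := by
        nlinarith
      calc 1 / (1 - partWeight N i * Real.exp 1)
          ≤ 1 / (1 - partWeight N i) * (1 + 4 * partWeight N i) := by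
            rw [div_mul_eq_mul_div, one_mul, div_le_div_iff₀ (by linarith) (by linarith)]
            linarith
        _ ≤ _ := by
            refine mul_le_mul_of_nonneg_left h4 ?_
            rw [one_div_nonneg]; linarith
    · simp only [e, hi, if_false, mul_one]
      exact sum_pow_fin_le hx0.le hx1 _
  have hexp : ∑ μ ∈ ofSize N, Real.exp (Y μ) ≤ Real.exp (L + 4 * w * y) * count N := by
    have h1 : Real.exp (-(decay N * N)) * ∑ μ ∈ ofSize N, Real.exp (Y μ) ≤
        Real.exp (growthConst * √N / 2) * Real.exp (4 * w * y) := by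
      calc _ = ∑ μ ∈ ofSize N, ∏ i, (partWeight N i * e i) ^ (multiplicities N μ i : ℕ) := by
            rw [Finset.mul_sum]
            refine Finset.sum_congr rfl fun μ hμ => ?_
            rw [mem_ofSize] at hμ
            simp only [mul_pow]
            rw [Finset.prod_mul_distrib, prod_partWeight_pow hμ, hY μ hμ]
        _ ≤ ∑ f : Fin N × ℤˣ → Fin (N + 1), ∏ i, (partWeight N i * e i) ^ (f i : ℕ) := by
            refine sum_comp_multiplicities_le (Finset.Subset.refl _) Finset.univ
              (fun _ _ => Finset.mem_univ _)
              (fun f => ∏ i, (partWeight N i * e i) ^ (f i : ℕ))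
              fun f => Finset.prod_nonneg fun i _ => ?_
            have : 0 ≤ e i := by simp only [e]; split_ifs <;> positivity
            have := partWeight_pos i
            positivity
        _ = ∏ i, ∑ m : Fin (N + 1), (partWeight N i * e i) ^ (m : ℕ) := by
            rw [Finset.prod_univ_sum, Fintype.piFinset_univ]
        _ ≤ ∏ i, (1 / (1 - partWeight N i) * (if i ∈ W then Real.exp (4 * y) else 1)) := by
            refine Finset.prod_le_prod (fun i _ => Finset.sum_nonneg fun m _ => ?_)
              fun i _ => hfac i
            have : 0 ≤ e i := by simp only [e]; split_ifs <;> positivity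
            have := partWeight_pos i
            positivity
        _ = (∏ i, 1 / (1 - partWeight N i)) * Real.exp (4 * w * y) := by
            rw [Finset.prod_mul_distrib, Finset.prod_ite_mem, Finset.univ_inter, Finset.prod_const,
              hW, ← Real.exp_nat_mul]
            congr 2; ring
        _ ≤ _ := by gcongr; exact prod_one_div_le hN
    have h2 : ∑ μ ∈ ofSize N, Real.exp (Y μ) =
        Real.exp (decay N * N) * (Real.exp (-(decay N * N)) * ∑ μ ∈ ofSize N, Real.exp (Y μ)) := by
      rw [← mul_assoc, ← Real.exp_add]; simp
    rw [h2]
    calc _ ≤ Real.exp (decay N * N) * (Real.exp (growthConst * √N / 2) * Real.exp (4 * w * y)) := by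
          gcongr
      _ = Real.exp (growthConst * √N) * Real.exp (4 * w * y) := by
          rw [← mul_assoc, ← Real.exp_add, decay_mul_self hN]; congr 2; ring
      _ ≤ Real.exp L * count N * Real.exp (4 * w * y) := by gcongr
      _ = _ := by rw [Real.exp_add]; ring
  have hsum : (∑ μ ∈ ofSize N, Y μ) ≤ count N * (L + 4 * w * y) := by
    set y0 := L + 4 * w * y
    have h1 : ∀ μ ∈ ofSize N, Y μ ≤ y0 - 1 + Real.exp (-y0) * Real.exp (Y μ) := by
      intro μ _
      rw [← Real.exp_add]
      have := Real.add_one_le_exp (-y0 + Y μ)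
      linarith
    refine (Finset.sum_le_sum h1).trans ?_
    rw [Finset.sum_add_distrib, Finset.sum_const, nsmul_eq_mul, ← Finset.mul_sum]
    have h2 : Real.exp (-y0) * ∑ μ ∈ ofSize N, Real.exp (Y μ) ≤ count N := by
      calc _ ≤ Real.exp (-y0) * (Real.exp y0 * count N) := by gcongr
        _ = _ := by rw [← mul_assoc, ← Real.exp_add]; simp
    have h3 : ((ofSize N).card : ℝ) = count N := rfl
    rw [h3]
    linarith
  refine le_trans ?_ hsum
  simp only [Y]
  rw [Finset.sum_comm]
  have h1 : ∀ i ∈ W, (partCount N t : ℝ) ≤ ∑ μ ∈ ofSize N, (μ ((i.1 : ℕ), i.2) : ℝ) := by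
    intro i hi
    have h2 := sum_apply_eq_partCount N (Nat.le_add_left 1 (i.1 : ℕ)) i.2
    rw [Nat.add_sub_cancel] at h2
    rw [← Nat.cast_sum, h2]
    exact_mod_cast partCount_anti N (Finset.mem_filter.mp hi).2.1.2
  refine le_trans (le_of_eq ?_) (Finset.sum_le_sum h1)
  rw [Finset.sum_const, hW, nsmul_eq_mul]

end SignedType

/-- Independent blocks of coordinates: the total weight of the configurations which avoid
prescribed patterns on each of several disjoint blocks. -/
lemma sum_prod_avoiding_blocks_le {ι J K κ : Type*} [Fintype ι] [Fintype J] [Fintype K] [Fintype κ]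
    [DecidableEq ι] [DecidableEq J] [DecidableEq K] [DecidableEq κ]
    (w : ι → κ → ℝ) (hw : ∀ i c, 0 ≤ w i c) (Z : ι → ℝ) (hZ : ∀ i, ∑ c, w i c ≤ Z i)
    (b : J × K → ι) (hb : Function.Injective b) (X : J → Finset (K → κ)) (P : J → ℝ)
    (hP : ∀ j, P j * ∏ l, Z (b (j, l)) ≤ ∑ y ∈ X j, ∏ l, w (b (j, l)) (y l)) :
    ∑ f ∈ Finset.univ.filter (fun f : ι → κ => ∀ j, (fun l => f (b (j, l))) ∉ X j),
      ∏ i, w i (f i) ≤ (∏ i, Z i) * Real.exp (-∑ j, P j) := by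
  classical
  let R : Type _ := ↥(Set.range b)ᶜ
  let e : (J × K) ⊕ R ≃ ι :=
    (Equiv.sumCongr (Equiv.ofInjective b hb) (Equiv.refl _)).trans (Equiv.Set.sumCompl (Set.range b))
  have hel : ∀ x, e (Sum.inl x) = b x := fun _ => rfl
  let E : (J → K → κ) × (R → κ) ≃ (ι → κ) :=
    ((Equiv.prodCongr (Equiv.curry J K κ).symm (Equiv.refl _)).trans
      (Equiv.sumArrowEquivProdArrow (J × K) R κ).symm).trans (Equiv.arrowCongr e (Equiv.refl κ))
  have hE : ∀ g h x, E (g, h) (e x) = Sum.elim (fun a => g a.1 a.2) h x := by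
    intro g h x
    rcases x with x | x <;> simp [E, Equiv.sumArrowEquivProdArrow, Equiv.arrowCongr, Function.uncurry]
  have hZ0 : ∀ i, 0 ≤ Z i := fun i => (Finset.sum_nonneg fun c _ => hw i c).trans (hZ i)
  have hprod : ∀ F : ι → ℝ, ∏ i, F i = (∏ j, ∏ l, F (b (j, l))) * ∏ r : R, F (e (Sum.inr r)) := by
    intro F
    rw [← Equiv.prod_comp e, Fintype.prod_sum_type, Fintype.prod_prod_type]
    simp only [hel]
  have hblock : ∀ j, (∑ y : K → κ, if y ∉ X j then ∏ l, w (b (j, l)) (y l) else 0) ≤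
      (∏ l, Z (b (j, l))) * Real.exp (-P j) := by
    intro j
    have h1 : ∑ y : K → κ, ∏ l, w (b (j, l)) (y l) ≤ ∏ l, Z (b (j, l)) := by
      rw [← Fintype.piFinset_univ, ← Finset.prod_univ_sum]
      exact Finset.prod_le_prod (fun l _ => Finset.sum_nonneg fun c _ => hw _ c) fun l _ => hZ _
    have h2 : (∑ y : K → κ, if y ∉ X j then ∏ l, w (b (j, l)) (y l) else 0) +
        ∑ y ∈ X j, ∏ l, w (b (j, l)) (y l) = ∑ y : K → κ, ∏ l, w (b (j, l)) (y l) := by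
      rw [← Finset.sum_filter, add_comm, ← Finset.sum_filter_add_sum_filter_not Finset.univ (· ∈ X j)]
      simp
    have h3 := Real.add_one_le_exp (-P j)
    have h4 : 0 ≤ ∏ l, Z (b (j, l)) := Finset.prod_nonneg fun l _ => hZ0 _
    have h5 := hP j
    nlinarith
  calc _ = ∑ f : ι → κ, if (∀ j, (fun l => f (b (j, l))) ∉ X j) then ∏ i, w i (f i) else 0 := by
        rw [Finset.sum_filter]
    _ = ∑ x : (J → K → κ) × (R → κ),
        (∏ j, if x.1 j ∉ X j then ∏ l, w (b (j, l)) (x.1 j l) else 0) *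
          ∏ r : R, w (e (Sum.inr r)) (x.2 r) := by
        rw [← Equiv.sum_comp E]
        refine Finset.sum_congr rfl fun ⟨g, h⟩ _ => ?_
        have h1 : ∀ j l, E (g, h) (b (j, l)) = g j l := fun j l => by rw [← hel, hE]; rfl
        have h2 : ∀ r, E (g, h) (e (Sum.inr r)) = h r := fun r => by rw [hE]; rfl
        rw [hprod]
        simp only [h1, h2]
        by_cases hx : ∀ j, g j ∉ X j
        · simp only [hx, not_false_eq_true, implies_true, if_true]
        · rw [if_neg hx]
          push Not at hx
          obtain ⟨j, hj⟩ := hx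
          rw [Finset.prod_eq_zero (Finset.mem_univ j) (by simp [hj]), zero_mul]
    _ = (∏ j, ∑ y : K → κ, if y ∉ X j then ∏ l, w (b (j, l)) (y l) else 0) *
          ∏ r : R, ∑ c, w (e (Sum.inr r)) c := by
        rw [Fintype.sum_prod_type, Finset.prod_univ_sum, Finset.prod_univ_sum, Fintype.piFinset_univ,
          Fintype.piFinset_univ, Finset.sum_mul_sum]
    _ ≤ (∏ j, (∏ l, Z (b (j, l))) * Real.exp (-P j)) * ∏ r : R, Z (e (Sum.inr r)) := by
        refine mul_le_mul (Finset.prod_le_prod (fun j _ => Finset.sum_nonneg fun y _ => ?_)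
          fun j _ => hblock j) (Finset.prod_le_prod (fun r _ => Finset.sum_nonneg fun c _ => hw _ c)
          fun r _ => hZ _) (Finset.prod_nonneg fun r _ => Finset.sum_nonneg fun c _ => hw _ c)
          (Finset.prod_nonneg fun j _ => mul_nonneg (Finset.prod_nonneg fun l _ => hZ0 _)
            (Real.exp_pos _).le)
        split_ifs
        · exact le_refl _
        · exact Finset.prod_nonneg fun l _ => hw _ _
    _ = _ := by
        rw [Finset.prod_mul_distrib, ← Real.exp_sum, Finset.sum_neg_distrib, hprod Z]
        ring

namespace SignedType

/-- The parts of size `m * p ^ l` and sign `+1`. -/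
def primeMultiple (p m l : ℕ) : ℕ × ℤˣ := (m * p ^ l - 1, 1)

lemma primeMultiple_fst_add_one {p m : ℕ} (hp : p.Prime) (hm : Odd m) (l : ℕ) :
    (primeMultiple p m l).1 + 1 = m * p ^ l :=
  Nat.sub_add_cancel (Nat.mul_pos hm.pos (pow_pos hp.pos l))

lemma primeMultiple_injective {p m m' l l' : ℕ} (hp : p.Prime) (hm : Odd m) (hm' : Odd m')
    (hc : m.Coprime p) (hc' : m'.Coprime p) (h : primeMultiple p m l = primeMultiple p m' l') :
    m = m' ∧ l = l' := by
  have h1 := congrArg (fun k => k.1 + 1) h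
  simp only [primeMultiple_fst_add_one hp hm, primeMultiple_fst_add_one hp hm'] at h1
  have h2 : m ∣ m' := (Nat.Coprime.pow_right l' hc).dvd_of_dvd_mul_right (h1 ▸ Dvd.intro _ rfl)
  have h3 : m' ∣ m := (Nat.Coprime.pow_right l hc').dvd_of_dvd_mul_right (h1 ▸ Dvd.intro _ rfl)
  obtain rfl := Nat.dvd_antisymm h2 h3
  exact ⟨rfl, Nat.pow_right_injective hp.two_le (Nat.eq_of_mul_eq_mul_left hm.pos h1)⟩

lemma mergeable_of_sum_eq {p m a n : ℕ} (hp : p.Prime) (hm : Odd m) (hc : m.Coprime p)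
    (hna : n ≤ a) (μ : SignedType)
    (hsum : ∑ l : Fin (n + 1), p ^ (l : ℕ) * μ (primeMultiple p m l) = p ^ a)
    (h0 : μ (primeMultiple p m 0) ≠ 0) : μ.Mergeable p (p ^ a * m) := by
  classical
  refine ⟨m, a, hm, hc, rfl, by simpa [primeMultiple] using h0, ?_⟩
  let S : Finset (ℕ × ℤˣ) := Finset.univ.image fun l : Fin (n + 1) => primeMultiple p m l
  refine ⟨Finsupp.filter (· ∈ S) μ, fun k => ?_, ?_, fun k hk => ?_⟩
  · rw [Finsupp.filter_apply]
    split_ifs <;> simp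
  · have h1 : size (Finsupp.filter (· ∈ S) μ) =
        ∑ k ∈ S, Finsupp.filter (· ∈ S) μ k * (k.1 + 1) :=
      Finsupp.sum_of_support_subset _ (fun k hk => by
        rw [Finsupp.support_filter, Finset.mem_filter] at hk
        exact hk.2) _ (by simp)
    rw [h1, Finset.sum_image fun l _ l' _ h => Fin.ext (primeMultiple_injective hp hm hm hc hc h).2,
      ← hsum, Finset.sum_mul]
    refine Finset.sum_congr rfl fun l _ => ?_
    rw [Finsupp.filter_apply_pos _ _ (Finset.mem_image_of_mem _ (Finset.mem_univ l)),
      primeMultiple_fst_add_one hp hm]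
    ring
  · rw [Finsupp.support_filter, Finset.mem_filter] at hk
    obtain ⟨l, _, rfl⟩ := Finset.mem_image.mp hk.2
    refine ⟨rfl, l, by have := l.2; omega, ?_⟩
    rw [primeMultiple_fst_add_one hp hm, mul_comm]

/-- The multiplicity patterns on sizes `m, m p, …, m p ^ n` with total size `m p ^ a`. -/
def mergePatterns (N p a n : ℕ) : Finset (Fin (n + 1) → Fin (N + 1)) :=
  Finset.univ.filter fun y => ∑ l : Fin (n + 1), p ^ (l : ℕ) * (y l : ℕ) = p ^ a ∧ (y 0 : ℕ) ≠ 0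

lemma le_card_mergePatterns {N p a n : ℕ} (hp : p.Prime) (hna : n ≤ a) (hN : p ^ a ≤ N) :
    ∏ l : Fin n, ((p : ℝ) ^ (a - (l + 1)) / (n + 1)) ≤ ((mergePatterns N p a n).card : ℝ) := by
  let T := Fintype.piFinset fun l : Fin n => Finset.range (p ^ (a - (l + 1)) / (n + 1) + 1)
  have hterm : ∀ x ∈ T, ∀ l : Fin n, (n + 1) * (p ^ ((l : ℕ) + 1) * x l) ≤ p ^ a := by
    intro x hx l
    have h1 := Finset.mem_range.mp (Fintype.mem_piFinset.mp hx l)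
    have h2 : x l * (n + 1) ≤ p ^ (a - (l + 1)) :=
      (Nat.le_div_iff_mul_le n.succ_pos).mp (Nat.lt_succ_iff.mp h1)
    calc (n + 1) * (p ^ ((l : ℕ) + 1) * x l) = p ^ ((l : ℕ) + 1) * (x l * (n + 1)) := by ring
      _ ≤ p ^ ((l : ℕ) + 1) * p ^ (a - (l + 1)) := Nat.mul_le_mul_left _ h2
      _ = p ^ a := by rw [← pow_add]; congr 1; have := l.2; omega
  have hsum : ∀ x ∈ T, ∑ l : Fin n, p ^ ((l : ℕ) + 1) * x l < p ^ a := by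
    intro x hx
    have h1 : (n + 1) * ∑ l : Fin n, p ^ ((l : ℕ) + 1) * x l ≤ n * p ^ a := by
      rw [Finset.mul_sum]
      refine (Finset.sum_le_sum fun l _ => hterm x hx l).trans ?_
      simp
    have h2 : 0 < p ^ a := pow_pos hp.pos a
    by_contra hcon
    push Not at hcon
    have := Nat.mul_le_mul_left (n + 1) hcon
    nlinarith
  have hcard : T.card ≤ (mergePatterns N p a n).card := by
    refine Finset.card_le_card_of_injOn (fun x => Fin.cons
      (Fin.ofNat (N + 1) (p ^ a - ∑ l : Fin n, p ^ ((l : ℕ) + 1) * x l))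
      (fun l => Fin.ofNat (N + 1) (x l))) ?_ ?_
    all_goals
      have hx : ∀ x ∈ T, ∀ l, x l % (N + 1) = x l := fun x hx l => by
        refine Nat.mod_eq_of_lt ?_
        have h1 := hterm x hx l
        have h2 : x l ≤ p ^ ((l : ℕ) + 1) * x l := Nat.le_mul_of_pos_left _ (pow_pos hp.pos _)
        have h3 : p ^ ((l : ℕ) + 1) * x l ≤ (n + 1) * (p ^ ((l : ℕ) + 1) * x l) :=
          Nat.le_mul_of_pos_left _ n.succ_pos
        omega
    · intro x hxT
      have h1 := hsum x hxT
      have h2 : (p ^ a - ∑ l : Fin n, p ^ ((l : ℕ) + 1) * x l) % (N + 1) =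
        p ^ a - ∑ l : Fin n, p ^ ((l : ℕ) + 1) * x l := Nat.mod_eq_of_lt (by omega)
      refine Finset.mem_coe.mpr (Finset.mem_filter.mpr ⟨Finset.mem_univ _, ?_⟩)
      simp only [Fin.sum_univ_succ, Fin.cons_zero, Fin.cons_succ, Fin.val_ofNat, h2, hx x hxT,
        Fin.val_zero, Fin.val_succ, pow_zero, one_mul]
      omega
    · intro x hxT y hyT h
      funext l
      have := congrArg Fin.val (congrFun h l.succ)
      simp only [Fin.cons_succ, Fin.val_ofNat] at this
      rwa [hx x hxT, hx y hyT] at this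
  refine le_trans ?_ (Nat.cast_le.mpr hcard)
  rw [Fintype.card_piFinset, Nat.cast_prod]
  refine Finset.prod_le_prod (fun l _ => by positivity) fun l _ => ?_
  rw [Finset.card_range]
  have := Nat.lt_floor_add_one ((p : ℝ) ^ (a - ((l : ℕ) + 1)) / (n + 1))
  have h2 : ⌊(p : ℝ) ^ (a - ((l : ℕ) + 1)) / (n + 1)⌋₊ = p ^ (a - ((l : ℕ) + 1)) / (n + 1) := by
    have := Nat.floor_div_eq_div (K := ℝ) (p ^ (a - ((l : ℕ) + 1))) (n + 1)
    push_cast at this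
    exact this
  rw [h2] at this
  push_cast
  exact_mod_cast this.le

lemma half_le_one_sub_exp_neg {s : ℝ} (h0 : 0 ≤ s) (h1 : s ≤ 1) : s / 2 ≤ 1 - Real.exp (-s) := by
  have h : Real.exp (-s) * (1 + s) ≤ 1 := by
    have h1 := Real.add_one_le_exp s
    calc Real.exp (-s) * (1 + s) ≤ Real.exp (-s) * Real.exp s := by gcongr; linarith
      _ = 1 := by rw [← Real.exp_add]; simp
  nlinarith [Real.exp_pos (-s)]

/-- A lower bound for the Boltzmann probability that parts of sizes `m, m p, …, m p ^ n` can be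
merged to a part of size `p ^ a m`. -/
noncomputable def mergeProb (N p a n m : ℕ) : ℝ :=
  Real.exp (-(decay N * (p ^ a * m))) * (decay N * m / 2) *
    (decay N * (p ^ a * m) / (2 * (n + 1))) ^ n

lemma card_not_mergeable_le {N p a n : ℕ} (hN : 1 ≤ N) (hp : p.Prime) (hna : n ≤ a) (S : Finset ℕ)
    (hS : ∀ m ∈ S, Odd m ∧ m.Coprime p ∧ p ^ a * m ≤ N ∧ decay N * (m * p ^ n) ≤ 1)
    {T : Finset SignedType} (hT : T ⊆ ofSize N)
    (hbad : ∀ μ ∈ T, ∀ m ∈ S, ¬ μ.Mergeable p (p ^ a * m)) :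
    (T.card : ℝ) ≤ Real.exp (growthConst * √N) * Real.exp (-∑ m ∈ S, mergeProb N p a n m) := by
  classical
  have hβ := decay_pos hN
  have hmp : ∀ m ∈ S, ∀ l : Fin (n + 1), m * p ^ (l : ℕ) ≤ N := fun m hm l => by
    refine le_trans ?_ (hS m hm).2.2.1
    rw [mul_comm]
    exact Nat.mul_le_mul_right _ (Nat.pow_le_pow_right hp.pos (by have := l.2; omega))
  let b : S × Fin (n + 1) → Fin N × ℤˣ := fun x => (⟨(primeMultiple p x.1 x.2).1, by
    have h1 := hmp x.1 x.1.2 x.2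
    have h2 := primeMultiple_fst_add_one hp (hS x.1 x.1.2).1 x.2
    omega⟩, 1)
  have hb : Function.Injective b := by
    rintro ⟨m, l⟩ ⟨m', l'⟩ h
    have h1 : primeMultiple p m l = primeMultiple p m' l' :=
      Prod.ext (congrArg (fun i => (i.1 : ℕ)) h) rfl
    have h2 := primeMultiple_injective hp (hS m m.2).1 (hS m' m'.2).1 (hS m m.2).2.1
      (hS m' m'.2).2.1 h1
    exact Prod.ext (Subtype.ext h2.1) (Fin.ext h2.2)
  have hbw : ∀ m l, partWeight N (b (m, l)) = Real.exp (-(decay N * (m * p ^ (l : ℕ)))) := by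
    intro m l
    have h2 := primeMultiple_fst_add_one hp (hS m m.2).1 l
    have h3 : (((primeMultiple p m l).1 : ℕ) : ℝ) + 1 = m * p ^ (l : ℕ) := by exact_mod_cast h2
    rw [partWeight]
    simp only [b]
    rw [h3]
  have hP : ∀ m : S, mergeProb N p a n m * ∏ l, 1 / (1 - partWeight N (b (m, l))) ≤
      ∑ y ∈ mergePatterns N p a n, ∏ l, partWeight N (b (m, l)) ^ (y l : ℕ) := by
    intro m
    obtain ⟨hodd, hc, hle, hsm⟩ := hS m m.2
    have hm0 : (0 : ℝ) < (m : ℕ) := by exact_mod_cast hodd.pos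
    have hp0 : (1 : ℝ) ≤ p := by exact_mod_cast hp.one_le
    have h1 : ∀ y ∈ mergePatterns N p a n, ∏ l, partWeight N (b (m, l)) ^ (y l : ℕ) =
        Real.exp (-(decay N * (p ^ a * m))) := by
      intro y hy
      have h2 : ∑ l : Fin (n + 1), (p : ℝ) ^ (l : ℕ) * ((y l : ℕ) : ℝ) = p ^ a := by
        exact_mod_cast (Finset.mem_filter.mp hy).2.1
      have h3 : ∀ l : Fin (n + 1), partWeight N (b (m, l)) ^ (y l : ℕ) =
          Real.exp (-(decay N * m) * ((p : ℝ) ^ (l : ℕ) * ((y l : ℕ) : ℝ))) := by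
        intro l
        rw [hbw, ← Real.exp_nat_mul]
        congr 1; ring
      rw [Finset.prod_congr rfl fun l _ => h3 l]
      rw [← Real.exp_sum, ← Finset.mul_sum, h2]
      congr 1; ring
    rw [Finset.sum_congr rfl h1, Finset.sum_const, nsmul_eq_mul, Finset.prod_div_distrib,
      Finset.prod_const_one, mul_one_div]
    have hpos : ∀ l, 0 < 1 - partWeight N (b (m, l)) := fun l => by
      linarith [partWeight_lt_one (b (m, l))]
    rw [div_le_iff₀ (Finset.prod_pos fun l _ => hpos l)]
    have h4 : ∀ l : Fin (n + 1), decay N * m * p ^ (l : ℕ) / 2 ≤ 1 - partWeight N (b (m, l)) := by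
      intro l
      rw [hbw, mul_assoc]
      refine half_le_one_sub_exp_neg (by positivity) (le_trans ?_ hsm)
      gcongr
      have := l.2; omega
    have h5 : p ^ a ≤ N := (Nat.le_mul_of_pos_right _ hodd.pos).trans hle
    have h6 := le_card_mergePatterns hp hna h5
    have h7 : decay N * m / 2 * (decay N * (p ^ a * m) / (2 * (n + 1))) ^ n ≤
        (mergePatterns N p a n).card * ∏ l, (1 - partWeight N (b (m, l))) := by
      calc _ = (∏ l : Fin n, ((p : ℝ) ^ (a - (l + 1)) / (n + 1))) *
            ∏ l : Fin (n + 1), (decay N * m * p ^ (l : ℕ) / 2) := by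
            rw [Fin.prod_univ_succ, mul_left_comm (∏ l : Fin n, _), ← Finset.prod_mul_distrib]
            have h8 : ∀ l : Fin n, (p : ℝ) ^ (a - ((l : ℕ) + 1)) / (n + 1) *
                (decay N * m * p ^ ((l.succ : Fin (n + 1)) : ℕ) / 2) =
                decay N * (p ^ a * m) / (2 * (n + 1)) := by
              intro l
              have : (p : ℝ) ^ a = p ^ (a - ((l : ℕ) + 1)) * p ^ ((l : ℕ) + 1) := by
                rw [← pow_add]; congr 1; have := l.2; omega
              rw [this, Fin.val_succ]
              field_simp
            rw [Finset.prod_congr rfl fun l _ => h8 l]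
            simp only [Fin.val_zero, pow_zero, mul_one, Finset.prod_const, Finset.card_univ,
              Fintype.card_fin]
        _ ≤ _ := by
            refine mul_le_mul h6 (Finset.prod_le_prod (fun l _ => by positivity) fun l _ => h4 l)
              (Finset.prod_nonneg fun l _ => by positivity) (Nat.cast_nonneg _)
    rw [mergeProb]
    calc _ = Real.exp (-(decay N * (p ^ a * m))) *
          (decay N * m / 2 * (decay N * (p ^ a * m) / (2 * (n + 1))) ^ n) := by ring
      _ ≤ Real.exp (-(decay N * (p ^ a * m))) *
          ((mergePatterns N p a n).card * ∏ l, (1 - partWeight N (b (m, l)))) := by gcongr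
      _ = _ := by ring
  have key := sum_prod_avoiding_blocks_le (J := S) (K := Fin (n + 1))
    (fun i (c : Fin (N + 1)) => partWeight N i ^ (c : ℕ))
    (fun i c => by have := partWeight_pos i; positivity) (fun i => 1 / (1 - partWeight N i))
    (fun i => sum_pow_fin_le (partWeight_pos i).le (partWeight_lt_one i) _) b hb
    (fun _ => mergePatterns N p a n) (fun m => mergeProb N p a n m) hP
  have hle := sum_comp_multiplicities_le hT
    (Finset.univ.filter fun f => ∀ j : S, (fun l => f (b (j, l))) ∉ mergePatterns N p a n)
    (fun μ hμ => by
      rw [Finset.mem_filter]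
      refine ⟨Finset.mem_univ _, fun m hmem => hbad μ hμ m m.2 ?_⟩
      have hsz := mem_ofSize.mp (hT hμ)
      obtain ⟨_, h1, h2⟩ := Finset.mem_filter.mp hmem
      simp only [multiplicities_val hsz] at h1 h2
      exact mergeable_of_sum_eq hp (hS m m.2).1 (hS m m.2).2.1 hna μ h1 h2)
    (fun f => ∏ i, partWeight N i ^ (f i : ℕ))
    (fun f => Finset.prod_nonneg fun i _ => by have := partWeight_pos i; positivity)
  rw [Finset.sum_congr rfl fun μ hμ => prod_partWeight_pow (mem_ofSize.mp (hT hμ)),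
    Finset.sum_const, nsmul_eq_mul] at hle
  rw [Finset.sum_coe_sort S (fun m => mergeProb N p a n m)] at key
  have h1 := hle.trans (key.trans (mul_le_mul_of_nonneg_right (prod_one_div_le hN)
    (Real.exp_pos _).le))
  calc (T.card : ℝ) = T.card * Real.exp (-(decay N * N)) * Real.exp (decay N * N) := by
        rw [mul_assoc, ← Real.exp_add]; simp
    _ ≤ Real.exp (growthConst * √N / 2) * Real.exp (-∑ m ∈ S, mergeProb N p a n m) *
        Real.exp (decay N * N) := by gcongr
    _ = _ := by
        rw [mul_right_comm, ← Real.exp_add, decay_mul_self hN, add_halves]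

lemma exists_exp_le_mul_count : ∃ A : ℝ, 0 ≤ A ∧ ∀ N : ℕ, 2 ≤ N →
    Real.exp (growthConst * √N) ≤ Real.exp (A * Real.log N) * count N := by
  obtain ⟨A, c, hc, h⟩ := exists_count_ge
  obtain ⟨B, hB⟩ := pow_unbounded_of_one_lt (1 / c) (one_lt_two : (1 : ℝ) < 2)
  refine ⟨2 * A + B, by positivity, fun N hN => ?_⟩
  have hN' : (2 : ℝ) ≤ N := by exact_mod_cast hN
  have hN0 : (0 : ℝ) < N := by linarith
  have h1 : Real.exp ((2 * A + B) * Real.log N) = ((N : ℝ) ^ 2) ^ A * (N : ℝ) ^ B := by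
    rw [add_mul, Real.exp_add, ← Real.log_pow, Real.exp_log (by positivity), ← pow_mul]
    congr 1
    have : (2 * (A : ℝ)) = ((2 * A : ℕ) : ℝ) := by push_cast; ring
    rw [this, ← Real.log_pow, Real.exp_log (by positivity)]
  rw [h1]
  have h2 : ((N : ℝ) + 1) ^ A ≤ ((N : ℝ) ^ 2) ^ A := by gcongr; nlinarith
  have h3 : 1 / c ≤ (N : ℝ) ^ B := hB.le.trans (by gcongr)
  have h4 := h N
  rw [growth, mul_div_assoc', div_le_iff₀ (by positivity)] at h4
  calc Real.exp (growthConst * √N) = 1 / c * (c * Real.exp (growthConst * √N)) := by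
        field_simp
    _ ≤ (N : ℝ) ^ B * (count N * ((N : ℝ) ^ 2) ^ A) := by
        refine mul_le_mul h3 (h4.trans ?_) (by positivity) (by positivity)
        gcongr
    _ = _ := by ring

lemma decay_anti {M N : ℕ} (hM : 1 ≤ M) (h : M ≤ N) : decay N ≤ decay M := by
  have h1 : (0 : ℝ) < √M := Real.sqrt_pos.mpr (by exact_mod_cast hM)
  have := growthConst_pos
  rw [decay, decay]
  gcongr

/-- Parts of at least this size are rare enough in a typical signed type of size `N`. -/
noncomputable def rareSize (N : ℕ) : ℕ :=
  (⌈√N⌉₊ + ⌈√N * Real.log N / growthConst⌉₊) +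
    (⌈√N⌉₊ + ⌈6 * √N * Real.log (Real.log N) / growthConst⌉₊)

lemma sqrt_le_rareSize (N : ℕ) : √N ≤ rareSize N := by
  have := Nat.le_ceil √(N : ℝ)
  refine this.trans (Nat.cast_le.mpr ?_)
  rw [rareSize]
  omega

lemma half_log_le_decay_mul_rareSize {N : ℕ} (hN : 1 ≤ N) :
    Real.log N / 2 ≤ decay N * rareSize N := by
  have hx : (0 : ℝ) < √N := Real.sqrt_pos.mpr (by exact_mod_cast hN)
  have hβ := decay_pos hN
  have hC := growthConst_pos
  calc Real.log N / 2 = decay N * (√N * Real.log N / growthConst) := by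
        rw [decay]; field_simp
    _ ≤ decay N * rareSize N := by
        refine mul_le_mul_of_nonneg_left ((Nat.le_ceil _).trans (Nat.cast_le.mpr ?_)) hβ.le
        rw [rareSize]
        omega

lemma decay_mul_rareSize_le {N : ℕ} (hN : 36 ≤ N) (hl : 1 ≤ Real.log N) :
    decay N * (rareSize N + √N) ≤ Real.log N / 2 + 3 * Real.log (Real.log N) + 8 := by
  have hx : (6 : ℝ) ≤ √N := Real.le_sqrt_of_sq_le (by norm_num; exact_mod_cast hN)
  have hC := growthConst_bounds
  have hC0 := growthConst_pos
  have hll := Real.log_nonneg hl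
  have h1 := (Nat.ceil_lt_add_one (Real.sqrt_nonneg N)).le
  have h2 := (Nat.ceil_lt_add_one (a := √N * Real.log N / growthConst) (by positivity)).le
  have h3 := (Nat.ceil_lt_add_one
    (a := 6 * √N * Real.log (Real.log N) / growthConst) (by positivity)).le
  rw [rareSize, decay, div_mul_eq_mul_div, div_le_iff₀ (by positivity)]
  push_cast
  have h4 : growthConst * ((⌈√N⌉₊ + ⌈√N * Real.log N / growthConst⌉₊) +
      (⌈√N⌉₊ + ⌈6 * √N * Real.log (Real.log N) / growthConst⌉₊) + √N) ≤
      growthConst * (((√N + 1) + (√N * Real.log N / growthConst + 1)) +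
      ((√N + 1) + (6 * √N * Real.log (Real.log N) / growthConst + 1)) + √N) := by gcongr
  have h5 : growthConst * (((√N + 1) + (√N * Real.log N / growthConst + 1)) +
      ((√N + 1) + (6 * √N * Real.log (Real.log N) / growthConst + 1)) + √N) =
      growthConst * (3 * √N + 4) + √N * Real.log N + 6 * √N * Real.log (Real.log N) := by
    field_simp; ring
  nlinarith

lemma mul_le_of_weighted_le {w y c d a a' q : ℝ} (hw : 0 < w) (hy : 0 ≤ y) (hc : 0 ≤ c)
    (h : w * d ≤ c * (a + 4 * w * q)) (ha : y * a ≤ a' * w) (hq : y * q ≤ 1) :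
    y * d ≤ c * (a' + 4) := by
  refine le_of_mul_le_mul_left ?_ hw
  calc w * (y * d) = y * (w * d) := by ring
    _ ≤ y * (c * (a + 4 * w * q)) := by gcongr
    _ = c * (y * a + 4 * w * (y * q)) := by ring
    _ ≤ c * (a' * w + 4 * w * 1) := by gcongr
    _ = _ := by ring

lemma partCount_le_of_rareSize_le {A : ℝ} (hA : 0 ≤ A)
    (hcount : ∀ N : ℕ, 2 ≤ N →
      Real.exp (growthConst * √N) ≤ Real.exp (A * Real.log N) * count N)
    {N t : ℕ} (hN : 36 ≤ N) (hl : 2 ≤ Real.log N) (hlx : Real.log N ^ 4 ≤ √N)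
    (hrare : rareSize N ≤ N) (ht : rareSize N ≤ t) :
    √N * Real.log N ^ 2 * partCount N t ≤ (A + 4) ^ 2 * count N := by
  have hx : (6 : ℝ) ≤ √N := Real.le_sqrt_of_sq_le (by norm_num; exact_mod_cast hN)
  have hC0 := growthConst_pos
  have hll := Real.log_nonneg (one_le_two.trans hl)
  have hN0 : (0 : ℝ) < N := by positivity
  set x := √N with hxdef
  set ℓ := Real.log N with hℓ
  set w := ⌈x⌉₊ with hw
  set u := ⌈x * ℓ / growthConst⌉₊ with hu
  set v := ⌈6 * x * Real.log ℓ / growthConst⌉₊ with hv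
  have hwx : x ≤ w := Nat.le_ceil x
  have hw6 : 6 ≤ w := by exact_mod_cast hx.trans hwx
  have hr : rareSize N = (w + u) + (w + v) := rfl
  have hd : decay N = growthConst / (2 * x) := rfl
  have hdu : ℓ / 2 ≤ decay N * u := by
    have h1 := Nat.le_ceil (x * ℓ / growthConst)
    calc ℓ / 2 = decay N * (x * ℓ / growthConst) := by rw [hd]; field_simp
      _ ≤ decay N * u := by have := decay_pos (n := N) (by omega); gcongr
  have hdv : 3 * Real.log ℓ ≤ decay N * v := by
    have h1 := Nat.le_ceil (6 * x * Real.log ℓ / growthConst)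
    calc 3 * Real.log ℓ = decay N * (6 * x * Real.log ℓ / growthConst) := by
          rw [hd]; field_simp; ring
      _ ≤ decay N * v := by have := decay_pos (n := N) (by omega); gcongr
  have hexp1 : Real.exp (-(ℓ / 2)) = 1 / x := by
    rw [Real.exp_neg, hℓ, ← Real.log_sqrt hN0.le, Real.exp_log (by positivity), one_div]
  have hexp2 : Real.exp (-(3 * Real.log ℓ)) = 1 / ℓ ^ 3 := by
    have : 3 * Real.log ℓ = Real.log (ℓ ^ 3) := by rw [Real.log_pow]; norm_num
    rw [this, Real.exp_neg, Real.exp_log (by positivity), one_div]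
  -- the first shift
  have hsN : w + v ≤ N := by omega
  have hN'2 : 2 ≤ N - (w + v) := by omega
  have step1 : x * partCount (N - (w + v)) (w + u) ≤ count (N - (w + v)) * ((A + 4) * ℓ) := by
    have hβ : decay N ≤ decay (N - (w + v)) := decay_anti (by omega) (Nat.sub_le _ _)
    have hq : Real.exp (-(decay (N - (w + v)) * ((w + u - w : ℕ) : ℝ))) ≤ 1 / x := by
      rw [← hexp1, Nat.add_sub_cancel_left]
      have : decay N * u ≤ decay (N - (w + v)) * u := by gcongr
      exact Real.exp_le_exp.mpr (by linarith)
    have hL : Real.exp (growthConst * √((N - (w + v) : ℕ) : ℝ)) ≤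
        Real.exp (A * ℓ) * count (N - (w + v)) := by
      refine (hcount _ hN'2).trans ?_
      have hpos : (0 : ℝ) < ((N - (w + v) : ℕ) : ℝ) := by
        exact_mod_cast (by omega : 0 < N - (w + v))
      have hle : Real.log ((N - (w + v) : ℕ) : ℝ) ≤ ℓ :=
        Real.log_le_log hpos (by exact_mod_cast Nat.sub_le _ _)
      gcongr
    have h := mul_partCount_le (N := N - (w + v)) (t := w + u) (w := w) (Nat.le_add_right _ _)
      (by omega) (by omega) hL (hq.trans (by
        rw [div_le_div_iff₀ (by positivity) (by norm_num)]; linarith))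
    refine (mul_le_of_weighted_le (by positivity) (by positivity) (by positivity) h
      (a' := A * ℓ) ?_ ?_).trans ?_
    · rw [mul_comm x]
      gcongr
    · exact (mul_le_mul_of_nonneg_left hq (by positivity)).trans
        (by rw [mul_one_div_cancel (by positivity)])
    · gcongr
      linarith
  have step2 : ℓ ^ 3 * partCount N (w + v) ≤ count N * (A + 4) := by
    have hq : Real.exp (-(decay N * ((w + v - w : ℕ) : ℝ))) ≤ 1 / ℓ ^ 3 := by
      rw [← hexp2, Nat.add_sub_cancel_left]
      exact Real.exp_le_exp.mpr (by linarith)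
    have h := mul_partCount_le (N := N) (t := w + v) (w := w) (Nat.le_add_right _ _)
      hsN (by omega) (hcount N (by omega)) (hq.trans (by
        rw [div_le_div_iff₀ (by positivity) (by norm_num)]
        have : (2 : ℝ) ^ 3 ≤ ℓ ^ 3 := by gcongr
        linarith))
    refine mul_le_of_weighted_le (by positivity) (by positivity) (by positivity) h ?_ ?_
    · calc ℓ ^ 3 * (A * ℓ) = A * ℓ ^ 4 := by ring
        _ ≤ A * w := by have := hlx.trans hwx; gcongr
    · exact (mul_le_mul_of_nonneg_left hq (by positivity)).trans
        (by rw [mul_one_div_cancel (by positivity)])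
  have h1 : partCount N t ≤ partCount (N - (w + v)) (w + u) :=
    (partCount_anti N (by omega)).trans (partCount_add_le (by omega) hsN)
  have h2 : count (N - (w + v)) ≤ partCount N (w + v) :=
    count_sub_le_partCount (by omega) hsN
  have h1' : (partCount N t : ℝ) ≤ partCount (N - (w + v)) (w + u) := by exact_mod_cast h1
  have h2' : (count (N - (w + v)) : ℝ) ≤ partCount N (w + v) := by exact_mod_cast h2
  have hℓ0 : (0 : ℝ) < ℓ := by linarith
  refine le_of_mul_le_mul_right ?_ hℓ0
  calc x * ℓ ^ 2 * partCount N t * ℓ = ℓ ^ 3 * (x * partCount N t) := by ring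
    _ ≤ ℓ ^ 3 * (x * partCount (N - (w + v)) (w + u)) := by gcongr
    _ ≤ ℓ ^ 3 * (count (N - (w + v)) * ((A + 4) * ℓ)) := by gcongr
    _ ≤ ℓ ^ 3 * (partCount N (w + v) * ((A + 4) * ℓ)) := by gcongr
    _ = ℓ ^ 3 * partCount N (w + v) * ((A + 4) * ℓ) := by ring
    _ ≤ count N * (A + 4) * ((A + 4) * ℓ) := by gcongr
    _ = _ := by ring

end SignedType

lemma exists_progression {p P M : ℕ} {x : ℝ} (hp : 1 ≤ p) (hP : 1 ≤ P) (hx : 8 * p * P ≤ x) :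
    ∃ S : Finset ℕ, (∀ m ∈ S, Odd m ∧ m.Coprime p ∧ M ≤ P * m ∧ ((P * m : ℕ) : ℝ) ≤ M + x) ∧
      x / (4 * p * P) ≤ S.card := by
  have hp0 : (0 : ℝ) < p := by exact_mod_cast hp
  have hP0 : (0 : ℝ) < P := by exact_mod_cast hP
  set d := 2 * p * P with hd
  have hd0 : (0 : ℝ) < d := by rw [hd]; positivity
  have hdc : (d : ℝ) = 2 * p * P := by rw [hd]; push_cast; ring
  set j₀ := M / d + 1 with hj
  have hPd : P ≤ d := by rw [hd]; nlinarith
  have h1 : M ≤ d * j₀ := by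
    rw [hj]; exact (Nat.lt_mul_div_succ M (by exact_mod_cast hd0)).le
  have h2 : d * j₀ ≤ M + d := by
    rw [hj, mul_add, mul_one]; have := Nat.mul_div_le M d; omega
  have hfl : 0 ≤ x / d := div_nonneg (le_trans (by positivity) hx) hd0.le
  refine ⟨(Finset.range (⌊x / d⌋₊ - 1)).image fun j => 2 * p * (j₀ + j) + 1, ?_, ?_⟩
  · intro m hm
    obtain ⟨j, hj', rfl⟩ := Finset.mem_image.mp hm
    have hj' := Finset.mem_range.mp hj'
    have h3 : P * (2 * p * (j₀ + j) + 1) = d * j₀ + d * j + P := by rw [hd]; ring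
    refine ⟨⟨p * (j₀ + j), by ring⟩, ?_, ?_, ?_⟩
    · have : 2 * p * (j₀ + j) + 1 = 1 + p * (2 * (j₀ + j)) := by ring
      rw [this]
      simp
    · rw [h3]; omega
    · have h4 : d * j₀ + d * j + P ≤ M + d * ⌊x / d⌋₊ := by
        have : d * (j + 2) ≤ d * ⌊x / d⌋₊ := Nat.mul_le_mul_left _ (by omega)
        nlinarith
      have h5 : (d : ℝ) * ⌊x / d⌋₊ ≤ x := by
        calc (d : ℝ) * ⌊x / d⌋₊ ≤ d * (x / d) := by gcongr; exact Nat.floor_le hfl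
          _ = x := by field_simp
      rw [h3]
      have h6 : ((d * j₀ + d * j + P : ℕ) : ℝ) ≤ ((M + d * ⌊x / d⌋₊ : ℕ) : ℝ) := by
        exact_mod_cast h4
      push_cast at h6 ⊢
      linarith
  · rw [Finset.card_image_of_injective _ fun i j h => by
      have h' : 2 * p * (j₀ + i) = 2 * p * (j₀ + j) := Nat.succ_injective h
      have := Nat.eq_of_mul_eq_mul_left (by omega) h'
      omega, Finset.card_range]
    have h3 := Nat.lt_floor_add_one (x / d)
    have h4 : 4 ≤ x / d := by rw [le_div_iff₀ hd0, hdc]; linarith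
    have h5 : x / (4 * p * P) = x / d / 2 := by rw [hdc]; field_simp; norm_num
    have h6 : 1 ≤ ⌊x / d⌋₊ := Nat.le_floor (by push_cast; linarith)
    rw [h5]
    push_cast [Nat.cast_sub h6]
    linarith

namespace SignedType

lemma le_sum_mergeProb {N p a : ℕ} {S : Finset ℕ} (hN : 1 ≤ N) (hp : 1 ≤ p)
    (hl : 1 ≤ Real.log N) (hpa : (p : ℝ) ^ a ≤ p ^ 7 * Real.log N)
    (hlow : ∀ m ∈ S, Real.log N / 2 ≤ decay N * (p ^ a * m))
    (hupp : ∀ m ∈ S, decay N * (p ^ a * m) ≤ Real.log N / 2 + 3 * Real.log (Real.log N) + 8)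
    (hcard : √N / (4 * p * p ^ a) ≤ S.card) :
    Real.log N ^ 2 * (Real.exp (-8) / (16 * p ^ 15 * 28 ^ 6)) ≤ ∑ m ∈ S, mergeProb N p a 6 m := by
  have hN0 : (0 : ℝ) < N := by exact_mod_cast hN
  have hx : 0 < √(N : ℝ) := Real.sqrt_pos.mpr hN0
  have hp0 : (0 : ℝ) < p := by exact_mod_cast hp
  have hl0 : 0 < Real.log N := by linarith
  set x := √(N : ℝ)
  set ℓ := Real.log N with hℓ
  have hexp : Real.exp (-(ℓ / 2 + 3 * Real.log ℓ + 8)) = 1 / x * (1 / ℓ ^ 3) * Real.exp (-8) := by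
    have h1 : ℓ / 2 = Real.log x := (Real.log_sqrt hN0.le).symm
    have h2 : 3 * Real.log ℓ = Real.log (ℓ ^ 3) := by rw [Real.log_pow]; norm_num
    rw [neg_add, neg_add, Real.exp_add, Real.exp_add, h1, h2, Real.exp_neg, Real.exp_neg,
      Real.exp_log hx, Real.exp_log (by positivity), one_div, one_div]
  have hβ := decay_pos hN
  have hterm : ∀ m ∈ S, 1 / x * (1 / ℓ ^ 3) * Real.exp (-8) * (ℓ / (4 * p ^ a)) * (ℓ / 28) ^ 6 ≤
      mergeProb N p a 6 m := by
    intro m hm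
    have h1 := hlow m hm
    rw [mergeProb, ← hexp]
    have h2 : ℓ / (4 * p ^ a) ≤ decay N * m / 2 := by
      rw [div_le_iff₀ (by positivity)]
      linarith
    have h3 : ℓ / 28 ≤ decay N * (p ^ a * m) / (2 * ((6 : ℕ) + 1)) := by
      push_cast
      rw [le_div_iff₀ (by norm_num)]
      linarith
    have h4 := hupp m hm
    gcongr
  refine le_trans ?_ (Finset.sum_le_sum hterm)
  rw [Finset.sum_const, nsmul_eq_mul]
  refine le_trans ?_ (mul_le_mul_of_nonneg_right hcard (by positivity))
  have h5 : ((p : ℝ) ^ a) ^ 2 ≤ (p ^ 7 * ℓ) ^ 2 := by gcongr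
  have h6 : x / (4 * p * p ^ a) * (1 / x * (1 / ℓ ^ 3) * Real.exp (-8) * (ℓ / (4 * p ^ a)) *
      (ℓ / 28) ^ 6) = ℓ ^ 4 * (Real.exp (-8) / (16 * p * ((p : ℝ) ^ a) ^ 2 * 28 ^ 6)) := by
    field_simp; ring
  rw [h6]
  calc ℓ ^ 2 * (Real.exp (-8) / (16 * p ^ 15 * 28 ^ 6)) =
        ℓ ^ 4 * (Real.exp (-8) / (16 * p * (p ^ 7 * ℓ) ^ 2 * 28 ^ 6)) := by field_simp
    _ ≤ _ := by gcongr

/-- For large `N` there is a set of part sizes that are rare in signed types of size `N`, but at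
least one of which can almost always be obtained by merging equal parts. -/
lemma eventually_exists_sizes {p : ℕ} (hp : p.Prime) : ∃ D : ℝ, ∀ᶠ N : ℕ in atTop,
    ∃ R : Finset ℕ, (∀ t ∈ R, 2 ≤ t ∧ t < N) ∧
      (∀ t ∈ R, Real.log N * (4 * t * partCount N t) ≤ D * count N) ∧
      ∀ T ⊆ ofSize N, (∀ μ ∈ T, ∀ t ∈ R, ¬ μ.Mergeable p t) → (N : ℝ) * T.card ≤ count N := by
  obtain ⟨A, hA, hcount⟩ := exists_exp_le_mul_count
  set κ : ℝ := Real.exp (-8) / (16 * p ^ 15 * 28 ^ 6) with hκ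
  have hp0 : (0 : ℝ) < p := by exact_mod_cast hp.pos
  have hκ0 : 0 < κ := by positivity
  refine ⟨4 * (A + 4) ^ 2, ?_⟩
  have hlog : Tendsto (fun N : ℕ => Real.log N) atTop atTop :=
    Real.tendsto_log_atTop.comp tendsto_natCast_atTop_atTop
  have e1 : ∀ᶠ N : ℕ in atTop, Real.log N ^ 4 ≤ √N := by
    filter_upwards [tendsto_natCast_atTop_atTop.eventually
      ((Real.isLittleO_pow_log_id_atTop (n := 8)).bound one_pos)] with N h
    refine Real.le_sqrt_of_sq_le ?_
    rw [← pow_mul]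
    simpa using (le_abs_self _).trans h
  have e2 : ∀ᶠ N : ℕ in atTop, 8 * p * (p ^ 7 * Real.log N) ≤ √N := by
    have hc : (0 : ℝ) < 1 / (8 * p * p ^ 7) ^ 2 := by positivity
    filter_upwards [tendsto_natCast_atTop_atTop.eventually
      ((Real.isLittleO_pow_log_id_atTop (n := 2)).bound hc)] with N h
    refine Real.le_sqrt_of_sq_le ?_
    have h' : Real.log N ^ 2 ≤ 1 / (8 * p * p ^ 7) ^ 2 * N := by
      simpa using (le_abs_self _).trans h
    rw [← mul_assoc, mul_pow]
    rwa [one_div, inv_mul_eq_div, le_div_iff₀' (by positivity)] at h'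
  have e3 : ∀ᶠ N : ℕ in atTop, 3 * Real.log (Real.log N) + 8 ≤ Real.log N / 2 := by
    have h : ∀ᶠ y : ℝ in atTop, 3 * Real.log y + 8 ≤ y / 2 := by
      filter_upwards [Real.isLittleO_log_id_atTop.bound (by norm_num : (0 : ℝ) < 1 / 12),
        eventually_ge_atTop 32] with y hy hy'
      have : Real.log y ≤ 1 / 12 * y := by
        refine (le_abs_self _).trans (hy.trans_eq ?_)
        rw [id, Real.norm_of_nonneg (by linarith)]
      linarith
    exact hlog.eventually h
  have e4 : ∀ᶠ N : ℕ in atTop, (A + 1) ≤ Real.log N * κ :=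
    (hlog.atTop_mul_const hκ0).eventually_ge_atTop _
  filter_upwards [e1, e2, e3, e4, eventually_ge_atTop 36, hlog.eventually_ge_atTop 2]
    with N h1 h2 h3 h4 hN hl
  have hN0 : (0 : ℝ) < N := by positivity
  have hx6 : (6 : ℝ) ≤ √N := Real.le_sqrt_of_sq_le (by norm_num; exact_mod_cast hN)
  have hxx : √(N : ℝ) * √N = N := Real.mul_self_sqrt hN0.le
  have hβ := decay_pos (n := N) (by omega)
  have hC := growthConst_bounds
  have hrs := decay_mul_rareSize_le hN (by linarith)
  have hlx : Real.log N < √N := by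
    refine lt_of_lt_of_le ?_ h1
    nlinarith [pow_le_pow_left₀ (by norm_num) hl 3]
  -- sizes with small decay exponent
  have hsize : ∀ t : ℝ, decay N * t ≤ Real.log N → t ≤ √N * Real.log N := by
    intro t ht
    rw [decay, div_mul_eq_mul_div, div_le_iff₀ (by positivity)] at ht
    by_cases ht0 : 0 ≤ t
    · nlinarith
    · have : 0 ≤ √(N : ℝ) * Real.log N := by positivity
      linarith
  have hwin : rareSize N + √N ≤ √N * Real.log N := hsize _ (by linarith)
  have hltN : √(N : ℝ) * Real.log N < N := by
    calc √(N : ℝ) * Real.log N < √N * √N := by gcongr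
      _ = N := hxx
  have hrN : rareSize N ≤ N := by
    have : (rareSize N : ℝ) ≤ N := by linarith
    exact_mod_cast this
  obtain ⟨k, hk1, hk2⟩ := exists_nat_pow_near (by linarith : 1 ≤ Real.log N)
    (by exact_mod_cast hp.one_lt : (1 : ℝ) < p)
  obtain ⟨a, ha⟩ : ∃ a, a = k + 7 := ⟨_, rfl⟩
  have hpa1 : (p : ℝ) ^ a ≤ p ^ 7 * Real.log N := by
    rw [ha, pow_add, mul_comm]; gcongr
  have hpa2 : p ^ 6 * Real.log N ≤ (p : ℝ) ^ a := by
    rw [ha, show k + 7 = 6 + (k + 1) by ring, pow_add]; gcongr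
  obtain ⟨S, hS, hcard⟩ := exists_progression (M := rareSize N) (x := √N) hp.one_le
    (Nat.one_le_pow a p hp.pos) (le_trans (by push_cast; gcongr) h2)
  push_cast at hS hcard
  have hup : ∀ m ∈ S, decay N * (p ^ a * m) ≤
      Real.log N / 2 + 3 * Real.log (Real.log N) + 8 := fun m hm =>
    le_trans (by gcongr; exact (hS m hm).2.2.2) hrs
  have hlo : ∀ m ∈ S, Real.log N / 2 ≤ decay N * (p ^ a * m) := fun m hm => by
    have h5 : (rareSize N : ℝ) ≤ p ^ a * m := by exact_mod_cast (hS m hm).2.2.1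
    exact (half_log_le_decay_mul_rareSize (by omega)).trans (mul_le_mul_of_nonneg_left h5 hβ.le)
  have htN : ∀ m ∈ S, p ^ a * m < N := fun m hm => by
    have := hsize _ ((hup m hm).trans (by linarith))
    have : ((p : ℝ) ^ a * m) < N := by linarith
    exact_mod_cast this
  refine ⟨S.image fun m => p ^ a * m, ?_, ?_, ?_⟩
  · intro t ht
    obtain ⟨m, hm, rfl⟩ := Finset.mem_image.mp ht
    refine ⟨le_trans ?_ (hS m hm).2.2.1, htN m hm⟩
    have h5 : (2 : ℝ) ≤ rareSize N := by linarith [sqrt_le_rareSize N]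
    exact_mod_cast h5
  · intro t ht
    obtain ⟨m, hm, rfl⟩ := Finset.mem_image.mp ht
    have h5 := partCount_le_of_rareSize_le hA hcount hN hl h1 hrN (hS m hm).2.2.1
    have h6 := hsize _ ((hup m hm).trans (by linarith))
    push_cast
    calc Real.log N * (4 * (p ^ a * m) * partCount N (p ^ a * m)) ≤
          Real.log N * (4 * (√N * Real.log N) * partCount N (p ^ a * m)) := by gcongr
      _ = 4 * (√N * Real.log N ^ 2 * partCount N (p ^ a * m)) := by ring
      _ ≤ _ := by linarith
  · intro T hT hbad
    have h5 := card_not_mergeable_le (N := N) (p := p) (a := a) (n := 6) (by omega) hp (by omega)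
      S (fun m hm => ⟨(hS m hm).1, (hS m hm).2.1, (htN m hm).le, ?_⟩) hT
      (fun μ hμ m hm => hbad μ hμ _ (Finset.mem_image_of_mem _ hm))
    · have h6 := le_sum_mergeProb (by omega) hp.one_le (by linarith) hpa1 hlo hup hcard
      have h7 : (A + 1) * Real.log N ≤ Real.log N ^ 2 * κ := by nlinarith
      have h8 := hcount N (by omega)
      calc (N : ℝ) * T.card ≤ N * (Real.exp (growthConst * √N) *
            Real.exp (-((A + 1) * Real.log N))) := by
            refine mul_le_mul_of_nonneg_left (h5.trans ?_) hN0.le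
            gcongr
            exact h7.trans h6
        _ ≤ N * (Real.exp (A * Real.log N) * count N * Real.exp (-((A + 1) * Real.log N))) := by
            gcongr
        _ = count N * (Real.exp (Real.log N) * Real.exp (A * Real.log N) *
            Real.exp (-((A + 1) * Real.log N))) := by rw [Real.exp_log hN0]; ring
        _ = count N := by
            rw [← Real.exp_add, ← Real.exp_add]
            ring_nf
            simp
    · have h6 := (hup m hm).trans (by linarith : _ ≤ Real.log N)
      have h7 : 0 < Real.log N := by linarith
      refine le_of_mul_le_mul_right ?_ h7
      calc decay N * (m * p ^ 6) * Real.log N = decay N * m * (p ^ 6 * Real.log N) := by ring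
        _ ≤ decay N * m * p ^ a := by gcongr
        _ = decay N * (p ^ a * m) := by ring
        _ ≤ _ := by linarith

end SignedType

lemma card_not_entryDivisible_le_mul {p N : ℕ} {D : ℝ} (hp : p.Prime) (hD : 0 ≤ D) (hN : 2 ≤ N)
    {R : Finset ℕ} (hR : ∀ t ∈ R, 2 ≤ t ∧ t < N)
    (hpart : ∀ t ∈ R, Real.log N * (4 * t * SignedType.partCount N t) ≤ D * SignedType.count N)
    (hmerge : ∀ T ⊆ SignedType.ofSize N, (∀ μ ∈ T, ∀ t ∈ R, ¬ SignedType.Mergeable p t μ) →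
      (N : ℝ) * T.card ≤ SignedType.count N) :
    (Nat.card {e : IrrChar (WeylD N) × ConjClasses (WeylD N) //
        ¬ EntryDivisible p e.1 e.2} : ℝ) ≤
      (2 * D * (Real.log N)⁻¹ + 4 * (N : ℝ)⁻¹) *
        (Nat.card (IrrChar (WeylD N)) * Nat.card (ConjClasses (WeylD N))) := by
  classical
  set M := R.sup fun t => 4 * t * SignedType.partCount N t with hM
  have h := HyperoctahedralGroup.card_not_entryDivisible_le hp R hR (SignedType.ofSize N)
    (fun μ hμ => SignedType.mem_ofSize.mpr hμ) M fun t ht => by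
      rw [SignedType.sum_apply_eq_partCount N (by have := (hR t ht).1; omega)]
      exact Finset.le_sup (f := fun t => 4 * t * SignedType.partCount N t) ht
  set B := ((SignedType.ofSize N).filter fun μ => ∀ t ∈ R, ¬ μ.Mergeable p t).card
  have hB : (N : ℝ) * B ≤ SignedType.count N :=
    hmerge _ (Finset.filter_subset _ _) fun μ hμ => (Finset.mem_filter.mp hμ).2
  have hlog : 0 < Real.log N := Real.log_pos (by exact_mod_cast hN)
  have hN0 : (0 : ℝ) < N := by positivity
  have hMle : Real.log N * M ≤ D * SignedType.count N := by
    rcases R.eq_empty_or_nonempty with hRe | hRe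
    · rw [hM, hRe, Finset.sup_empty]
      simp only [bot_eq_zero, Nat.cast_zero, mul_zero]
      positivity
    · obtain ⟨t, ht, htM⟩ := Finset.exists_mem_eq_sup R hRe
        fun t => 4 * t * SignedType.partCount N t
      rw [hM, htM]
      push_cast
      exact hpart t ht
  have hk : SignedType.count N ≤ 2 * Nat.card (ConjClasses (WeylD N)) :=
    HyperoctahedralGroup.card_le_two_mul_card_conjClasses _ fun μ hμ => SignedType.mem_ofSize.mp hμ
  have hI : Nat.card (ConjClasses (WeylD N)) ≤ Nat.card (IrrChar (WeylD N)) :=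
    IrrChar.card_conjClasses_le
  have hk' : (SignedType.count N : ℝ) ≤ 2 * Nat.card (ConjClasses (WeylD N)) := by
    exact_mod_cast hk
  have hI' : (SignedType.count N : ℝ) ≤ 2 * Nat.card (IrrChar (WeylD N)) := by
    exact_mod_cast hk.trans (Nat.mul_le_mul_left 2 hI)
  have h' : (Nat.card {e : IrrChar (WeylD N) × ConjClasses (WeylD N) //
      ¬ EntryDivisible p e.1 e.2} : ℝ) ≤ Nat.card (ConjClasses (WeylD N)) * M +
        2 * B * Nat.card (IrrChar (WeylD N)) := by exact_mod_cast h
  set k : ℝ := (Nat.card (ConjClasses (WeylD N)) : ℝ)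
  set I : ℝ := (Nat.card (IrrChar (WeylD N)) : ℝ)
  have hM2 : (M : ℝ) ≤ (Real.log N)⁻¹ * (D * (2 * I)) := by
    rw [← div_eq_inv_mul, le_div_iff₀' hlog]
    exact hMle.trans (by gcongr)
  have hB2 : (B : ℝ) ≤ (N : ℝ)⁻¹ * (2 * k) := by
    rw [← div_eq_inv_mul, le_div_iff₀' hN0]
    exact hB.trans hk'
  calc _ ≤ k * M + 2 * B * I := h'
    _ ≤ k * ((Real.log N)⁻¹ * (D * (2 * I))) + 2 * ((N : ℝ)⁻¹ * (2 * k)) * I := by gcongr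
    _ = _ := by ring

/-- For every prime `p`, the proportion of entries in the character table
of the Weyl group `D_N` of type `D` that are divisible by `p` tends to `1` as `N → ∞`. -/
theorem weylD_character_table_mostly_divisible (p : ℕ) (hp : p.Prime) :
    Tendsto
      (fun N : ℕ =>
        (Nat.card { e : IrrChar (WeylD N) × ConjClasses (WeylD N) //
            EntryDivisible p e.1 e.2 } : ℝ) /
          ((Nat.card (IrrChar (WeylD N)) : ℝ) * (Nat.card (ConjClasses (WeylD N)) : ℝ)))
      atTop (nhds 1) := by
  obtain ⟨D, hD⟩ := SignedType.eventually_exists_sizes hp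
  have hlim : Tendsto (fun N : ℕ => 1 - (2 * max D 0 * (Real.log N)⁻¹ + 4 * (N : ℝ)⁻¹)) atTop
      (nhds 1) := by
    have h1 : Tendsto (fun N : ℕ => (Real.log N)⁻¹) atTop (nhds 0) :=
      (Real.tendsto_log_atTop.comp tendsto_natCast_atTop_atTop).inv_tendsto_atTop
    have h2 : Tendsto (fun N : ℕ => (N : ℝ)⁻¹) atTop (nhds 0) :=
      tendsto_natCast_atTop_atTop.inv_tendsto_atTop
    simpa using ((h1.const_mul (2 * max D 0)).add (h2.const_mul 4)).const_sub 1
  have hcard : ∀ N : ℕ, (Nat.card {e : IrrChar (WeylD N) × ConjClasses (WeylD N) //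
      EntryDivisible p e.1 e.2} : ℝ) + Nat.card {e : IrrChar (WeylD N) × ConjClasses (WeylD N) //
      ¬ EntryDivisible p e.1 e.2} =
      Nat.card (IrrChar (WeylD N)) * Nat.card (ConjClasses (WeylD N)) := by
    intro N
    classical
    rw [← Nat.cast_mul, ← Nat.card_prod, ← Nat.cast_add, ← Nat.card_sum]
    exact congrArg Nat.cast (Nat.card_congr (Equiv.sumCompl _))
  refine tendsto_of_tendsto_of_tendsto_of_le_of_le' hlim tendsto_const_nhds ?_ ?_
  · filter_upwards [hD, eventually_ge_atTop 2] with N ⟨R, hR, hpart, hmerge⟩ hN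
    have h := card_not_entryDivisible_le_mul (D := max D 0) hp (le_max_right _ _) hN hR
      (fun t ht => (hpart t ht).trans (by gcongr; exact le_max_left _ _)) hmerge
    have hpos : 0 < (Nat.card (IrrChar (WeylD N)) : ℝ) * Nat.card (ConjClasses (WeylD N)) := by
      have h1 : 0 < Nat.card (ConjClasses (WeylD N)) := Nat.card_pos
      have h2 : 0 < Nat.card (IrrChar (WeylD N)) := h1.trans_le IrrChar.card_conjClasses_le
      positivity
    rw [le_div_iff₀ hpos, sub_mul, one_mul, ← hcard N]
    rw [← hcard N] at h
    linarith
  · refine Eventually.of_forall fun N => div_le_one_of_le₀ ?_ (by positivity)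
    rw [← hcard N]
    exact le_add_of_nonneg_right (Nat.cast_nonneg _)
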